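/- arXiv:2201.09835 — 2 statements merged into one kernel-verified Lean document; each statement's English description precedes it below -/
import Mathlib

section
/- Let G be a finite simple graph and < a total order on its edge set. Then γ₂(G,<) = 0 if and only if either (i) G is a forest, or (ii) all but exactly one of the 2-connected components of G are single edges, and the remaining 2-connected component is isomorphic to K_4, to G_ℓ for some ℓ ≥ 3, or to K_{2,ℓ} for some ℓ ≥ 2. -/
open SimpleGraph Finset Filter

namespace SEP

/-- The vector `e_i - e_j` in `ℝ^n`. -/
def eVec {n : ℕ} (i j : Fin n) : Fin n → ℝ :=
  fun t => (if t = i then 1 else 0) - (if t = j then 1 else 0)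

/-- The symmetric edge polytope of a graph on `Fin n`. -/
def symEdgePolytope {n : ℕ} (G : SimpleGraph (Fin n)) : Set (Fin n → ℝ) :=
  convexHull ℝ {x | ∃ i j, G.Adj i j ∧ x = eVec i j}

/-- Both darts `a` and `b` are arcs of a common directed cycle of length `m` of `G`. -/
def dartsInCycle {V : Type*} (G : SimpleGraph V) (a b : G.Dart) (m : ℕ) : Prop :=
  ∃ (u : V) (w : G.Walk u u), w.IsCycle ∧ w.length = m ∧ a ∈ w.darts ∧ b ∈ w.darts

/-- `F` is a face of the polytope `P`: the set of maximizers of some linear functional. -/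
def IsFaceOfPolytope {n : ℕ} (P F : Set (Fin n → ℝ)) : Prop :=
  ∃ a : Fin n → ℝ,
    F = {x | x ∈ P ∧ ∀ y ∈ P, ∑ t, a t * y t ≤ ∑ t, a t * x t}

/-- Dimension of (the affine span of) a subset of `ℝ^n`. -/
noncomputable def polyDim {n : ℕ} (s : Set (Fin n → ℝ)) : ℕ :=
  Module.finrank ℝ (vectorSpan ℝ s)

/-- `v` is a vertex of the polytope `P`. -/
def IsVertexOfPolytope {n : ℕ} (P : Set (Fin n → ℝ)) (v : Fin n → ℝ) : Prop :=
  IsFaceOfPolytope P {v}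

/-- `F` is an edge (a 1-dimensional face) of the polytope `P`. -/
def IsEdgeOfPolytope {n : ℕ} (P F : Set (Fin n → ℝ)) : Prop :=
  IsFaceOfPolytope P F ∧ polyDim F = 1

/-- A polytope is simple if every vertex lies on exactly `dim P` edges. -/
def IsSimplePolytope {n : ℕ} (P : Set (Fin n → ℝ)) : Prop :=
  ∀ v, IsVertexOfPolytope P v →
    Set.ncard {F : Set (Fin n → ℝ) | IsEdgeOfPolytope P F ∧ v ∈ F} = polyDim P

/-- Two disjoint edges, on four vertices. -/
def twoDisjointEdges : SimpleGraph (Fin 4) :=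
  SimpleGraph.fromEdgeSet {s(0, 1), s(2, 3)}

/-- The cyclomatic number `|E| - |V| + c` of a graph, as an integer. -/
noncomputable def cyc {V : Type*} (G : SimpleGraph V) : ℤ :=
  (G.edgeSet.ncard : ℤ) + Nat.card G.ConnectedComponent - Nat.card V

/-- A graph is 2-connected: connected, with at least 3 vertices, and deleting any
single vertex leaves it connected. -/
def TwoConnected {V : Type*} (G : SimpleGraph V) : Prop :=
  G.Connected ∧ 3 ≤ Nat.card V ∧ ∀ v : V, (G.induce {u | u ≠ v}).Connected

/-- The subgraph `H` consists of a single edge of `G`. -/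
def IsSingleEdge {V : Type*} (G : SimpleGraph V) (H : G.Subgraph) : Prop :=
  ∃ (u v : V) (h : G.Adj u v), H = G.subgraphOfAdj h

/-- `H` is a 2-connected component (block) of `G`: an inclusion-maximal subgraph that is
2-connected or a single edge. -/
def IsBlock {V : Type*} (G : SimpleGraph V) (H : G.Subgraph) : Prop :=
  (TwoConnected H.coe ∨ IsSingleEdge G H) ∧
    ∀ H' : G.Subgraph, H ≤ H' → (TwoConnected H'.coe ∨ IsSingleEdge G H') → H' = H

/-- A pair of darts (oriented edges) of `G`, with distinct underlying edges, is *bad*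
with respect to the order `elt` on edges. -/
def BadPair {V : Type*} (G : SimpleGraph V) (elt : Sym2 V → Sym2 V → Prop)
    (a b : G.Dart) : Prop :=
  a.edge ≠ b.edge ∧
    (dartsInCycle G a b 3 ∨
      ∃ (u : V) (w : G.Walk u u), w.IsCycle ∧ w.length = 4 ∧ a ∈ w.darts ∧ b ∈ w.darts ∧
        (∃ e ∈ w.edges, elt e a.edge) ∧ (∃ e ∈ w.edges, elt e b.edge))

/-- `n₁(G, <)`: the number of (unordered) bad pairs of oriented edges. -/
noncomputable def n1 {V : Type*} (G : SimpleGraph V) (elt : Sym2 V → Sym2 V → Prop) : ℕ :=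
  Set.ncard {z : Sym2 G.Dart | ∃ a b, BadPair G elt a b ∧ z = s(a, b)}

/-- `γ₂(G, <) = 2 cy(G)(cy(G)+2) - n₁(G, <)`. -/
noncomputable def gammaTwo {V : Type*} (G : SimpleGraph V)
    (elt : Sym2 V → Sym2 V → Prop) : ℤ :=
  2 * cyc G * (cyc G + 2) - (n1 G elt : ℤ)

/-- Restriction of an order on `Sym2 V` to `Sym2 s` for `s : Set V`. -/
def restrictOrd {V : Type*} (elt : Sym2 V → Sym2 V → Prop) (s : Set V) :
    Sym2 s → Sym2 s → Prop :=
  fun e₁ e₂ => elt (e₁.map Subtype.val) (e₂.map Subtype.val)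

/-- The graph `G_n` on `Fin n`: vertices `0` and `1` are adjacent to everything. -/
def GnGraph (n : ℕ) : SimpleGraph (Fin n) :=
  SimpleGraph.fromRel (fun a _ => a.val < 2)

/-- The complete bipartite graph `K_{2, n-2}` on `Fin n`, with parts `{0,1}` and the rest. -/
def K2Graph (n : ℕ) : SimpleGraph (Fin n) :=
  SimpleGraph.fromRel (fun a b => a.val < 2 ∧ 2 ≤ b.val)

/-- A set `S` of darts of `G` is a face of the triangulation `Δ_<` of `∂P_G`. -/
def IsFace {V : Type*} (G : SimpleGraph V) (elt : Sym2 V → Sym2 V → Prop)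
    (S : Set G.Dart) : Prop :=
  (¬ ∃ d ∈ S, d.symm ∈ S) ∧
    ∀ ℓ : ℕ, 2 ≤ ℓ → ∀ (u : V) (w : G.Walk u u), w.IsCycle →
      (w.length = 2 * ℓ - 1 → Set.ncard {d ∈ S | d ∈ w.darts} < ℓ) ∧
      (w.length = 2 * ℓ →
        Set.ncard {d ∈ S | d ∈ w.darts ∧ ∃ e ∈ w.edges, elt e d.edge} < ℓ)

/-- The face complex `Δ_<` of `(G, <)`. -/
def faceCx {V : Type*} (G : SimpleGraph V) (elt : Sym2 V → Sym2 V → Prop) :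
    Set (Set G.Dart) :=
  {S | IsFace G elt S}

/-- The join of two simplicial complexes (given as families of faces on disjoint
vertex types). -/
def joinCx {A B : Type*} (F : Set (Set A)) (H : Set (Set B)) : Set (Set (A ⊕ B)) :=
  {S | ∃ F₁ ∈ F, ∃ H₁ ∈ H, S = Sum.inl '' F₁ ∪ Sum.inr '' H₁}

/-- The complex consisting of two disjoint vertices. -/
def twoPtCx : Set (Set (Fin 2)) :=
  {S | S = ∅ ∨ S = {0} ∨ S = {1}}

/-- Contraction of the edge `{v, w}` of a simplicial complex; `v` is identified with `w`. -/
def contractCx {A : Type*} (F : Set (Set A)) (v w : A) : Set (Set A) :=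
  {S | (S ∈ F ∧ v ∉ S) ∨ ∃ H ∈ F, v ∈ H ∧ S = (H \ {v}) ∪ {w}}

/-- Isomorphism of simplicial complexes: a bijection of vertex sets inducing a bijection
of faces. -/
def CxIso {A B : Type*} (F : Set (Set A)) (H : Set (Set B)) : Prop :=
  ∃ φ : A → B, Set.BijOn φ (⋃₀ F) (⋃₀ H) ∧
    (∀ S ∈ F, φ '' S ∈ H) ∧ (∀ T ∈ H, ∃ S ∈ F, φ '' S = T)

/-! ### Erdős–Rényi random graphs -/

/-- The probability weight of a fixed graph `G` in the Erdős–Rényi model `G(n,p)`. -/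
noncomputable def graphWeight (n : ℕ) (p : ℝ) (G : SimpleGraph (Fin n)) : ℝ :=
  p ^ G.edgeSet.ncard * (1 - p) ^ (n.choose 2 - G.edgeSet.ncard)

/-- The probability of an event `A` in the Erdős–Rényi model `G(n,p)`. -/
noncomputable def erProb (n : ℕ) (p : ℝ) (A : Set (SimpleGraph (Fin n))) : ℝ :=
  ∑ G : SimpleGraph (Fin n), A.indicator (graphWeight n p) G

/-- The expectation of a random variable in the Erdős–Rényi model `G(n,p)`. -/
noncomputable def erExp (n : ℕ) (p : ℝ) (X : SimpleGraph (Fin n) → ℝ) : ℝ :=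
  ∑ G : SimpleGraph (Fin n), graphWeight n p G * X G

/-- The variance of a random variable in the Erdős–Rényi model `G(n,p)`. -/
noncomputable def erVar (n : ℕ) (p : ℝ) (X : SimpleGraph (Fin n) → ℝ) : ℝ :=
  erExp n p (fun G => (X G - erExp n p X) ^ 2)

/-- The number of cycles of `G` with exactly `k` vertices, counted via their edge sets. -/
noncomputable def numCycles {V : Type*} (G : SimpleGraph V) (k : ℕ) : ℕ :=
  Set.ncard {s : Set (Sym2 V) |
    ∃ (u : V) (w : G.Walk u u), w.IsCycle ∧ w.length = k ∧ s = {e | e ∈ w.edges}}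

/-- `E(X_k) = C(n,k)·((k−1)!/2)·p^k`, the expected number of `k`-cycles. -/
noncomputable def expCycles (n : ℕ) (p : ℝ) (k : ℕ) : ℝ :=
  (n.choose k : ℝ) * ((Nat.factorial (k - 1) : ℝ) / 2) * p ^ k

/-- `E(X_E) = C(n,2)·p`, the expected number of edges. -/
noncomputable def expEdges (n : ℕ) (p : ℝ) : ℝ :=
  (n.choose 2 : ℝ) * p

/-- `n_{k-1}(G)`: the number of `k`-element non-faces of `Δ_<` containing no antipodal
pair. -/
noncomputable def numNonFaces {V : Type*} (G : SimpleGraph V)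
    (elt : Sym2 V → Sym2 V → Prop) (k : ℕ) : ℕ :=
  Set.ncard {S : Set G.Dart |
    S.ncard = k ∧ (¬ ∃ d ∈ S, d.symm ∈ S) ∧ ¬ IsFace G elt S}

/-- `f_{k-1}(G)`: the number of `k`-element faces of `Δ_<`. -/
noncomputable def numFaces {V : Type*} (G : SimpleGraph V)
    (elt : Sym2 V → Sym2 V → Prop) (k : ℕ) : ℕ :=
  Set.ncard {S : Set G.Dart | S.ncard = k ∧ IsFace G elt S}

/-- The generalized binomial coefficient `binom(x, ℓ)` for real `x`. -/
noncomputable def realChoose (x : ℝ) (ℓ : ℕ) : ℝ :=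
  (∏ i ∈ Finset.range ℓ, (x - i)) / (Nat.factorial ℓ)

/-- The recursively defined γ-numbers `γ_ℓ(G)`:
`γ_0 = 1` and
`γ_ℓ = f_{ℓ−1} − [t^{n−1−ℓ}] ∑_{i<ℓ} γ_i (t+1)^i (t+2)^{n−1−2i}`. -/
noncomputable def gammaRG (n : ℕ) (G : SimpleGraph (Fin n))
    (elt : Sym2 (Fin n) → Sym2 (Fin n) → Prop) : ℕ → ℤ := fun ℓ =>
  Nat.strongRecOn ℓ (fun ℓ ih =>
    if ℓ = 0 then (1 : ℤ)
    else
      (numFaces G elt ℓ : ℤ) -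
        Polynomial.coeff
          (∑ i ∈ (Finset.range ℓ).attach,
            Polynomial.C (ih i.1 (Finset.mem_range.mp i.2)) *
              ((Polynomial.X + 1) ^ (i.1 : ℕ) *
                (Polynomial.X + 2) ^ (n - 1 - 2 * i.1) : Polynomial ℤ))
          (n - 1 - ℓ))
section Cyclomatic

open scoped Classical

/-- The neighbours of `u` in `G`, as a finset. -/
noncomputable def nb {V : Type*} [Fintype V] (G : SimpleGraph V) (u : V) : Finset V :=
  univ.filter (G.Adj u)

@[simp]
theorem mem_nb {V : Type*} [Fintype V] {G : SimpleGraph V} {u z : V} :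
    z ∈ nb G u ↔ G.Adj u z := by
  simp [nb]

theorem sum_card_nb {V : Type*} [Fintype V] (G : SimpleGraph V) :
    ∑ u, #(nb G u) = 2 * G.edgeSet.ncard := by
  rw [← coe_edgeFinset, Set.ncard_coe_finset, ← G.sum_degrees_eq_twice_card_edges]
  refine Finset.sum_congr rfl fun u _ => ?_
  rw [← card_neighborFinset_eq_degree]
  congr 1
  ext z
  simp

theorem IsAcyclic.map_embedding {U V : Type*} {F : SimpleGraph U} (hF : F.IsAcyclic) (f : U ↪ V) :
    (F.map f).IsAcyclic := by
  rw [isAcyclic_iff_forall_adj_isBridge] at hF ⊢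
  intro x y hxy
  obtain ⟨-, a, b, hab, rfl, rfl⟩ := hxy
  have hbr := hF hab
  rw [isBridge_iff] at hbr ⊢
  refine fun hreach => hbr ?_
  have : Nonempty U := ⟨a⟩
  let g : (F.map f).deleteEdges {s(f a, f b)} →g F.deleteEdges {s(a, b)} :=
    { toFun := Function.invFun f
      map_rel' := by
        intro x y h
        rw [deleteEdges_adj] at h
        obtain ⟨⟨-, p, q, hpq, rfl, rfl⟩, hne⟩ := h
        rw [Function.leftInverse_invFun f.injective, Function.leftInverse_invFun f.injective,
          deleteEdges_adj]
        refine ⟨hpq, fun h => hne ?_⟩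
        have h := congrArg (Sym2.map f) (Set.mem_singleton_iff.1 h)
        simpa using h }
  have := hreach.map g
  simpa only [g, RelHom.coeFn_mk, Function.leftInverse_invFun f.injective _] using this

theorem IsTree.ncard_edgeSet {V : Type*} [Fintype V] {T : SimpleGraph V} (hT : T.IsTree) :
    T.edgeSet.ncard + 1 = Fintype.card V := by
  rw [← hT.card_edgeFinset, ← coe_edgeFinset, Set.ncard_coe_finset]

theorem IsAcyclic.ncard_edgeSet {V : Type*} [Fintype V] {F : SimpleGraph V} (hF : F.IsAcyclic) :
    F.edgeSet.ncard + Nat.card F.ConnectedComponent = Nat.card V := by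
  have key : ∀ c : F.ConnectedComponent,
      ∑ u with F.connectedComponentMk u = c, #(nb F u) + 2 =
        2 * #{u | F.connectedComponentMk u = c} := by
    intro c
    have h1 := IsTree.ncard_edgeSet (hF.isTree_connectedComponent c)
    have h2 := sum_card_nb c.toSimpleGraph
    have h3 : ∑ u with F.connectedComponentMk u = c, #(nb F u) =
        ∑ u : c, #(nb c.toSimpleGraph u) := by
      refine Finset.sum_bij'
        (fun u hu => ⟨u, (ConnectedComponent.mem_supp_iff c u).2 (by simpa using hu)⟩)
        (fun u _ => u.1)
        ?_ ?_ ?_ ?_ ?_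
      · simp
      · intro u _; simpa using (ConnectedComponent.mem_supp_iff c u.1).1 u.2
      · simp
      · simp
      · intro u hu
        refine Finset.card_bij' (fun z hz => ⟨z, ?_⟩) (fun z _ => z.1) ?_ ?_ ?_ ?_
        · have : F.Adj u z := by simpa using hz
          have h := ConnectedComponent.connectedComponentMk_eq_of_adj this
          have hu' : F.connectedComponentMk u = c := by simpa using hu
          exact (ConnectedComponent.mem_supp_iff c z).2 (h ▸ hu')
        · intro z hz; simpa [ConnectedComponent.toSimpleGraph] using hz
        · intro z hz; simpa [ConnectedComponent.toSimpleGraph] using hz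
        · simp
        · simp
    have h4 : #{u | F.connectedComponentMk u = c} = Fintype.card c := by
      rw [← Fintype.card_coe]
      exact Fintype.card_congr (Equiv.subtypeEquivRight fun x => by
        rw [Finset.mem_filter]
        exact ⟨fun h => (ConnectedComponent.mem_supp_iff c x).2 h.2,
          fun h => ⟨mem_univ _, (ConnectedComponent.mem_supp_iff c x).1 h⟩⟩)
    omega
  have h1 := Finset.sum_fiberwise (s := (univ : Finset V)) (fun u => F.connectedComponentMk u)
    (fun u => #(nb F u))
  have h2 := Finset.sum_congr rfl (fun c (_ : c ∈ (univ : Finset F.ConnectedComponent)) => key c)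
  rw [Finset.sum_add_distrib, ← Finset.mul_sum, h1, sum_card_nb] at h2
  have h3 := Finset.card_eq_sum_card_fiberwise (f := fun u => F.connectedComponentMk u)
    (s := (univ : Finset V)) (t := univ) (fun _ _ => by simp)
  rw [Finset.card_univ] at h3
  simp only [Nat.card_eq_fintype_card]
  simp only [Finset.sum_const, Finset.card_univ, smul_eq_mul] at h2
  have h4 : ∑ c, #{u | F.connectedComponentMk u = c} = Fintype.card V := by
    rw [h3]
  omega

theorem ncard_add_cyc_eq {V : Type*} [Fintype V] {F G : SimpleGraph V} (hF : F.IsAcyclic)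
    (hr : F.Reachable = G.Reachable) : (F.edgeSet.ncard : ℤ) + cyc G = G.edgeSet.ncard := by
  have h := IsAcyclic.ncard_edgeSet hF
  have hc : Nat.card F.ConnectedComponent = Nat.card G.ConnectedComponent := by
    unfold ConnectedComponent
    rw [hr]
  rw [cyc]
  omega

theorem exists_forest_of_acyclic_le {V : Type*} [Fintype V] {F G : SimpleGraph V} (hle : F ≤ G)
    (hF : F.IsAcyclic) : ∃ F', F ≤ F' ∧ F' ≤ G ∧ F'.IsAcyclic ∧ F'.Reachable = G.Reachable ∧
      cyc G = (G.edgeSet \ F'.edgeSet).ncard := by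
  obtain ⟨F', h1, h2, h3, h4⟩ :=
    G.exists_isAcyclic_reachable_eq_le_of_le_of_isAcyclic hle hF
  refine ⟨F', h1, h2, h3, h4, ?_⟩
  have h := ncard_add_cyc_eq h3 h4
  have h' := Set.ncard_sdiff_add_ncard_of_subset (edgeSet_subset_edgeSet.2 h2)
  omega

theorem ncard_add_cyc_le {V : Type*} [Fintype V] {F G : SimpleGraph V} (hle : F ≤ G)
    (hF : F.IsAcyclic) : (F.edgeSet.ncard : ℤ) + cyc G ≤ G.edgeSet.ncard := by
  obtain ⟨F', h1, h2, -, -, h5⟩ := exists_forest_of_acyclic_le hle hF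
  have h' := Set.ncard_sdiff_add_ncard_of_subset (edgeSet_subset_edgeSet.2 h2)
  have := Set.ncard_le_ncard (edgeSet_subset_edgeSet.2 h1)
  omega

theorem exists_forest {V : Type*} [Fintype V] (G : SimpleGraph V) : ∃ F ≤ G, F.IsAcyclic ∧
    F.Reachable = G.Reachable ∧ cyc G = (G.edgeSet \ F.edgeSet).ncard := by
  obtain ⟨F, -, h⟩ := exists_forest_of_acyclic_le (bot_le : ⊥ ≤ G) isAcyclic_bot
  exact ⟨F, h⟩

theorem cyc_nonneg {V : Type*} [Fintype V] (G : SimpleGraph V) : 0 ≤ cyc G := by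
  obtain ⟨F, -, -, -, h⟩ := exists_forest G
  omega

theorem cyc_eq_zero_iff {V : Type*} [Fintype V] {G : SimpleGraph V} :
    cyc G = 0 ↔ G.IsAcyclic := by
  constructor
  · intro h0
    obtain ⟨F, h1, h2, -, h⟩ := exists_forest G
    have : (G.edgeSet \ F.edgeSet) = ∅ := by
      rw [← Set.ncard_eq_zero]
      omega
    have hGF : G ≤ F := edgeSet_subset_edgeSet.1 (Set.sdiff_eq_empty.1 this)
    exact h2.anti hGF
  · intro h
    have := ncard_add_cyc_eq h rfl
    omega

/-- The cyclomatic number is monotone under (not necessarily induced) copies. -/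
theorem cyc_le_of_copy {U V : Type*} [Fintype U] [Fintype V] {D : SimpleGraph U}
    {G : SimpleGraph V} (f : Copy D G) : cyc D ≤ cyc G := by
  obtain ⟨T, h1, h2, h3, h4⟩ := exists_forest D
  have hle : T.map f.toEmbedding ≤ G := by
    rintro x y ⟨-, a, b, hab, rfl, rfl⟩
    exact f.toHom.map_adj (h1 hab)
  obtain ⟨F, k1, k2, k3, k4, k5⟩ :=
    exists_forest_of_acyclic_le hle (IsAcyclic.map_embedding h2 f.toEmbedding)
  rw [h4, k5]
  norm_cast
  refine Set.ncard_le_ncard_of_injOn (Sym2.map f) ?_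
    ((Sym2.map.injective f.injective).injOn) (Set.toFinite _)
  rintro e ⟨he, heT⟩
  induction e with | _ a b =>
  refine ⟨f.toHom.map_adj he, fun hF => heT ?_⟩
  have hmax := ((maximal_isAcyclic_iff_reachable_eq h1 h2).2 h3)
  have hac : (F.comap f.toEmbedding ⊓ D).IsAcyclic := (k3.of_comap f.toEmbedding).anti inf_le_left
  have hT : T ≤ F.comap f.toEmbedding ⊓ D :=
    le_inf (fun x y hxy => k1 ⟨f.injective.ne hxy.ne, x, y, hxy, rfl, rfl⟩) h1
  have := hmax.2 ⟨inf_le_right, hac⟩ hT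
  exact this ⟨hF, he⟩

theorem cyc_mono {V : Type*} [Fintype V] {X G : SimpleGraph V} (h : X ≤ G) : cyc X ≤ cyc G :=
  cyc_le_of_copy (Copy.ofLE X G h)

theorem sum_card_nb_inter_add_two_le {V : Type*} [Fintype V] (G : SimpleGraph V) (W : Finset V)
    (hW : W.Nonempty) : (∑ u ∈ W, #(nb G u ∩ W) : ℤ) + 2 ≤ 2 * #W + 2 * cyc G := by
  have h1 : cyc (G.induce (W : Set V)) ≤ cyc G := cyc_le_of_copy (Embedding.induce _).toCopy
  have h2 := sum_card_nb (G.induce (W : Set V))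
  have h3 : ∑ u ∈ W, #(nb G u ∩ W) = ∑ u : (W : Set V), #(nb (G.induce (W : Set V)) u) := by
    refine Finset.sum_bij' (fun u hu => ⟨u, by simpa using hu⟩) (fun u _ => u.1) ?_ ?_ ?_ ?_ ?_
    · simp
    · intro u _; simp
    · simp
    · simp
    · intro u hu
      refine Finset.card_bij' (fun z hz => ⟨z, ?_⟩) (fun z _ => z.1) ?_ ?_ ?_ ?_
      · simp at hz; exact hz.2
      · intro z hz; simp at hz; simpa using hz.1
      · intro z hz; simp at hz; simpa using hz
      · simp
      · simp
  have : Nonempty (W : Set V) := hW.to_subtype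
  have h4 : 0 < Nat.card (G.induce (W : Set V)).ConnectedComponent := Nat.card_pos
  have h5 : Nat.card (W : Set V) = #W := by simp
  rw [cyc] at h1
  rw [← Nat.cast_sum]
  omega

theorem cyc_deleteEdges_of_not_isBridge {V : Type*} [Fintype V] {G : SimpleGraph V} {e : Sym2 V}
    (he : e ∈ G.edgeSet) (h : ¬ G.IsBridge e) : cyc (G.deleteEdges {e}) < cyc G := by
  obtain ⟨F, h1, h2, h3, -⟩ := exists_forest (G.deleteEdges {e})
  have h4 := ncard_add_cyc_eq h2 h3
  have h5 : F.Reachable = G.Reachable := by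
    rw [h3]
    have key : ∀ x y, G.Adj x y → (G.deleteEdges {e}).Reachable x y := by
      intro x y hxy
      by_cases hxe : s(x, y) = e
      · subst hxe
        rwa [isBridge_iff, not_not] at h
      · exact Adj.reachable (by simp [deleteEdges_adj, hxy, hxe])
    ext x y
    refine ⟨fun h => h.mono (deleteEdges_le _), ?_⟩
    rintro ⟨p⟩
    induction p with
    | nil => exact Reachable.refl _
    | cons hadj _ ih => exact (key _ _ hadj).trans ih
  have h6 := ncard_add_cyc_eq h2 h5
  have h7 : (G.deleteEdges {e}).edgeSet.ncard < G.edgeSet.ncard := by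
    refine Set.ncard_lt_ncard ?_
    rw [edgeSet_deleteEdges]
    exact ⟨Set.sdiff_subset, fun h => (h he).2 rfl⟩
  omega

end Cyclomatic

section Counting

open scoped Classical

variable {V : Type*} [Fintype V]

/-- Common neighbours of two vertices. -/
noncomputable def cn (G : SimpleGraph V) (u w : V) : Finset V := nb G u ∩ nb G w

@[simp]
theorem mem_cn {G : SimpleGraph V} {u w z : V} : z ∈ cn G u w ↔ G.Adj u z ∧ G.Adj w z := by
  simp [cn]

theorem cn_comm (G : SimpleGraph V) (u w : V) : cn G u w = cn G w u := inter_comm _ _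

/-- The contribution of an ordered pair of vertices to four times the number of bad pairs. -/
noncomputable def pairWeight (G : SimpleGraph V) (u w : V) : ℕ :=
  if u = w then 0 else
    #(cn G u w) * (#(cn G u w) - 1) +
      4 * (if G.Adj u w then #(cn G u w) else #(cn G u w) - 1)

/-- Four times the number of bad pairs, expressed through common neighbours. -/
noncomputable def totalWeight (G : SimpleGraph V) : ℕ := ∑ u, ∑ w, pairWeight G u w

/-- The number of paths of length one or two between two distinct vertices. -/
noncomputable def shortPaths (G : SimpleGraph V) (u w : V) : ℕ :=
  #(cn G u w) + if G.Adj u w then 1 else 0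

theorem sum_card_nb_inter_le (G : SimpleGraph V) (N : Finset V) (hN : N.Nonempty) :
    ((∑ z ∈ N, #(nb G z ∩ N) + 2 * ∑ z ∈ Nᶜ, (#(nb G z ∩ N) - 1) : ℕ) : ℤ) + 2 ≤
      2 * #N + 2 * cyc G := by
  set Z : Finset V := Nᶜ.filter fun z => 0 < #(nb G z ∩ N) with hZ
  have hdisj : Disjoint N Z := by
    rw [Finset.disjoint_left]
    intro z hz hz'
    simp [hZ, hz] at hz'
  have h := sum_card_nb_inter_add_two_le G (N ∪ Z) (hN.mono subset_union_left)
  rw [card_union_of_disjoint hdisj] at h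
  have h1 : ∑ z ∈ N, #(nb G z ∩ N) + ∑ z ∈ N, #(nb G z ∩ Z) ≤
      ∑ u ∈ N, #(nb G u ∩ (N ∪ Z)) := by
    rw [← Finset.sum_add_distrib]
    refine Finset.sum_le_sum fun z _ => ?_
    rw [inter_union_distrib_left, card_union_of_disjoint]
    exact hdisj.mono inter_subset_right inter_subset_right
  have h2 : ∑ z ∈ Z, #(nb G z ∩ N) ≤ ∑ u ∈ Z, #(nb G u ∩ (N ∪ Z)) :=
    Finset.sum_le_sum fun z _ => card_le_card (inter_subset_inter_left subset_union_left)
  have h3 : ∑ z ∈ N, #(nb G z ∩ Z) = ∑ z ∈ Z, #(nb G z ∩ N) := by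
    have := Finset.sum_card_bipartiteAbove_eq_sum_card_bipartiteBelow (s := N) (t := Z) G.Adj
    convert this using 3
    · ext; simp [bipartiteAbove, and_comm]
    · ext; simp [bipartiteBelow, and_comm, G.adj_comm]
  have h4 : ∑ z ∈ Nᶜ, (#(nb G z ∩ N) - 1) = ∑ z ∈ Z, (#(nb G z ∩ N) - 1) := by
    refine (Finset.sum_subset (filter_subset _ _) fun z hz hz' => ?_).symm
    simp only [mem_filter, not_and, not_lt] at hz'
    have := hz' hz
    omega
  have h5 : ∑ z ∈ Z, (#(nb G z ∩ N) - 1) + #Z = ∑ z ∈ Z, #(nb G z ∩ N) := by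
    rw [card_eq_sum_ones, ← Finset.sum_add_distrib]
    refine Finset.sum_congr rfl fun z hz => ?_
    have := (mem_filter.1 hz).2
    omega
  rw [Finset.sum_union hdisj] at h
  rw [h4]
  push_cast at h h1 h2 h3 h5 ⊢
  zify at h1 h2 h3 h5
  linarith

theorem sum_card_cn_le (G : SimpleGraph V) (x : V) :
    ((∑ z ∈ nb G x, #(cn G x z) + 2 * ∑ y ∈ (insert x (nb G x))ᶜ, (#(cn G x y) - 1) : ℕ) : ℤ) ≤
      2 * cyc G := by
  have h := sum_card_nb_inter_le G (insert x (nb G x)) (insert_nonempty _ _)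
  have hx : x ∉ nb G x := by simp
  rw [Finset.sum_insert hx, card_insert_of_notMem hx] at h
  have h1 : nb G x ∩ insert x (nb G x) = nb G x := inter_eq_left.2 (subset_insert _ _)
  have h2 : ∑ z ∈ nb G x, #(nb G z ∩ insert x (nb G x)) = ∑ z ∈ nb G x, #(cn G x z) + #(nb G x) := by
    rw [card_eq_sum_ones, ← Finset.sum_add_distrib]
    refine Finset.sum_congr rfl fun z hz => ?_
    rw [inter_insert_of_mem (by simpa [G.adj_comm] using hz), card_insert_of_notMem (by simp), cn,
      inter_comm]
  have h3 : ∑ y ∈ (insert x (nb G x))ᶜ, (#(nb G y ∩ insert x (nb G x)) - 1) =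
      ∑ y ∈ (insert x (nb G x))ᶜ, (#(cn G x y) - 1) := by
    refine Finset.sum_congr rfl fun z hz => ?_
    simp only [mem_compl, mem_insert, not_or, mem_nb] at hz
    rw [inter_insert_of_notMem (by simpa [G.adj_comm] using hz.2), cn, inter_comm]
  rw [h1, h2, h3] at h
  push_cast at h ⊢
  linarith

theorem shortPaths_le (G : SimpleGraph V) {x y : V} (hxy : x ≠ y) :
    (shortPaths G x y : ℤ) ≤ cyc G + 1 := by
  have h := sum_card_nb_inter_le G {x, y} (insert_nonempty _ _)
  rw [Finset.sum_pair hxy, card_pair hxy] at h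
  have h1 : ∀ a b : V, nb G a ∩ {a, b} = if G.Adj a b then {b} else ∅ := by
    intro a b
    ext z
    split_ifs with hab
    · simp; grind [SimpleGraph.irrefl]
    · simp; grind [SimpleGraph.irrefl]
  have h2 : #(cn G x y) ≤ ∑ z ∈ ({x, y} : Finset V)ᶜ, (#(nb G z ∩ {x, y}) - 1) := by
    rw [card_eq_sum_ones]
    refine (Finset.sum_le_sum (f := fun _ => 1) (g := fun z => #(nb G z ∩ {x, y}) - 1) ?_).trans
      (Finset.sum_le_sum_of_subset ?_)
    · intro z hz
      rw [mem_cn, G.adj_comm, G.adj_comm y] at hz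
      have : nb G z ∩ {x, y} = {x, y} := by
        rw [inter_eq_right]
        intro a
        simp only [mem_insert, mem_singleton, mem_nb]
        rintro (rfl | rfl)
        exacts [hz.1, hz.2]
      rw [this, card_pair hxy]
    · intro z hz
      rw [mem_cn] at hz
      simp only [mem_compl, mem_insert, mem_singleton, not_or]
      exact ⟨hz.1.ne', hz.2.ne'⟩
  rw [h1 x y, pair_comm x y, h1 y x] at h
  rw [pair_comm] at h2
  rw [shortPaths]
  by_cases hadj : G.Adj x y
  · simp only [if_pos hadj, if_pos hadj.symm, card_singleton] at h ⊢
    push_cast at h ⊢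
    zify at h2
    linarith
  · simp only [if_neg hadj, if_neg (fun h : G.Adj y x => hadj h.symm), card_empty] at h ⊢
    push_cast at h ⊢
    zify at h2
    linarith

theorem sum_shortPaths_le (G : SimpleGraph V) (x : V) (N : Finset V) (hx : x ∉ N) :
    ((∑ y ∈ N, (shortPaths G x y - 1) : ℕ) : ℤ) ≤ 2 * cyc G := by
  refine le_trans ?_ (sum_card_cn_le G x)
  norm_cast
  rw [← Finset.sum_filter_add_sum_filter_not N (fun y => G.Adj x y)]
  refine add_le_add ?_ ((Nat.le_mul_of_pos_left _ two_pos).trans' ?_)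
  · refine le_trans (Finset.sum_le_sum (g := fun y => #(cn G x y)) ?_)
      (Finset.sum_le_sum_of_subset ?_)
    · intro y hy
      simp [shortPaths, (mem_filter.1 hy).2]
    · intro y hy
      simpa using (mem_filter.1 hy).2
  · refine le_trans (Finset.sum_le_sum (g := fun y => #(cn G x y) - 1) ?_)
      (Finset.sum_le_sum_of_subset ?_)
    · intro y hy
      simp [shortPaths, (mem_filter.1 hy).2]
    · intro y hy
      rw [mem_filter] at hy
      simp only [mem_compl, mem_insert, not_or, mem_nb]
      exact ⟨fun h => hx (h ▸ hy.1), hy.2⟩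

end Counting

section VertexDeletion

open scoped Classical

variable {V : Type*} [Fintype V]

theorem nb_deleteIncidenceSet_self (G : SimpleGraph V) (v : V) :
    nb (G.deleteIncidenceSet v) v = ∅ := by
  ext; simp [deleteIncidenceSet_adj]

theorem cn_eq_of_ne (G : SimpleGraph V) {v u w : V} (hu : u ≠ v) (hw : w ≠ v) :
    #(cn G u w) = #(cn (G.deleteIncidenceSet v) u w) +
      if u ∈ nb G v ∧ w ∈ nb G v then 1 else 0 := by
  split_ifs with h
  · have : cn G u w = insert v (cn (G.deleteIncidenceSet v) u w) := by
      ext z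
      simp only [mem_cn, mem_insert, deleteIncidenceSet_adj, mem_nb] at h ⊢
      by_cases hz : z = v
      · subst hz; simp [h.1.symm, h.2.symm]
      · simp [hz, hu, hw]
    rw [this, card_insert_of_notMem (by simp [deleteIncidenceSet_adj])]
  · have : cn G u w = cn (G.deleteIncidenceSet v) u w := by
      ext z
      simp only [mem_cn, deleteIncidenceSet_adj, mem_nb, G.adj_comm v] at h ⊢
      by_cases hz : z = v
      · subst hz; simpa using h
      · simp [hz, hu, hw]
    rw [this, add_zero]

theorem cn_self_eq (G : SimpleGraph V) {v w : V} (hw : w ≠ v) :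
    cn G v w = nb (G.deleteIncidenceSet v) w ∩ nb G v := by
  ext z
  simp only [mem_cn, mem_inter, mem_nb, deleteIncidenceSet_adj]
  constructor
  · exact fun h => ⟨⟨h.2, hw, h.1.ne'⟩, h.1⟩
  · exact fun h => ⟨h.2, h.1.1⟩

/-- The increase of `pairWeight` at a pair when a common neighbour is added. -/
noncomputable def pairGain (G : SimpleGraph V) (u w : V) : ℕ :=
  2 * #(cn G u w) + 4 * (if G.Adj u w ∨ 0 < #(cn G u w) then 1 else 0)

/-- The weight of the pair formed by `z` and a new vertex with neighbours `N`. -/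
noncomputable def starWeight (G : SimpleGraph V) (N : Finset V) (z : V) : ℕ :=
  #(nb G z ∩ N) * (#(nb G z ∩ N) - 1) +
    4 * (if z ∈ N then #(nb G z ∩ N) else #(nb G z ∩ N) - 1)

theorem pairWeight_self_left (G : SimpleGraph V) {v w : V} (hw : w ≠ v) :
    pairWeight G v w = starWeight (G.deleteIncidenceSet v) (nb G v) w := by
  rw [pairWeight, if_neg hw.symm, cn_self_eq G hw, starWeight]
  simp only [mem_nb]

theorem pairWeight_comm (G : SimpleGraph V) (u w : V) : pairWeight G u w = pairWeight G w u := by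
  simp only [pairWeight, cn_comm G u w, G.adj_comm u w, eq_comm]

theorem pairWeight_eq (G : SimpleGraph V) (v u w : V) :
    pairWeight G u w = pairWeight (G.deleteIncidenceSet v) u w +
      (if u ≠ w ∧ u ∈ nb G v ∧ w ∈ nb G v then
        pairGain (G.deleteIncidenceSet v) u w else 0) +
      (if u = v then starWeight (G.deleteIncidenceSet v) (nb G v) w else 0) +
      (if w = v then starWeight (G.deleteIncidenceSet v) (nb G v) u else 0) := by
  have hv : v ∉ nb G v := by simp
  have hs : starWeight (G.deleteIncidenceSet v) (nb G v) v = 0 := by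
    simp [starWeight, nb_deleteIncidenceSet_self]
  have h0 : ∀ w, pairWeight (G.deleteIncidenceSet v) v w = 0 := by
    intro w
    simp [pairWeight, cn, nb_deleteIncidenceSet_self]
  rcases eq_or_ne u w with rfl | huw
  · rcases eq_or_ne u v with rfl | hu
    · simp [pairWeight, hs]
    · simp [pairWeight, hu]
  rcases eq_or_ne u v with rfl | hu
  · rw [pairWeight_self_left G huw.symm, h0]
    simp [huw.symm]
  rcases eq_or_ne w v with rfl | hw
  · rw [pairWeight_comm, pairWeight_self_left G hu, pairWeight_comm, h0]
    simp [hu]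
  rw [if_neg hu, if_neg hw, pairWeight, pairWeight, if_neg huw, if_neg huw, cn_eq_of_ne G hu hw]
  have hadj : (G.deleteIncidenceSet v).Adj u w ↔ G.Adj u w := by
    simp [deleteIncidenceSet_adj, hu, hw]
  simp only [hadj, pairGain]
  obtain ⟨m, hm⟩ : ∃ m, m = #(cn (G.deleteIncidenceSet v) u w) := ⟨_, rfl⟩
  simp only [← hm]
  by_cases hN : u ∈ nb G v ∧ w ∈ nb G v
  · simp only [hN, huw, ne_eq, not_false_eq_true, and_self, if_true]
    rcases m with _ | m
    · by_cases h : G.Adj u w <;> simp [h]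
    · by_cases h : G.Adj u w <;> simp [h] <;> ring
  · simp only [hN, and_false, if_false, add_zero]

theorem sum_card_mul_pred (G : SimpleGraph V) (N : Finset V) :
    ∑ z, #(nb G z ∩ N) * (#(nb G z ∩ N) - 1) = ∑ p ∈ N.offDiag, #(cn G p.1 p.2) := by
  have h1 : ∀ z, #(nb G z ∩ N) * (#(nb G z ∩ N) - 1) =
      #(N.offDiag.filter fun p => z ∈ cn G p.1 p.2) := by
    intro z
    rw [Nat.mul_sub_one, ← offDiag_card]
    congr 1
    ext ⟨a, b⟩
    simp only [mem_offDiag, mem_inter, mem_nb, mem_filter, mem_cn, G.adj_comm z]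
    tauto
  simp only [h1, card_filter]
  rw [Finset.sum_comm]
  refine Finset.sum_congr rfl fun p _ => ?_
  rw [← card_filter]
  congr 1
  ext; simp

theorem totalWeight_eq (G : SimpleGraph V) (v : V) :
    totalWeight G = totalWeight (G.deleteIncidenceSet v) +
      ∑ p ∈ (nb G v).offDiag, pairGain (G.deleteIncidenceSet v) p.1 p.2 +
      2 * ∑ z, starWeight (G.deleteIncidenceSet v) (nb G v) z := by
  simp only [totalWeight, pairWeight_eq G v, Finset.sum_add_distrib]
  have h1 : ∑ u, ∑ w, (if u ≠ w ∧ u ∈ nb G v ∧ w ∈ nb G v then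
      pairGain (G.deleteIncidenceSet v) u w else 0) =
      ∑ p ∈ (nb G v).offDiag, pairGain (G.deleteIncidenceSet v) p.1 p.2 := by
    rw [← Fintype.sum_prod_type' (f := fun u w => if u ≠ w ∧ u ∈ nb G v ∧ w ∈ nb G v then
      pairGain (G.deleteIncidenceSet v) u w else 0), ← Finset.sum_filter]
    refine Finset.sum_congr ?_ fun _ _ => rfl
    ext ⟨a, b⟩
    simp only [mem_filter, mem_univ, true_and, mem_offDiag]
    tauto
  rw [h1]
  have h2 : ∑ u, ∑ w, (if u = v then starWeight (G.deleteIncidenceSet v) (nb G v) w else 0) =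
      ∑ z, starWeight (G.deleteIncidenceSet v) (nb G v) z := by
    rw [Finset.sum_comm]; simp
  rw [h2]
  simp only [Finset.sum_ite_eq', mem_univ, if_true]
  ring

theorem totalWeight_add_le (G : SimpleGraph V) (v : V) (hN : (nb G v).Nonempty) :
    ((totalWeight G + 8 * #((nb G v).offDiag.filter
        fun p => shortPaths (G.deleteIncidenceSet v) p.1 p.2 = 0) : ℕ) : ℤ) ≤
      totalWeight (G.deleteIncidenceSet v) + 8 * (#(nb G v) ^ 2 - 1) +
        8 * cyc (G.deleteIncidenceSet v) +
        4 * (∑ p ∈ (nb G v).offDiag, (shortPaths (G.deleteIncidenceSet v) p.1 p.2 - 1) : ℕ) := by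
  have h1 := totalWeight_eq G v
  have h2 := sum_card_mul_pred (G.deleteIncidenceSet v) (nb G v)
  have h3 := sum_card_nb_inter_le (G.deleteIncidenceSet v) (nb G v) hN
  set G' := G.deleteIncidenceSet v
  set N := nb G v
  have h4 : ∑ z ∈ N, #(nb G' z ∩ N) = ∑ p ∈ N.offDiag, if G'.Adj p.1 p.2 then 1 else 0 := by
    rw [← card_filter]
    have : ∀ z ∈ N, #(nb G' z ∩ N) = #((N.offDiag.filter fun p => G'.Adj p.1 p.2).filter
        fun p => p.1 = z) := by
      intro z hz
      refine card_bij (fun b _ => (z, b)) ?_ ?_ ?_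
      · intro b hb
        simp only [mem_inter, mem_nb, mem_filter, mem_offDiag] at hb ⊢
        exact ⟨⟨⟨hz, hb.2, hb.1.ne⟩, hb.1⟩, trivial⟩
      · simp
      · rintro ⟨a, b⟩ hb
        simp only [mem_filter, mem_offDiag] at hb
        obtain ⟨⟨⟨h1, h2, h3⟩, h4⟩, rfl⟩ := hb
        exact ⟨b, by simp [h2, h4], rfl⟩
    rw [Finset.sum_congr rfl this]
    refine (card_eq_sum_card_fiberwise fun p hp => ?_).symm
    simp at hp
    exact hp.1.1
  have h5 : ∑ z, (if z ∈ N then #(nb G' z ∩ N) else #(nb G' z ∩ N) - 1) =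
      ∑ z ∈ N, #(nb G' z ∩ N) + ∑ z ∈ Nᶜ, (#(nb G' z ∩ N) - 1) := by
    rw [← Finset.sum_add_sum_compl N]
    congr 1
    · exact Finset.sum_congr rfl fun z hz => if_pos hz
    · exact Finset.sum_congr rfl fun z hz => if_neg (mem_compl.1 hz)
  have h6 : ∑ z, starWeight G' N z = ∑ p ∈ N.offDiag, #(cn G' p.1 p.2) +
      4 * (∑ z ∈ N, #(nb G' z ∩ N) + ∑ z ∈ Nᶜ, (#(nb G' z ∩ N) - 1)) := by
    simp only [starWeight, Finset.sum_add_distrib, ← Finset.mul_sum]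
    rw [h2, h5]
  have h7 : ∑ p ∈ N.offDiag, pairGain G' p.1 p.2 +
      2 * ∑ p ∈ N.offDiag, #(cn G' p.1 p.2) + 4 * ∑ z ∈ N, #(nb G' z ∩ N) +
      8 * #(N.offDiag.filter fun p => shortPaths G' p.1 p.2 = 0) =
      ∑ p ∈ N.offDiag, 8 + 4 * ∑ p ∈ N.offDiag, (shortPaths G' p.1 p.2 - 1) := by
    rw [h4, card_filter]
    simp only [Finset.mul_sum, ← Finset.sum_add_distrib]
    refine Finset.sum_congr rfl fun p _ => ?_
    simp only [pairGain, shortPaths]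
    obtain ⟨m, hm⟩ : ∃ m, m = #(cn G' p.1 p.2) := ⟨_, rfl⟩
    simp only [← hm]
    by_cases h : G'.Adj p.1 p.2
    · simp [h]; omega
    · rcases m with _ | m
      · simp [h]
      · simp [h]; omega
  rw [Finset.sum_const, offDiag_card, smul_eq_mul] at h7
  rw [h6] at h1
  have h8 : #N ≤ #N * #N := Nat.le_mul_self _
  zify [h8] at h1 h3 h7 ⊢
  linarith

end VertexDeletion

section UpperBound

open scoped Classical

variable {V : Type*}

theorem IsAcyclic.exists_center {G : SimpleGraph V} (hG : G.IsAcyclic) (N : Finset V)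
    (hN : 2 ≤ #N)
    (h : ∀ x ∈ N, ∀ y ∈ N, x ≠ y → G.Adj x y ∨ ∃ z, G.Adj x z ∧ G.Adj y z) :
    ∃ z, ∀ x ∈ N, x ≠ z → G.Adj z x := by
  have c3 : ∀ a b c, G.Adj a b → G.Adj b c → G.Adj c a → False := by
    intro a b c h1 h2 h3
    refine hG (.cons h1 (.cons h2 (.cons h3 .nil))) ?_
    have := h1.ne; have := h2.ne; have := h3.ne
    simp [Walk.cons_isCycle_iff, Walk.cons_isPath_iff]
    grind
  have c4 : ∀ a b c d, G.Adj a b → G.Adj b c → G.Adj c d → G.Adj d a → a ≠ c → b ≠ d → False := by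
    intro a b c d h1 h2 h3 h4 h5 h6
    refine hG (.cons h1 (.cons h2 (.cons h3 (.cons h4 .nil)))) ?_
    have := h1.ne; have := h2.ne; have := h3.ne; have := h4.ne
    simp [Walk.cons_isCycle_iff, Walk.cons_isPath_iff]
    grind
  have c5 : ∀ a b c d e, G.Adj a b → G.Adj b c → G.Adj c d → G.Adj d e → G.Adj e a → a ≠ c →
      a ≠ d → b ≠ d → b ≠ e → c ≠ e → False := by
    intro a b c d e h1 h2 h3 h4 h5 h6 h7 h8 h9 h10
    refine hG (.cons h1 (.cons h2 (.cons h3 (.cons h4 (.cons h5 .nil))))) ?_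
    have := h1.ne; have := h2.ne; have := h3.ne; have := h4.ne; have := h5.ne
    simp [Walk.cons_isCycle_iff, Walk.cons_isPath_iff]
    grind
  have c6 : ∀ a b c d e f, G.Adj a b → G.Adj b c → G.Adj c d → G.Adj d e → G.Adj e f → G.Adj f a →
      a ≠ c → a ≠ d → a ≠ e → b ≠ d → b ≠ e → b ≠ f → c ≠ e → c ≠ f → d ≠ f → False := by
    intro a b c d e f h1 h2 h3 h4 h5 h6 h7 h8 h9 h10 h11 h12 h13 h14 h15
    refine hG (.cons h1 (.cons h2 (.cons h3 (.cons h4 (.cons h5 (.cons h6 .nil)))))) ?_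
    have := h1.ne; have := h2.ne; have := h3.ne; have := h4.ne; have := h5.ne; have := h6.ne
    simp [Walk.cons_isCycle_iff, Walk.cons_isPath_iff]
    grind
  by_cases hind : ∃ x ∈ N, ∃ y ∈ N, G.Adj x y
  · obtain ⟨x, hx, y, hy, hxy⟩ := hind
    have key : ∀ w ∈ N, w ≠ x → w ≠ y → G.Adj w x ∨ G.Adj w y := by
      intro w hw hwx hwy
      by_contra! hcon
      obtain ⟨a, ha, ha'⟩ := (h w hw x hx hwx).resolve_left hcon.1
      obtain ⟨b, hb, hb'⟩ := (h w hw y hy hwy).resolve_left hcon.2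
      rcases eq_or_ne a b with rfl | hab
      · exact c3 x y a hxy hb' ha'.symm
      · exact c5 x a w b y ha' ha.symm hb hb'.symm hxy.symm hwx.symm
          (by rintro rfl; exact hcon.1 hb) hab (by rintro rfl; exact hcon.2 ha) hwy
    by_cases hall : ∀ w ∈ N, w ≠ x → G.Adj x w
    · exact ⟨x, hall⟩
    · push Not at hall
      obtain ⟨w, hw, hwx, hnw⟩ := hall
      have hwy : w ≠ y := by rintro rfl; exact hnw hxy
      have hwy' : G.Adj w y := (key w hw hwx hwy).resolve_left fun h => hnw h.symm
      refine ⟨y, fun u hu huy => ?_⟩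
      by_contra hnu
      have hux : u ≠ x := by rintro rfl; exact hnu hxy.symm
      have hux' : G.Adj u x := (key u hu hux huy).resolve_right fun h => hnu h.symm
      have huw : u ≠ w := by rintro rfl; exact hnu hwy'.symm
      rcases h u hu w hw huw with h' | ⟨b, hb, hb'⟩
      · exact c4 u x y w hux' hxy hwy'.symm h'.symm huy hwx.symm
      · exact c5 u x y w b hux' hxy hwy'.symm hb' hb.symm huy huw hwx.symm
          (by rintro rfl; exact hnw hb'.symm) (by rintro rfl; exact hnu hb.symm)
  · push Not at hind
    obtain ⟨x, hx, y, hy, hxy⟩ := one_lt_card.1 hN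
    obtain ⟨z, hz, hz'⟩ := (h x hx y hy hxy).resolve_left (hind x hx y hy)
    refine ⟨z, fun w hw hwz => ?_⟩
    by_contra hnw
    have hwx : w ≠ x := by rintro rfl; exact hnw hz.symm
    have hwy : w ≠ y := by rintro rfl; exact hnw hz'.symm
    obtain ⟨a, ha, ha'⟩ := (h w hw x hx hwx).resolve_left (hind w hw x hx)
    obtain ⟨b, hb, hb'⟩ := (h w hw y hy hwy).resolve_left (hind w hw y hy)
    have haz : a ≠ z := by rintro rfl; exact hnw ha.symm
    have hbz : b ≠ z := by rintro rfl; exact hnw hb.symm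
    rcases eq_or_ne a b with rfl | hab
    · exact c4 x z y a hz hz'.symm hb' ha'.symm hxy haz.symm
    · exact c6 x z y b w a hz hz'.symm hb' hb.symm ha ha'.symm hxy
        (by rintro rfl; exact hind _ hw _ hx hb) hwx.symm hbz.symm hwz.symm haz.symm hwy.symm
        (by rintro rfl; exact hind _ hw _ hy ha) hab.symm

variable [Fintype V]

theorem ncard_edgeSet_deleteIncidenceSet (G : SimpleGraph V) (v : V) :
    (G.deleteIncidenceSet v).edgeSet.ncard + #(nb G v) = G.edgeSet.ncard := by
  have h := G.card_edgeFinset_deleteIncidenceSet v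
  have h2 : #(nb G v) = G.degree v := by
    rw [← card_neighborFinset_eq_degree]; congr 1; ext; simp
  have h3 := G.degree_le_card_edgeFinset v
  rw [← coe_edgeFinset, ← coe_edgeFinset, Set.ncard_coe_finset, Set.ncard_coe_finset]
  rw [h2]
  omega

theorem exists_cyc_deleteIncidenceSet_le {G : SimpleGraph V} (hG : G ≠ ⊥) :
    ∃ v, (nb G v).Nonempty ∧ cyc (G.deleteIncidenceSet v) + #(nb G v) ≤ cyc G + 1 := by
  obtain ⟨F, hFG, hF, hr, -⟩ := exists_forest G
  set W : Finset V := univ.filter fun u => (nb F u).Nonempty with hW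
  have hWne : W.Nonempty := by
    by_contra hcon
    have hbot : F = ⊥ := by
      ext a b
      simp only [bot_adj, iff_false]
      intro hab
      exact hcon ⟨a, by simpa [hW] using ⟨b, by simpa using hab⟩⟩
    apply hG
    ext a b
    simp only [bot_adj, iff_false]
    intro hab
    have : F.Reachable a b := hr ▸ hab.reachable
    rw [hbot, reachable_bot] at this
    exact hab.ne this
  have h := sum_card_nb_inter_add_two_le F W hWne
  rw [cyc_eq_zero_iff.2 hF] at h
  obtain ⟨v, hv, hv1⟩ : ∃ v ∈ W, #(nb F v) < 2 := by
    by_contra! hcon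
    have h1 : ∑ u ∈ W, 2 ≤ ∑ u ∈ W, #(nb F u ∩ W) := by
      refine Finset.sum_le_sum fun u hu => ?_
      rw [inter_eq_left.2]
      · exact hcon u hu
      · intro b hb
        simp only [hW, mem_filter, mem_univ, true_and]
        exact ⟨u, by simpa [F.adj_comm] using hb⟩
    rw [Finset.sum_const, smul_eq_mul] at h1
    zify at h1
    linarith
  have hv0 : (nb F v).Nonempty := (mem_filter.1 hv).2
  refine ⟨v, hv0.mono fun b hb => by simp at hb ⊢; exact hFG hb, ?_⟩
  have h1 := ncard_edgeSet_deleteIncidenceSet F v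
  have h2 := ncard_edgeSet_deleteIncidenceSet G v
  have h3 := ncard_add_cyc_eq hF hr
  have h4 : F.deleteIncidenceSet v ≤ G.deleteIncidenceSet v := by
    intro a b
    simp only [deleteIncidenceSet_adj]
    exact fun h => ⟨hFG h.1, h.2⟩
  have h5 := ncard_add_cyc_le h4 (hF.anti (F.deleteIncidenceSet_le v))
  have h6 := hv0.card_pos
  omega

end UpperBound

section Extremal

open scoped Classical

variable {V : Type*} [Fintype V]

/-- `G` contains a copy of `K_{2,ℓ}`, `G_ℓ` or `K_4` with the same cyclomatic number. -/
def HasFullCore (G : SimpleGraph V) : Prop :=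
  (∃ p q, ∃ S : Finset V, p ≠ q ∧ S ⊆ cn G p q ∧ 2 ≤ #S ∧ cyc G + 1 = #S) ∨
  (∃ p q, ∃ S : Finset V, G.Adj p q ∧ S ⊆ cn G p q ∧ 1 ≤ #S ∧ cyc G = #S) ∨
  (cyc G = 3 ∧ ∃ a b c d, G.Adj a b ∧ G.Adj a c ∧ G.Adj a d ∧ G.Adj b c ∧ G.Adj b d ∧ G.Adj c d)

theorem HasFullCore.mono {G' G : SimpleGraph V} (h : HasFullCore G') (hle : G' ≤ G)
    (hc : cyc G' = cyc G) : HasFullCore G := by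
  have hcn : ∀ p q, cn G' p q ⊆ cn G p q := by
    intro p q z hz
    rw [mem_cn] at hz ⊢
    exact ⟨hle hz.1, hle hz.2⟩
  rw [HasFullCore, ← hc]
  rcases h with ⟨p, q, S, h1, h2, h3⟩ | ⟨p, q, S, h1, h2, h3⟩ | ⟨h, a, b, c, d, h1, h2, h3, h4, h5, h6⟩
  · exact Or.inl ⟨p, q, S, h1, h2.trans (hcn p q), h3⟩
  · exact Or.inr (Or.inl ⟨p, q, S, hle h1, h2.trans (hcn p q), h3⟩)
  · exact Or.inr (Or.inr ⟨h, a, b, c, d, hle h1, hle h2, hle h3, hle h4, hle h5, hle h6⟩)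

theorem totalWeight_eq_of_card_nb_eq_one {G : SimpleGraph V} {v : V} (h : #(nb G v) = 1) :
    totalWeight G = totalWeight (G.deleteIncidenceSet v) := by
  rw [totalWeight_eq G v]
  obtain ⟨x, hx⟩ := card_eq_one.1 h
  rw [hx, offDiag_singleton, Finset.sum_empty]
  have : ∀ z, starWeight (G.deleteIncidenceSet v) {x} z = 0 := by
    intro z
    rw [starWeight]
    have h1 : #(nb (G.deleteIncidenceSet v) z ∩ {x}) ≤ 1 :=
      (card_le_card inter_subset_right).trans_eq (card_singleton x)
    have h2 : z ∈ ({x} : Finset V) → #(nb (G.deleteIncidenceSet v) z ∩ {x}) = 0 := by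
      intro hz
      rw [mem_singleton] at hz
      subst hz
      simp
    generalize #(nb (G.deleteIncidenceSet v) z ∩ {x}) = δ at h1 h2
    split_ifs with hz
    · simp [h2 hz]
    · interval_cases δ <;> simp
  simp [this]

theorem sum_offDiag_eq_sum_erase {W : Type*} (N : Finset W) (f : W → W → ℕ) :
    ∑ p ∈ N.offDiag, f p.1 p.2 = ∑ x ∈ N, ∑ y ∈ N.erase x, f x y := by
  rw [Finset.sum_sigma']
  refine Finset.sum_bij' (fun p _ => ⟨p.1, p.2⟩) (fun p _ => (p.1, p.2)) ?_ ?_ ?_ ?_ ?_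
  · simp only [mem_offDiag, mem_sigma, mem_erase]; tauto
  · simp only [mem_offDiag, mem_sigma, mem_erase]; tauto
  · simp
  · simp
  · simp

theorem sum_offDiag_pair {W : Type*} {x y : W} (hxy : x ≠ y) (f : W → W → ℕ) :
    ∑ p ∈ ({x, y} : Finset W).offDiag, f p.1 p.2 = f x y + f y x := by
  rw [sum_offDiag_eq_sum_erase, Finset.sum_pair hxy]
  have h1 : ({x, y} : Finset W).erase x = {y} := by
    ext; simp; grind
  have h2 : ({x, y} : Finset W).erase y = {x} := by
    ext; simp; grind
  rw [h1, h2, Finset.sum_singleton, Finset.sum_singleton]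

theorem shortPaths_comm (G : SimpleGraph V) (u w : V) : shortPaths G u w = shortPaths G w u := by
  simp only [shortPaths, cn_comm G u w, G.adj_comm u w]

theorem sum_offDiag_shortPaths_le (G : SimpleGraph V) (N : Finset V) :
    ((∑ p ∈ N.offDiag, (shortPaths G p.1 p.2 - 1) : ℕ) : ℤ) ≤ #N * (2 * cyc G) := by
  rw [sum_offDiag_eq_sum_erase N (fun x y => shortPaths G x y - 1), Nat.cast_sum]
  refine (Finset.sum_le_card_nsmul _ _ (2 * cyc G) fun x _ => ?_).trans_eq (by simp)
  exact sum_shortPaths_le G x (N.erase x) (notMem_erase x N)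

theorem sum_offDiag_shortPaths_le' (G : SimpleGraph V) {N : Finset V} (hN : 2 ≤ #N) :
    ((∑ p ∈ N.offDiag, (shortPaths G p.1 p.2 - 1) : ℕ) : ℤ) ≤ 2 * cyc G * (2 * #N - 3) := by
  have hc := cyc_nonneg G
  rcases hN.eq_or_lt with h2 | h3
  · obtain ⟨x, y, hxy, rfl⟩ := card_eq_two.1 h2.symm
    rw [sum_offDiag_pair hxy (fun x y => shortPaths G x y - 1), shortPaths_comm G y x, ← h2]
    have := shortPaths_le G hxy
    push_cast
    omega
  · refine (sum_offDiag_shortPaths_le G N).trans ?_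
    have : (3 : ℤ) ≤ #N := by exact_mod_cast h3
    nlinarith

theorem hasFullCore_of_card_two {G : SimpleGraph V} {v : V} (h2 : #(nb G v) = 2)
    (hc : cyc G = cyc (G.deleteIncidenceSet v) + 1)
    (hk : ∀ p ∈ (nb G v).offDiag, shortPaths (G.deleteIncidenceSet v) p.1 p.2 ≠ 0)
    (hS : ((∑ p ∈ (nb G v).offDiag, (shortPaths (G.deleteIncidenceSet v) p.1 p.2 - 1) : ℕ) : ℤ) =
      2 * cyc (G.deleteIncidenceSet v) * (2 * #(nb G v) - 3)) : HasFullCore G := by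
  obtain ⟨x, y, hxy, hN⟩ := card_eq_two.1 h2
  have hx : x ∈ nb G v := by simp [hN]
  have hy : y ∈ nb G v := by simp [hN]
  have hk := hk (x, y) (by simp [mem_offDiag, hxy, hN])
  have hm := cn_eq_of_ne G (v := v) (u := x) (w := y) (by rintro rfl; simp at hx)
    (by rintro rfl; simp at hy)
  rw [if_pos ⟨hx, hy⟩] at hm
  rw [h2, hN, sum_offDiag_pair hxy (fun x y => shortPaths (G.deleteIncidenceSet v) x y - 1),
    shortPaths_comm _ y x] at hS
  have hk' : (shortPaths (G.deleteIncidenceSet v) x y : ℤ) =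
      cyc (G.deleteIncidenceSet v) + 1 := by
    push_cast at hS
    simp only at hk
    omega
  have hadj : (G.deleteIncidenceSet v).Adj x y ↔ G.Adj x y := by
    simp only [mem_nb] at hx hy
    simp [deleteIncidenceSet_adj, hx.ne', hy.ne']
  have := cyc_nonneg (G.deleteIncidenceSet v)
  rw [shortPaths] at hk'
  by_cases h : G.Adj x y
  · rw [if_pos (hadj.2 h)] at hk'
    exact Or.inr (Or.inl ⟨x, y, _, h, subset_rfl, by omega, by push_cast at *; omega⟩)
  · rw [if_neg (fun h' => h (hadj.1 h'))] at hk'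
    exact Or.inl ⟨x, y, _, hxy, subset_rfl, by push_cast at *; omega, by push_cast at *; omega⟩

theorem hasFullCore_of_card_three {G : SimpleGraph V} {v : V} (h3 : #(nb G v) = 3)
    (hc0 : 1 ≤ cyc (G.deleteIncidenceSet v))
    (hc : cyc G = cyc (G.deleteIncidenceSet v) + 2)
    (hS : ((∑ p ∈ (nb G v).offDiag, (shortPaths (G.deleteIncidenceSet v) p.1 p.2 - 1) : ℕ) : ℤ) =
      2 * cyc (G.deleteIncidenceSet v) * (2 * #(nb G v) - 3)) : HasFullCore G := by
  set G' := G.deleteIncidenceSet v with hG'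
  have hle : G' ≤ G := G.deleteIncidenceSet_le v
  have hpair : ∀ x ∈ nb G v, ∀ y ∈ nb G v, x ≠ y → (shortPaths G' x y : ℤ) = cyc G' + 1 := by
    by_contra! hcon
    obtain ⟨x, hx, y, hy, hxy, hne⟩ := hcon
    have hlt : ∑ p ∈ (nb G v).offDiag, ((shortPaths G' p.1 p.2 - 1 : ℕ) : ℤ) <
        ∑ p ∈ (nb G v).offDiag, cyc G' := by
      refine Finset.sum_lt_sum (fun p hp => ?_) ⟨(x, y), mem_offDiag.2 ⟨hx, hy, hxy⟩, ?_⟩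
      · have := shortPaths_le G' (mem_offDiag.1 hp).2.2
        omega
      · have := shortPaths_le G' hxy
        simp only
        omega
    rw [← Nat.cast_sum, hS, Finset.sum_const, offDiag_card, h3] at hlt
    norm_num at hlt
    linarith
  have htri : ∀ x ∈ nb G v, ∀ y ∈ nb G v, x ≠ y → G'.Adj x y := by
    intro x hx y hy hxy
    by_contra hnadj
    obtain ⟨w, hw⟩ : ∃ w, w ∈ (nb G v \ {x, y}) := by
      have := le_card_sdiff {x, y} (nb G v)
      rw [h3, card_pair hxy] at this
      exact card_pos.1 (by omega)
    simp only [Finset.mem_sdiff, mem_insert, mem_singleton, not_or] at hw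
    obtain ⟨hw, hwx, hwy⟩ := hw
    have h1 := sum_card_cn_le G' x
    have hpy := hpair x hx y hy hxy
    have hpw := hpair x hx w hw (Ne.symm hwx)
    rw [shortPaths, if_neg hnadj] at hpy
    have hymem : y ∈ (insert x (nb G' x))ᶜ := by
      simp [hnadj, hxy.symm]
    by_cases hxw : G'.Adj x w
    · rw [shortPaths, if_pos hxw] at hpw
      have h2 := Finset.single_le_sum (f := fun y => #(cn G' x y) - 1) (fun _ _ => Nat.zero_le _)
        hymem
      have h4 := Finset.single_le_sum (f := fun y => #(cn G' x y)) (fun _ _ => Nat.zero_le _)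
        (mem_nb.2 hxw)
      push_cast at h1 hpy hpw
      zify at h2 h4
      omega
    · rw [shortPaths, if_neg hxw] at hpw
      have hwmem : w ∈ (insert x (nb G' x))ᶜ := by
        simp [hxw, hwx]
      have h2 := Finset.sum_le_sum_of_subset (f := fun y => #(cn G' x y) - 1)
        (s := {y, w}) (t := (insert x (nb G' x))ᶜ)
        (by intro; simp only [mem_insert, mem_singleton]; rintro (rfl | rfl) <;> assumption)
      rw [Finset.sum_pair (Ne.symm hwy)] at h2
      push_cast [-Nat.cast_sum] at h1 hpy hpw
      omega
  obtain ⟨x, y, w, hxy, hxw, hyw, hN⟩ := card_eq_three.1 h3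
  have hx : x ∈ nb G v := by simp [hN]
  have hy : y ∈ nb G v := by simp [hN]
  have hw : w ∈ nb G v := by simp [hN]
  have h1 := sum_card_cn_le G' x
  have hpy := hpair x hx y hy hxy
  have hpw := hpair x hx w hw hxw
  have axy := htri x hx y hy hxy
  have axw := htri x hx w hw hxw
  have ayw := htri y hy w hw hyw
  rw [shortPaths, if_pos axy] at hpy
  rw [shortPaths, if_pos axw] at hpw
  have hone : cn G' x y ⊆ {w} := by
    intro z hz
    rw [mem_singleton]
    by_contra hzw
    rw [mem_cn] at hz
    have h2 := Finset.sum_le_sum_of_subset (f := fun y => #(cn G' x y))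
      (s := {y, w, z}) (t := nb G' x) (by
        intro
        simp only [mem_insert, mem_singleton, mem_nb]
        rintro (rfl | rfl | rfl)
        exacts [axy, axw, hz.1])
    rw [Finset.sum_insert (by simp [hyw, hz.2.ne]), Finset.sum_pair (Ne.symm hzw)] at h2
    have h4 : 0 < #(cn G' x z) := card_pos.2 ⟨y, by simp [axy, hz.2.symm]⟩
    push_cast at h1 hpy hpw
    zify at h2 h4
    have : (0 : ℤ) ≤ ∑ y ∈ (insert x (nb G' x))ᶜ, ((#(cn G' x y) - 1 : ℕ) : ℤ) :=
      Finset.sum_nonneg fun _ _ => by positivity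
    linarith
  have := card_le_card hone
  rw [card_singleton] at this
  simp only [mem_nb] at hx hy hw
  refine Or.inr (Or.inr ⟨?_, v, x, y, w, hx, hy, hw, hle axy, hle axw, hle ayw⟩)
  push_cast at hpy
  omega

theorem hasFullCore_of_cyc_eq_zero {G : SimpleGraph V} {v : V} (h3 : 3 ≤ #(nb G v))
    (hc0 : cyc (G.deleteIncidenceSet v) = 0) (hc : cyc G + 1 = #(nb G v))
    (hk : ∀ p ∈ (nb G v).offDiag, shortPaths (G.deleteIncidenceSet v) p.1 p.2 ≠ 0) :
    HasFullCore G := by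
  set G' := G.deleteIncidenceSet v with hG'
  have hle : G' ≤ G := G.deleteIncidenceSet_le v
  obtain ⟨z, hz⟩ := IsAcyclic.exists_center (cyc_eq_zero_iff.1 hc0) (nb G v) (by omega) (by
    intro x hx y hy hxy
    by_cases hadj : G'.Adj x y
    · exact Or.inl hadj
    · refine Or.inr ?_
      have := hk (x, y) (by simp only [mem_offDiag]; exact ⟨hx, hy, hxy⟩)
      simp only [shortPaths, if_neg hadj, add_zero, card_ne_zero] at this
      obtain ⟨z, hz⟩ := this
      exact ⟨z, by simpa using hz⟩)
  by_cases hzN : z ∈ nb G v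
  · refine Or.inr (Or.inl ⟨v, z, (nb G v).erase z, by simpa using hzN, ?_, ?_, ?_⟩)
    · intro a ha
      rw [mem_erase] at ha
      rw [mem_cn]
      exact ⟨by simpa using ha.2, hle (hz a ha.2 ha.1)⟩
    · rw [card_erase_of_mem hzN]; omega
    · rw [card_erase_of_mem hzN]; omega
  · refine Or.inl ⟨v, z, nb G v, ?_, ?_, by omega, hc⟩
    · rintro rfl
      obtain ⟨a, ha⟩ := card_pos.1 (by omega : 0 < #(nb G v))
      have := hz a ha (by rintro rfl; exact hzN ha)
      simp [hG', deleteIncidenceSet_adj] at this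
    · intro a ha
      rw [mem_cn]
      exact ⟨by simpa using ha, hle (hz a ha (by rintro rfl; exact hzN ha))⟩

theorem totalWeight_bot : totalWeight (⊥ : SimpleGraph V) = 0 := by
  have : ∀ u w : V, cn (⊥ : SimpleGraph V) u w = ∅ := by intro u w; ext; simp
  simp [totalWeight, pairWeight, this]

theorem totalWeight_le_and (G : SimpleGraph V) :
    (totalWeight G : ℤ) ≤ 8 * (cyc G * (cyc G + 2)) ∧
      ((totalWeight G : ℤ) = 8 * (cyc G * (cyc G + 2)) → cyc G = 0 ∨ HasFullCore G) := by
  induction hn : G.edgeSet.ncard using Nat.strong_induction_on generalizing G with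
  | _ n ih =>
  by_cases hG : G = ⊥
  · have hc : cyc G = 0 := by rw [hG]; exact cyc_eq_zero_iff.2 isAcyclic_bot
    rw [hc, hG, totalWeight_bot]
    simp
  obtain ⟨v, hv, hcv⟩ := exists_cyc_deleteIncidenceSet_le hG
  have hd := hv.card_pos
  obtain ⟨ih1, ih2⟩ := ih _ (by
    rw [← hn, ← ncard_edgeSet_deleteIncidenceSet G v]; omega) (G.deleteIncidenceSet v) rfl
  have hmono := cyc_mono (G.deleteIncidenceSet_le v)
  have hc0 := cyc_nonneg (G.deleteIncidenceSet v)
  rcases Nat.eq_or_lt_of_le hd with h1 | h2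
  · rw [totalWeight_eq_of_card_nb_eq_one h1.symm]
    refine ⟨ih1.trans (by nlinarith), fun heq => ?_⟩
    have hceq : cyc (G.deleteIncidenceSet v) = cyc G := by nlinarith
    rw [← hceq]
    exact (ih2 (by rw [heq, hceq])).imp_right fun h => h.mono (G.deleteIncidenceSet_le v) hceq
  have hmain := totalWeight_add_le G v hv
  have hS := sum_offDiag_shortPaths_le' (G.deleteIncidenceSet v) h2
  have hS' := sum_offDiag_shortPaths_le (G.deleteIncidenceSet v) (nb G v)
  push_cast [-Nat.cast_sum] at hmain
  obtain ⟨E, hE⟩ : ∃ E, E = #((nb G v).offDiag.filter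
    fun p => shortPaths (G.deleteIncidenceSet v) p.1 p.2 = 0) := ⟨_, rfl⟩
  rw [← hE] at hmain
  have hd2 : (2 : ℤ) ≤ #(nb G v) := by exact_mod_cast h2
  have hE0 : (0 : ℤ) ≤ E := by positivity
  have hsq : (cyc (G.deleteIncidenceSet v) + #(nb G v)) ^ 2 ≤ (cyc G + 1) ^ 2 :=
    pow_le_pow_left₀ (by linarith) hcv 2
  refine ⟨by nlinarith, fun heq => Or.inr ?_⟩
  have hceq : cyc G + 1 = cyc (G.deleteIncidenceSet v) + #(nb G v) := by
    have : (cyc (G.deleteIncidenceSet v) + #(nb G v)) ^ 2 = (cyc G + 1) ^ 2 :=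
      hsq.antisymm (by nlinarith)
    exact ((pow_left_inj₀ (by linarith) (by linarith) two_ne_zero).1 this).symm
  have hEz : E = 0 := by
    have : (E : ℤ) ≤ 0 := by nlinarith
    omega
  have hk : ∀ p ∈ (nb G v).offDiag, shortPaths (G.deleteIncidenceSet v) p.1 p.2 ≠ 0 := by
    rw [hEz, eq_comm, card_eq_zero, filter_eq_empty_iff] at hE
    exact fun p hp => hE hp
  have hSeq := hS.antisymm (by nlinarith)
  rcases Nat.eq_or_lt_of_le h2 with h2 | h3
  · exact hasFullCore_of_card_two h2.symm (by omega) hk hSeq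
  rcases hc0.eq_or_lt with h0 | h0
  · exact hasFullCore_of_cyc_eq_zero h3 h0.symm (by omega) hk
  have hd3 : #(nb G v) = 3 := by
    have h3' : (3 : ℤ) ≤ #(nb G v) := by exact_mod_cast h3
    rw [hSeq] at hS'
    have : (#(nb G v) : ℤ) ≤ 3 := by nlinarith
    omega
  exact hasFullCore_of_card_three hd3 h0 (by omega) hSeq

end Extremal

section StandardGraphs

open scoped Classical

theorem totalWeight_le_of_copy {U V : Type*} [Fintype U] [Fintype V] {D : SimpleGraph U}
    {G : SimpleGraph V} (f : Copy D G) : totalWeight D ≤ totalWeight G := by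
  have hf : Function.Injective f := f.injective
  have hcn : ∀ a b, #(cn D a b) ≤ #(cn G (f a) (f b)) := by
    intro a b
    refine card_le_card_of_injOn f (fun z hz => ?_) hf.injOn
    simp only [mem_coe, mem_cn] at hz ⊢
    exact ⟨f.toHom.map_adj hz.1, f.toHom.map_adj hz.2⟩
  have hp : ∀ a b, pairWeight D a b ≤ pairWeight G (f a) (f b) := by
    intro a b
    rw [pairWeight, pairWeight]
    rcases eq_or_ne a b with h | h
    · rw [if_pos h]
      exact Nat.zero_le _
    rw [if_neg h, if_neg (hf.ne h)]
    have h1 := hcn a b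
    refine add_le_add (Nat.mul_le_mul h1 (Nat.sub_le_sub_right h1 1)) (Nat.mul_le_mul_left 4 ?_)
    by_cases hab : D.Adj a b
    · have hab' : G.Adj (f a) (f b) := f.toHom.map_adj hab
      rwa [if_pos hab, if_pos hab']
    · rw [if_neg hab]
      split_ifs <;> omega
  rw [totalWeight, totalWeight, ← Fintype.sum_prod_type', ← Fintype.sum_prod_type']
  calc ∑ x : U × U, pairWeight D x.1 x.2
      ≤ ∑ x : U × U, pairWeight G (f x.1) (f x.2) := Finset.sum_le_sum fun _ _ => hp _ _
    _ = ∑ x ∈ univ.image (Prod.map f f), pairWeight G x.1 x.2 := by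
        rw [Finset.sum_image]
        · rfl
        · exact (hf.prodMap hf).injOn
    _ ≤ _ := Finset.sum_le_sum_of_subset (subset_univ _)

theorem connected_of_center {W : Type*} {G : SimpleGraph W} (c : W)
    (h : ∀ x, x ≠ c → G.Adj c x ∨ ∃ y, G.Adj c y ∧ G.Adj y x) : G.Connected := by
  rw [connected_iff_exists_forall_reachable]
  refine ⟨c, fun x => ?_⟩
  rcases eq_or_ne x c with rfl | hx
  · exact Reachable.refl _
  · rcases h x hx with h | ⟨y, h1, h2⟩
    · exact h.reachable
    · exact h1.reachable.trans h2.reachable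

theorem induce_connected_of_center {W : Type*} {G : SimpleGraph W} {v : W} (c : W) (hc : c ≠ v)
    (h : ∀ x, x ≠ v → x ≠ c → G.Adj c x ∨ ∃ y, y ≠ v ∧ G.Adj c y ∧ G.Adj y x) :
    (G.induce {u | u ≠ v}).Connected := by
  refine connected_of_center ⟨c, hc⟩ ?_
  rintro ⟨x, hx⟩ hxc
  rcases h x hx (fun h => hxc (Subtype.ext h)) with h | ⟨y, hy, h1, h2⟩
  · exact Or.inl h
  · exact Or.inr ⟨⟨y, hy⟩, h1, h2⟩

theorem TwoConnected.of_iso {U W : Type*} {D : SimpleGraph U} {H : SimpleGraph W} (e : D ≃g H)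
    (hD : TwoConnected D) : TwoConnected H := by
  refine ⟨e.connected_iff.1 hD.1, by rw [← Nat.card_congr e.toEquiv]; exact hD.2.1, fun v => ?_⟩
  refine (hD.2.2 (e.symm v)).map (⟨fun x => ⟨e x, ?_⟩, ?_⟩ :
    D.induce {u | u ≠ e.symm v} →g H.induce {u | u ≠ v}) ?_
  · intro h
    exact x.2 (by simp [← h])
  · intro a b hab
    exact e.map_adj_iff.2 hab
  · rintro ⟨y, hy⟩
    exact ⟨⟨e.symm y, fun h => hy (e.symm.injective h)⟩, Subtype.ext (e.apply_symm_apply y)⟩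

theorem cyc_of_iso {U W : Type*} [Fintype U] [Fintype W] {D : SimpleGraph U} {H : SimpleGraph W}
    (e : D ≃g H) : cyc D = cyc H :=
  le_antisymm (cyc_le_of_copy e.toCopy) (cyc_le_of_copy e.symm.toCopy)

theorem cyc_of_connected {W : Type*} [Fintype W] {G : SimpleGraph W} (h : G.Connected) :
    2 * cyc G = ∑ u, #(nb G u) + 2 - 2 * Fintype.card W := by
  have h1 := sum_card_nb G
  have h2 : Nat.card G.ConnectedComponent = 1 := by
    have := h.preconnected.subsingleton_connectedComponent
    have := h.nonempty
    exact Nat.card_eq_one_iff_unique.2 ⟨inferInstance, inferInstance⟩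
  rw [cyc, h2, h1, Nat.card_eq_fintype_card]
  push_cast
  ring

/-- A graph on `m + 2` vertices in which `0` and `1` are adjacent to all others, and there are no
further edges except possibly the one between `0` and `1`. -/
def IsBook {m : ℕ} (D : SimpleGraph (Fin (m + 2))) : Prop :=
  (∀ k : Fin m, D.Adj 0 k.succ.succ) ∧ (∀ k : Fin m, D.Adj 1 k.succ.succ) ∧
    ∀ k l : Fin m, ¬ D.Adj k.succ.succ l.succ.succ

theorem forall_fin_add_two {m : ℕ} {p : Fin (m + 2) → Prop} :
    (∀ x, p x) ↔ p 0 ∧ p 1 ∧ ∀ k : Fin m, p k.succ.succ := by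
  rw [Fin.forall_fin_succ, Fin.forall_fin_succ]
  rfl

theorem sum_fin_add_two {m : ℕ} (f : Fin (m + 2) → ℕ) :
    ∑ x, f x = f 0 + f 1 + ∑ k : Fin m, f k.succ.succ := by
  rw [Fin.sum_univ_succ, Fin.sum_univ_succ, ← add_assoc]
  rfl

theorem IsBook.cyc_eq {m : ℕ} {D : SimpleGraph (Fin (m + 2))} (h : IsBook D)
    (hD : D.Connected) : cyc D = m - 1 + if D.Adj 0 1 then 1 else 0 := by
  obtain ⟨h0, h1, h2⟩ := h
  have hnb : ∀ u, #(nb D u) = ∑ z, if D.Adj u z then 1 else 0 := fun u => by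
    rw [← card_filter]; rfl
  have h := cyc_of_connected hD
  have h0' := fun k => (h0 k).symm
  have h1' := fun k => (h1 k).symm
  simp only [hnb, sum_fin_add_two, h0, h1, h2, h0', h1', D.adj_comm 1 0,
    SimpleGraph.irrefl, if_true, if_false, Finset.sum_const, Fintype.card_fin, card_univ,
    smul_eq_mul, mul_one, mul_zero, add_zero, zero_add] at h
  by_cases hadj : D.Adj 0 1 <;> simp [hadj] at h ⊢ <;> linarith

theorem IsBook.totalWeight_eq {m : ℕ} {D : SimpleGraph (Fin (m + 2))} (h : IsBook D) :
    totalWeight D = if D.Adj 0 1 then 8 * m * (m + 2) else 8 * (m - 1) * (m + 1) := by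
  obtain ⟨h0, h1, h2⟩ := h
  have hcn : ∀ u w, #(cn D u w) = ∑ z, if D.Adj u z ∧ D.Adj w z then 1 else 0 := fun u w => by
    rw [← card_filter]; congr 1; ext; simp
  have hs : ∀ k : Fin m, k.succ.succ ≠ 0 ∧ k.succ.succ ≠ 1 := fun k =>
    ⟨Fin.succ_ne_zero _, fun h => Fin.succ_ne_zero k (Fin.succ_injective _ h)⟩
  have hs' : ∀ k : Fin m, 0 ≠ k.succ.succ ∧ 1 ≠ k.succ.succ := fun k =>
    ⟨(hs k).1.symm, (hs k).2.symm⟩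
  have hite : ∀ (k : Fin m) (a : ℕ), ∑ l : Fin m, (if k = l then 0 else a) = (m - 1) * a := by
    intro k a
    have : ∀ l, (if k = l then 0 else a) = if ¬ k = l then a else 0 := by
      intro l; split_ifs <;> rfl
    simp only [this]
    rw [← Finset.sum_filter, Finset.sum_const, smul_eq_mul, Finset.filter_ne, card_erase_of_mem
      (mem_univ _), card_univ, Fintype.card_fin]
  have h0' := fun k => (h0 k).symm
  have h1' := fun k => (h1 k).symm
  simp only [totalWeight, pairWeight, hcn, sum_fin_add_two, h0, h1, h2, h0', h1', D.adj_comm 1 0, hs, hs', Fin.succ_inj, zero_ne_one, one_ne_zero,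
    SimpleGraph.irrefl, if_true, if_false, Finset.sum_const, Fintype.card_fin, card_univ,
    smul_eq_mul, mul_one, mul_zero, add_zero, zero_add, and_true, and_false, false_and, hite,
    true_and, and_self]
  rcases m with _ | m
  · by_cases hadj : D.Adj 0 1 <;> simp [hadj]
  · by_cases hadj : D.Adj 0 1 <;> simp [hadj] <;> ring

theorem IsBook.twoConnected {m : ℕ} {D : SimpleGraph (Fin (m + 2))} (h : IsBook D)
    (hm : 2 ≤ m ∨ D.Adj 0 1 ∧ 1 ≤ m) : TwoConnected D := by
  obtain ⟨h0, h1, h2⟩ := h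
  have hm1 : 1 ≤ m := by omega
  refine ⟨connected_of_center 0 ?_, by simp; omega, ?_⟩
  · rw [forall_fin_add_two]
    exact ⟨by simp, fun _ => Or.inr ⟨_, h0 ⟨0, hm1⟩, (h1 ⟨0, hm1⟩).symm⟩, fun k _ => Or.inl (h0 k)⟩
  · rw [forall_fin_add_two]
    refine ⟨induce_connected_of_center 1 one_ne_zero ?_,
      induce_connected_of_center 0 zero_ne_one ?_,
      fun k => induce_connected_of_center 0 (Fin.succ_ne_zero _).symm ?_⟩
    · rw [forall_fin_add_two]
      exact ⟨by simp, by simp, fun k _ _ => Or.inl (h1 k)⟩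
    · rw [forall_fin_add_two]
      exact ⟨by simp, by simp, fun k _ _ => Or.inl (h0 k)⟩
    · rw [forall_fin_add_two]
      refine ⟨by simp, fun _ _ => ?_, fun k _ _ => Or.inl (h0 k)⟩
      rcases hm with hm | hm
      · obtain ⟨l, hl⟩ : ∃ l : Fin m, l ≠ k := by
          have : Nontrivial (Fin m) := Fin.nontrivial_iff_two_le.2 hm
          exact exists_ne k
        exact Or.inr ⟨l.succ.succ, by simpa using hl, h0 l, (h1 l).symm⟩
      · exact Or.inl hm.1

theorem isBook_GnGraph (m : ℕ) : IsBook (GnGraph (m + 2)) ∧ (GnGraph (m + 2)).Adj 0 1 := by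
  simp [IsBook, GnGraph, Fin.ext_iff]

theorem isBook_K2Graph (m : ℕ) : IsBook (K2Graph (m + 2)) ∧ ¬ (K2Graph (m + 2)).Adj 0 1 := by
  simp [IsBook, K2Graph, Fin.ext_iff]

/-- `D` is isomorphic to `K_4`, to some `G_ℓ`, or to some `K_{2,ℓ}`. -/
def IsStandard {W : Type*} (D : SimpleGraph W) : Prop :=
  Nonempty (D ≃g (⊤ : SimpleGraph (Fin 4))) ∨
    (∃ ℓ : ℕ, 3 ≤ ℓ ∧ Nonempty (D ≃g GnGraph ℓ)) ∨
    (∃ ℓ : ℕ, 2 ≤ ℓ ∧ Nonempty (D ≃g K2Graph (ℓ + 2)))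

theorem IsStandard.of_iso {U W : Type*} {D : SimpleGraph U} {H : SimpleGraph W} (e : H ≃g D)
    (hD : IsStandard D) : IsStandard H := by
  rcases hD with ⟨⟨f⟩⟩ | ⟨ℓ, hℓ, ⟨f⟩⟩ | ⟨ℓ, hℓ, ⟨f⟩⟩
  · exact Or.inl ⟨e.trans f⟩
  · exact Or.inr (Or.inl ⟨ℓ, hℓ, ⟨e.trans f⟩⟩)
  · exact Or.inr (Or.inr ⟨ℓ, hℓ, ⟨e.trans f⟩⟩)

theorem twoConnected_top_four : TwoConnected (⊤ : SimpleGraph (Fin 4)) := by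
  refine ⟨connected_of_center 0 fun x hx => Or.inl hx.symm, by simp, fun v => ?_⟩
  obtain ⟨c, hc⟩ := exists_ne v
  exact induce_connected_of_center c hc fun x _ hx => Or.inl hx.symm

theorem cyc_top_four : cyc (⊤ : SimpleGraph (Fin 4)) = 3 := by
  have h := cyc_of_connected twoConnected_top_four.1
  have hnb : ∀ u, #(nb (⊤ : SimpleGraph (Fin 4)) u) = 3 := by
    intro u
    have : nb (⊤ : SimpleGraph (Fin 4)) u = univ.erase u := by ext; simp [eq_comm]
    rw [this, card_erase_of_mem (mem_univ _)]; rfl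
  simp [hnb] at h
  linarith

theorem totalWeight_top_four : totalWeight (⊤ : SimpleGraph (Fin 4)) = 120 := by
  have hp : ∀ u w, pairWeight (⊤ : SimpleGraph (Fin 4)) u w = if w ∈ univ.erase u then 10 else 0 := by
    intro u w
    rw [pairWeight]
    by_cases h : u = w
    · simp [h]
    · have : cn (⊤ : SimpleGraph (Fin 4)) u w = (univ.erase u).erase w := by
        ext; simp [eq_comm, and_comm]
      rw [this, card_erase_of_mem (by simp [Ne.symm h]), card_erase_of_mem (mem_univ _)]
      simp [h, Ne.symm h]
  simp only [totalWeight, hp, Finset.sum_ite_mem, univ_inter, Finset.sum_const,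
    card_erase_of_mem (mem_univ _), card_univ, Fintype.card_fin]
  rfl

theorem IsStandard.twoConnected {W : Type*} {D : SimpleGraph W} (hD : IsStandard D) :
    TwoConnected D := by
  rcases hD with ⟨⟨f⟩⟩ | ⟨ℓ, hℓ, ⟨f⟩⟩ | ⟨ℓ, hℓ, ⟨f⟩⟩
  · exact twoConnected_top_four.of_iso f.symm
  · obtain ⟨m, rfl⟩ := Nat.exists_eq_add_of_le' (by omega : 2 ≤ ℓ)
    obtain ⟨h1, h2⟩ := isBook_GnGraph m
    exact (h1.twoConnected (Or.inr ⟨h2, by omega⟩)).of_iso f.symm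
  · exact ((isBook_K2Graph ℓ).1.twoConnected (Or.inl hℓ)).of_iso f.symm

theorem IsStandard.le_totalWeight {W : Type*} [Fintype W] {D : SimpleGraph W} (hD : IsStandard D) :
    8 * (cyc D * (cyc D + 2)) ≤ totalWeight D := by
  have hconn := hD.twoConnected.1
  rcases hD with ⟨⟨f⟩⟩ | ⟨ℓ, hℓ, ⟨f⟩⟩ | ⟨ℓ, hℓ, ⟨f⟩⟩
  · have := totalWeight_le_of_copy f.symm.toCopy
    rw [totalWeight_top_four] at this
    rw [cyc_of_iso f, cyc_top_four]
    zify at this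
    linarith
  · obtain ⟨m, rfl⟩ := Nat.exists_eq_add_of_le' (by omega : 2 ≤ ℓ)
    obtain ⟨h1, h2⟩ := isBook_GnGraph m
    have := totalWeight_le_of_copy f.symm.toCopy
    rw [h1.totalWeight_eq, if_pos h2] at this
    rw [cyc_of_iso f, h1.cyc_eq (f.connected_iff.1 hconn), if_pos h2]
    zify at this
    linarith
  · obtain ⟨h1, h2⟩ := isBook_K2Graph ℓ
    have := totalWeight_le_of_copy f.symm.toCopy
    rw [h1.totalWeight_eq, if_neg h2] at this
    rw [cyc_of_iso f, h1.cyc_eq (f.connected_iff.1 hconn), if_neg h2]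
    zify [(by omega : 1 ≤ ℓ)] at this
    linarith

theorem IsBook.exists_copy {V : Type*} [Fintype V] {G : SimpleGraph V} {m : ℕ}
    {D : SimpleGraph (Fin (m + 2))} (hD : IsBook D) {p q : V} (hpq : p ≠ q)
    (hadj : D.Adj 0 1 → G.Adj p q) {S : Finset V} (hS : S ⊆ cn G p q) (hm : m = #S) :
    Nonempty (Copy D G) := by
  subst hm
  obtain ⟨-, -, h2⟩ := hD
  have hs : ∀ k, G.Adj p (S.equivFin.symm k) ∧ G.Adj q (S.equivFin.symm k) := fun k => by
    simpa using hS (S.equivFin.symm k).2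
  let f : Fin (#S + 2) → V := Fin.cons p (Fin.cons q fun k => (S.equivFin.symm k : V))
  have f0 : f 0 = p := rfl
  have f1 : f 1 = q := rfl
  have fk : ∀ k : Fin #S, f k.succ.succ = S.equivFin.symm k := fun k => rfl
  refine ⟨⟨⟨f, ?_⟩, ?_⟩⟩
  · have : ∀ a b, D.Adj a b → G.Adj (f a) (f b) := by
      simp only [forall_fin_add_two, f0, f1, fk, h2, SimpleGraph.irrefl, hs, false_imp_iff,
        implies_true, true_and, and_true, (hs _).1.symm, (hs _).2.symm]
      exact ⟨hadj, fun h => (hadj h.symm).symm⟩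
    exact fun {a b} => this a b
  · have : ∀ a b, f a = f b → a = b := by
      have hne := fun k => (hs k).1.ne
      have hne' := fun k => (hs k).2.ne
      simp only [forall_fin_add_two, f0, f1, fk, hpq, hpq.symm, hne, hne', (hne _).symm,
        (hne' _).symm, false_imp_iff, implies_true, true_and, and_true]
      intro k l h
      rw [S.equivFin.symm.injective (Subtype.ext h)]
    exact fun {a b} => this a b

theorem HasFullCore.exists_copy {V : Type*} [Fintype V] {G : SimpleGraph V} (h : HasFullCore G) :
    ∃ (n : ℕ) (D : SimpleGraph (Fin n)), IsStandard D ∧ cyc D = cyc G ∧ Nonempty (Copy D G) := by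
  rcases h with ⟨p, q, S, h1, h2, h3, h4⟩ | ⟨p, q, S, h1, h2, h3, h4⟩ |
    ⟨h, a, b, c, d, h1, h2, h3, h4, h5, h6⟩
  · have hstd : IsStandard (K2Graph (#S + 2)) := Or.inr (Or.inr ⟨#S, h3, ⟨Iso.refl⟩⟩)
    obtain ⟨hb, hn⟩ := isBook_K2Graph #S
    refine ⟨_, _, hstd, ?_, hb.exists_copy h1 (fun h => absurd h hn) h2 rfl⟩
    rw [hb.cyc_eq hstd.twoConnected.1, if_neg hn, ← h4]
    ring
  · have hstd : IsStandard (GnGraph (#S + 2)) :=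
      Or.inr (Or.inl ⟨#S + 2, by omega, ⟨Iso.refl⟩⟩)
    obtain ⟨hb, hn⟩ := isBook_GnGraph #S
    refine ⟨_, _, hstd, ?_, hb.exists_copy h1.ne (fun _ => h1) h2 rfl⟩
    rw [hb.cyc_eq hstd.twoConnected.1, if_pos hn, ← h4]
    ring
  · refine ⟨4, ⊤, Or.inl ⟨Iso.refl⟩, by rw [h, cyc_top_four], ?_⟩
    have key : ∀ i j : Fin 4, i ≠ j → G.Adj (![a, b, c, d] i) (![a, b, c, d] j) := by
      intro i j hij
      fin_cases i <;> fin_cases j <;> first | exact absurd rfl hij | skip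
      exacts [h1, h2, h3, h1.symm, h4, h5, h2.symm, h4.symm, h6, h3.symm, h5.symm, h6.symm]
    refine ⟨⟨⟨![a, b, c, d], fun {i j} hij => key i j hij⟩, fun i j hij => ?_⟩⟩
    by_contra hne
    exact (key i j hne).ne hij

end StandardGraphs

section Blocks

open scoped Classical

theorem TwoConnected.reachable_deleteEdges {W : Type*} {K : SimpleGraph W} (hK : TwoConnected K)
    {a b : W} (hab : K.Adj a b) : (K.deleteEdges {s(a, b)}).Reachable a b := by
  obtain ⟨-, hcard, hdel⟩ := hK
  have key : ∀ v, v = a ∨ v = b → ∀ x y, x ≠ v → y ≠ v →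
      (K.deleteEdges {s(a, b)}).Reachable x y := by
    intro v hv x y hx hy
    let f : K.induce {u | u ≠ v} →g K.deleteEdges {s(a, b)} :=
      { toFun := Subtype.val
        map_rel' := by
          rintro ⟨x, hx⟩ ⟨y, hy⟩ h
          simp only [deleteEdges_adj, Set.mem_singleton_iff, Sym2.eq_iff]
          refine ⟨h, ?_⟩
          simp only [Set.mem_ofPred_eq] at hx hy
          rcases hv with rfl | rfl <;> tauto }
    exact ((hdel v).preconnected ⟨x, hx⟩ ⟨y, hy⟩).map f
  obtain ⟨c, hca, hcb⟩ : ∃ c, c ≠ a ∧ c ≠ b := by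
    have : Finite W := Nat.finite_of_card_ne_zero (by omega)
    have := Fintype.ofFinite W
    rw [Nat.card_eq_fintype_card] at hcard
    obtain ⟨c, hc⟩ := Finset.exists_mem_notMem_of_card_lt_card
      (s := {a, b}) (t := univ) (by rw [card_univ]; exact (card_le_two).trans_lt hcard)
    simp only [mem_univ, Finset.mem_insert, Finset.mem_singleton, not_or] at hc
    exact ⟨c, hc.2⟩
  exact (key b (Or.inr rfl) a c hab.ne hcb).trans (key a (Or.inl rfl) c b hca hab.ne')

theorem TwoConnected.not_isBridge {V : Type*} {G : SimpleGraph V} {H : G.Subgraph}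
    (hH : TwoConnected H.coe) {a b : V} (hab : H.Adj a b) : ¬ G.IsBridge s(a, b) := by
  rw [isBridge_iff, not_not]
  let f : H.coe.deleteEdges {s(⟨a, hab.fst_mem⟩, ⟨b, hab.snd_mem⟩)} →g G.deleteEdges {s(a, b)} :=
    { toFun := Subtype.val
      map_rel' := by
        rintro ⟨x, hx⟩ ⟨y, hy⟩ h
        simp only [deleteEdges_adj, Set.mem_singleton_iff, Sym2.eq_iff, Subtype.mk.injEq] at h ⊢
        exact ⟨h.1.adj_sub, h.2⟩ }
  exact (hH.reachable_deleteEdges (K := H.coe) (a := ⟨a, hab.fst_mem⟩) (b := ⟨b, hab.snd_mem⟩)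
    hab).map f

theorem TwoConnected.exists_adj {V : Type*} {G : SimpleGraph V} {H : G.Subgraph}
    (hH : TwoConnected H.coe) {v : V} (hv : v ∈ H.verts) : ∃ w, H.Adj v w := by
  have : Nontrivial H.verts := by
    have h3 := hH.2.1
    have : Finite H.verts := Nat.finite_of_card_ne_zero (by omega)
    exact Finite.one_lt_card_iff_nontrivial.1 (by omega)
  obtain ⟨w, hw⟩ := hH.1.preconnected.exists_adj_of_nontrivial ⟨v, hv⟩
  exact ⟨w, hw⟩

theorem TwoConnected.not_isSingleEdge_of_le {V : Type*} {G : SimpleGraph V} {H K : G.Subgraph}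
    (hH : TwoConnected H.coe) (hle : H ≤ K) : ¬ IsSingleEdge G K := by
  rintro ⟨u, v, h, rfl⟩
  have h2 : Nat.card H.verts ≤ 2 := by
    rw [Nat.card_coe_set_eq]
    exact (Set.ncard_le_ncard (hle.1 : H.verts ⊆ {u, v}) (Set.toFinite {u, v})).trans
      ((Set.ncard_insert_le _ _).trans (by simp))
  have := hH.2.1
  omega

theorem TwoConnected.le_of_forall_isBridge {V : Type*} {G : SimpleGraph V} {H K : G.Subgraph}
    (hK : TwoConnected K.coe) (h : ∀ a b, G.Adj a b → ¬ H.Adj a b → G.IsBridge s(a, b)) :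
    K ≤ H := by
  have hadj : ∀ a b, K.Adj a b → H.Adj a b := fun a b hab => by
    by_contra hn
    exact hK.not_isBridge hab (h a b hab.adj_sub hn)
  refine ⟨fun v hv => ?_, fun a b => hadj a b⟩
  obtain ⟨w, hw⟩ := hK.exists_adj hv
  exact (hadj v w hw).fst_mem

theorem isBlock_of_forall_isBridge {V : Type*} {G : SimpleGraph V} {H : G.Subgraph}
    (hH : TwoConnected H.coe) (h : ∀ a b, G.Adj a b → ¬ H.Adj a b → G.IsBridge s(a, b)) :
    IsBlock G H ∧ ¬ IsSingleEdge G H ∧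
      ∀ H' : G.Subgraph, IsBlock G H' → H' ≠ H → IsSingleEdge G H' := by
  refine ⟨⟨Or.inl hH, fun H' hle h' => ?_⟩, hH.not_isSingleEdge_of_le le_rfl, fun H' h' hne => ?_⟩
  · have h2 := h'.resolve_right (hH.not_isSingleEdge_of_le hle)
    exact le_antisymm (h2.le_of_forall_isBridge h) hle
  · by_contra hn
    have h2 := h'.1.resolve_right hn
    exact hne (h'.2 H (h2.le_of_forall_isBridge h) (Or.inl hH)).symm

theorem exists_standard_block_of_copy {V : Type*} [Fintype V] {G : SimpleGraph V} {n : ℕ}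
    {D : SimpleGraph (Fin n)} (hD : IsStandard D) (hcyc : cyc D = cyc G) (f : Copy D G) :
    ∃ H : G.Subgraph, IsBlock G H ∧ ¬ IsSingleEdge G H ∧
      (∀ H' : G.Subgraph, IsBlock G H' → H' ≠ H → IsSingleEdge G H') ∧ IsStandard H.coe := by
  have e := f.isoToSubgraph
  have hb : ∀ a b, G.Adj a b → ¬ f.toSubgraph.Adj a b → G.IsBridge s(a, b) := by
    intro a b hab hn
    by_contra hbr
    have h1 := cyc_deleteEdges_of_not_isBridge (e := s(a, b)) hab hbr
    have : Copy D (G.deleteEdges {s(a, b)}) := by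
      refine ⟨⟨f, fun {x y} hxy => ?_⟩, f.injective⟩
      simp only [deleteEdges_adj, Set.mem_singleton_iff]
      refine ⟨f.toHom.map_rel hxy, fun hs => hn ?_⟩
      have h3 : f.toSubgraph.Adj (f x) (f y) := ⟨x, y, hxy, rfl, rfl⟩
      rw [← Subgraph.mem_edgeSet] at h3 ⊢
      exact hs ▸ h3
    have h2 := cyc_le_of_copy this
    omega
  obtain ⟨h1, h2, h3⟩ := isBlock_of_forall_isBridge (hD.twoConnected.of_iso e) hb
  exact ⟨f.toSubgraph, h1, h2, h3, hD.of_iso e.symm⟩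

theorem reachable_induce_of_walk {V : Type*} {G : SimpleGraph V} {K : G.Subgraph} {v : K.verts}
    {x y : V} (q : G.Walk x y) (hq : ∀ e ∈ q.edges, e ∈ K.edgeSet) (hv : (v : V) ∉ q.support)
    (hx : x ∈ K.verts) (hy : y ∈ K.verts) :
    (K.coe.induce {u | u ≠ v}).Reachable
      ⟨⟨x, hx⟩, fun h => hv (h ▸ q.start_mem_support)⟩
      ⟨⟨y, hy⟩, fun h => hv (h ▸ q.end_mem_support)⟩ := by
  induction q with
  | nil => exact Reachable.refl _
  | @cons a b c hab q ih =>
    simp only [Walk.edges_cons, List.mem_cons, forall_eq_or_imp, Subgraph.mem_edgeSet,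
      Walk.support_cons, not_or] at hq hv
    refine Reachable.trans (Adj.reachable ?_) (ih hq.2 hv.2 hq.1.snd_mem hy)
    exact hq.1

theorem IsCycle.twoConnected {V : Type*} {G : SimpleGraph V} {u : V} {w : G.Walk u u}
    (hw : w.IsCycle) : TwoConnected w.toSubgraph.coe := by
  refine ⟨w.toSubgraph_connected.coe, ?_, ?_⟩
  · have h3 := hw.three_le_length
    have h1 := List.toFinset_card_of_nodup hw.support_nodup
    have h2 : (w.support.tail.toFinset : Set V) ⊆ w.toSubgraph.verts := by
      intro z hz
      simp only [List.coe_toFinset, Set.mem_ofPred_eq] at hz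
      simpa using List.mem_of_mem_tail hz
    have hfin : w.toSubgraph.verts.Finite := by
      rw [Walk.verts_toSubgraph]; exact List.finite_toSet _
    have h4 := Set.ncard_le_ncard h2 hfin
    rw [Set.ncard_coe_finset, h1, List.length_tail, Walk.length_support] at h4
    rw [Nat.card_coe_set_eq]
    omega
  · rintro ⟨v, hv⟩
    have hvw : v ∈ w.support := by simpa using hv
    obtain ⟨w', hw', hE, hS⟩ : ∃ w' : G.Walk v v, w'.IsCycle ∧
        (∀ e, e ∈ w'.edges → e ∈ w.edges) ∧ ∀ z, z ∈ w.support → z ∈ w'.support :=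
      ⟨w.rotate _ hvw, hw.rotate hvw, fun e he => (w.rotate_edges _ hvw).mem_iff.1 he, fun z hz => by
        simpa using hz⟩
    cases w' with
    | nil => exact absurd hw' Walk.not_isCycle_nil
    | @cons _ b _ hvb p =>
      obtain ⟨hp, -⟩ := (Walk.cons_isCycle_iff p hvb).1 hw'
      have hbK : b ∈ w.toSubgraph.verts := by
        have : s(v, b) ∈ w.edges := hE _ (by simp)
        simpa using w.snd_mem_support_of_mem_edges this
      have key : ∀ z (hz : z ∈ w.toSubgraph.verts) (hzv : z ≠ v),
          (w.toSubgraph.coe.induce {u | u ≠ (⟨v, hv⟩ : w.toSubgraph.verts)}).Reachable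
            ⟨⟨b, hbK⟩, fun h => hvb.ne (congrArg Subtype.val h).symm⟩
            ⟨⟨z, hz⟩, fun h => hzv (congrArg Subtype.val h)⟩ := by
        intro z hz hzv
        have hzp : z ∈ p.support := by
          have := hS z (by simpa using hz)
          rw [Walk.support_cons, List.mem_cons] at this
          exact this.resolve_left hzv
        refine reachable_induce_of_walk (p.takeUntil z hzp) (fun e he => ?_)
          (Walk.endpoint_notMem_support_takeUntil hp hzp hzv.symm) hbK hz
        rw [Walk.mem_edges_toSubgraph]
        exact hE _ (by simp [p.edges_takeUntil_subset_edges hzp he])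
      have : Nonempty {u | u ≠ (⟨v, hv⟩ : w.toSubgraph.verts)} :=
        ⟨⟨⟨b, hbK⟩, fun h => hvb.ne (congrArg Subtype.val h).symm⟩⟩
      refine ⟨fun x y => ?_⟩
      obtain ⟨⟨x, hx⟩, hxv⟩ := x
      obtain ⟨⟨y, hy⟩, hyv⟩ := y
      exact (key x hx fun h => hxv (Subtype.ext h)).symm.trans
        (key y hy fun h => hyv (Subtype.ext h))

theorem adj_of_not_isBridge {V : Type*} [Fintype V] {G : SimpleGraph V} {H : G.Subgraph}
    (hH : ∀ H' : G.Subgraph, IsBlock G H' → H' ≠ H → IsSingleEdge G H') {a b : V}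
    (hab : G.Adj a b) (hbr : ¬ G.IsBridge s(a, b)) : H.Adj a b := by
  rw [isBridge_iff_forall_cycle_notMem (e := s(a, b)) hab] at hbr
  push Not at hbr
  obtain ⟨u, w, hw, he⟩ := hbr
  obtain ⟨M, hle, hM⟩ := Finite.exists_le_maximal (p := fun K : G.Subgraph => TwoConnected K.coe)
    (IsCycle.twoConnected hw)
  have hblock : IsBlock G M := ⟨Or.inl hM.1, fun H' h1 h2 =>
    le_antisymm (hM.2 (h2.resolve_right (hM.1.not_isSingleEdge_of_le h1)) h1) h1⟩
  have hMH : M = H := by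
    by_contra hne
    exact hM.1.not_isSingleEdge_of_le le_rfl (hH M hblock hne)
  subst hMH
  apply hle.2
  rwa [← Subgraph.mem_edgeSet, Walk.mem_edges_toSubgraph]

theorem cyc_le_of_block {V : Type*} [Fintype V] {G : SimpleGraph V} {H : G.Subgraph}
    (h : ∀ a b, G.Adj a b → ¬ G.IsBridge s(a, b) → H.Adj a b) : cyc G ≤ cyc H.coe := by
  obtain ⟨T, hT, hTa, -, hTc⟩ := exists_forest H.coe
  have hle : T.map (Function.Embedding.subtype (· ∈ H.verts)) ≤ G := by
    rintro x y ⟨-, a, b, hab, rfl, rfl⟩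
    exact (hT hab).adj_sub
  obtain ⟨F, hTF, hFG, hFa, hFr, hFc⟩ :=
    exists_forest_of_acyclic_le hle (IsAcyclic.map_embedding hTa _)
  rw [hTc, hFc, Nat.cast_le]
  rw [← Set.ncard_image_of_injective (H.coe.edgeSet \ T.edgeSet)
    (Sym2.map.injective Subtype.val_injective)]
  refine Set.ncard_le_ncard ?_ (Set.toFinite _)
  intro e
  induction e with
  | _ a b =>
    rintro ⟨hG, hF⟩
    rw [mem_edgeSet] at hG hF
    have hab : H.Adj a b := by
      refine h a b hG ?_
      rw [isBridge_iff, not_not]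
      have hr : F.Reachable a b := by rw [hFr]; exact hG.reachable
      refine hr.mono fun x y hxy => ?_
      simp only [deleteEdges_adj, Set.mem_singleton_iff]
      refine ⟨hFG hxy, fun hs => hF ?_⟩
      rw [← mem_edgeSet] at hxy ⊢
      rwa [← hs]
    refine ⟨s(⟨a, hab.fst_mem⟩, ⟨b, hab.snd_mem⟩), ⟨hab, fun hTab => hF (hTF ?_)⟩, rfl⟩
    exact ⟨hG.ne, _, _, hTab, rfl, rfl⟩

theorem cyc_coe_eq_of_block {V : Type*} [Fintype V] {G : SimpleGraph V} {H : G.Subgraph}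
    (hH : ∀ H' : G.Subgraph, IsBlock G H' → H' ≠ H → IsSingleEdge G H') :
    cyc H.coe = cyc G :=
  le_antisymm (cyc_le_of_copy H.coeCopy)
    (cyc_le_of_block fun _ _ hab hbr => adj_of_not_isBridge hH hab hbr)

end Blocks

section BadPairs

open scoped Classical

theorem darts_of_length_eq_three {V : Type*} {G : SimpleGraph V} {u : V}
    {w : G.Walk u u} (h3 : w.length = 3) :
    ∃ (x y z : V) (hxy : G.Adj x y) (hyz : G.Adj y z) (hzx : G.Adj z x),
      w.darts = [⟨(x, y), hxy⟩, ⟨(y, z), hyz⟩, ⟨(z, x), hzx⟩] := by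
  match w, h3 with
  | .cons h1 (.cons h2 (.cons h3 .nil)), _ => exact ⟨_, _, _, h1, h2, h3, rfl⟩

theorem darts_of_isCycle_of_length_eq_four {V : Type*} {G : SimpleGraph V} {u : V}
    {w : G.Walk u u} (hw : w.IsCycle) (h4 : w.length = 4) :
    ∃ (x y z t : V) (hxy : G.Adj x y) (hyz : G.Adj y z) (hzt : G.Adj z t) (htx : G.Adj t x),
      x ≠ z ∧ y ≠ t ∧
      w.darts = [⟨(x, y), hxy⟩, ⟨(y, z), hyz⟩, ⟨(z, t), hzt⟩, ⟨(t, x), htx⟩] := by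
  match w, h4 with
  | .cons h1 (.cons h2 (.cons h3 (.cons h4 .nil))), _ =>
    refine ⟨_, _, _, _, h1, h2, h3, h4, ?_, ?_, rfl⟩
    · have := hw.support_nodup
      simp at this
      tauto
    · have := hw.support_nodup
      simp at this
      tauto

theorem exists_isCycle_three {V : Type*} {G : SimpleGraph V} {x y z : V}
    (hxy : G.Adj x y) (hyz : G.Adj y z) (hzx : G.Adj z x) :
    ∃ w : G.Walk x x, w.IsCycle ∧ w.length = 3 ∧
      w.darts = [⟨(x, y), hxy⟩, ⟨(y, z), hyz⟩, ⟨(z, x), hzx⟩] := by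
  refine ⟨.cons hxy (.cons hyz (.cons hzx .nil)), ?_, rfl, rfl⟩
  have h1 := hxy.ne
  have h2 := hyz.ne
  have h3 := hzx.ne
  simp [Walk.cons_isCycle_iff, Walk.cons_isPath_iff]
  grind

theorem exists_isCycle_four {V : Type*} {G : SimpleGraph V} {x y z t : V}
    (hxy : G.Adj x y) (hyz : G.Adj y z) (hzt : G.Adj z t) (htx : G.Adj t x)
    (hxz : x ≠ z) (hyt : y ≠ t) :
    ∃ w : G.Walk x x, w.IsCycle ∧ w.length = 4 ∧
      w.darts = [⟨(x, y), hxy⟩, ⟨(y, z), hyz⟩, ⟨(z, t), hzt⟩, ⟨(t, x), htx⟩] := by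
  refine ⟨.cons hxy (.cons hyz (.cons hzt (.cons htx .nil))), ?_, rfl, rfl⟩
  have h1 := hxy.ne
  have h2 := hyz.ne
  have h3 := hzt.ne
  have h4 := htx.ne
  simp [Walk.cons_isCycle_iff, Walk.cons_isPath_iff]
  grind

/-- The vertices `p, q, r, s` form a 4-cycle of `G` in this cyclic order. -/
def IsSquare4 {V : Type*} (G : SimpleGraph V) (p q r s : V) : Prop :=
  G.Adj p q ∧ G.Adj q r ∧ G.Adj r s ∧ G.Adj s p ∧ p ≠ r ∧ q ≠ s

/-- The edge `e` is larger than some edge of the closed walk `p, q, r, s, p`. -/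
def NotMinimal {V : Type*} (elt : Sym2 V → Sym2 V → Prop) (p q r s : V) (e : Sym2 V) : Prop :=
  elt s(p, q) e ∨ elt s(q, r) e ∨ elt s(r, s) e ∨ elt s(s, p) e

theorem IsSquare4.rotate {V : Type*} {G : SimpleGraph V} {p q r s : V}
    (h : IsSquare4 G p q r s) : IsSquare4 G q r s p :=
  ⟨h.2.1, h.2.2.1, h.2.2.2.1, h.1, h.2.2.2.2.2, h.2.2.2.2.1.symm⟩

theorem NotMinimal.rotate {V : Type*} {elt : Sym2 V → Sym2 V → Prop} {p q r s : V} {e : Sym2 V}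
    (h : NotMinimal elt p q r s e) : NotMinimal elt q r s p e := by
  unfold NotMinimal at *
  tauto

/-- The path `p, q, r` lies on a directed 3-cycle, or on a directed 4-cycle whose minimal edge
is not in the path. -/
def BadPath {V : Type*} (elt : Sym2 V → Sym2 V → Prop) (G : SimpleGraph V) (p q r : V) : Prop :=
  G.Adj p q ∧ G.Adj q r ∧ p ≠ r ∧ (G.Adj p r ∨ ∃ x, IsSquare4 G p q r x ∧
    NotMinimal elt p q r x s(p, q) ∧ NotMinimal elt p q r x s(q, r))

/-- The opposite arcs `p → q`, `r → s` lie on a directed 4-cycle whose minimal edge is neither of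
them. -/
def BadSquare {V : Type*} (elt : Sym2 V → Sym2 V → Prop) (G : SimpleGraph V) (p q r s : V) : Prop :=
  IsSquare4 G p q r s ∧ NotMinimal elt p q r s s(p, q) ∧ NotMinimal elt p q r s s(r, s)

theorem IsSquare4.badPair {V : Type*} {elt : Sym2 V → Sym2 V → Prop} {G : SimpleGraph V} {p q r s : V}
    (h : IsSquare4 G p q r s) {a b : G.Dart} (hne : a.edge ≠ b.edge)
    (ha : a.toProd ∈ [(p, q), (q, r), (r, s), (s, p)])
    (hb : b.toProd ∈ [(p, q), (q, r), (r, s), (s, p)])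
    (ha' : NotMinimal elt p q r s a.edge) (hb' : NotMinimal elt p q r s b.edge) :
    BadPair G elt a b := by
  obtain ⟨h1, h2, h3, h4, h5, h6⟩ := h
  obtain ⟨w, hw, hl, hd⟩ := exists_isCycle_four h1 h2 h3 h4 h5 h6
  refine ⟨hne, Or.inr ⟨p, w, hw, hl, ?_⟩⟩
  simp only [Walk.edges, hd]
  unfold NotMinimal at ha' hb'
  simpa [Dart.ext_iff, Dart.edge_mk] using ⟨by simpa using ha, by simpa using hb, ha', hb'⟩

theorem badPair_iff {V : Type*} {elt : Sym2 V → Sym2 V → Prop} {G : SimpleGraph V} (a b : G.Dart) :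
    BadPair G elt a b ↔
      (a.snd = b.fst ∧ BadPath elt G a.fst a.snd b.snd) ∨
      (b.snd = a.fst ∧ BadPath elt G b.fst b.snd a.snd) ∨
      BadSquare elt G a.fst a.snd b.fst b.snd := by
  constructor
  · rintro ⟨hne, ⟨u, w, hw, h3, ha, hb⟩ | ⟨u, w, hw, h4, ha, hb, ha', hb'⟩⟩
    · obtain ⟨x, y, z, hxy, hyz, hzx, hd⟩ := darts_of_length_eq_three h3
      simp only [hd, List.mem_cons, List.not_mem_nil, or_false] at ha hb
      have n1 := hxy.ne
      have n2 := hyz.ne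
      have n3 := hzx.ne
      unfold BadPath
      rcases ha with rfl | rfl | rfl <;> rcases hb with rfl | rfl | rfl <;>
        first
        | exact absurd rfl hne
        | (left; exact ⟨rfl, by assumption, by assumption, Ne.symm (by assumption),
            Or.inl (SimpleGraph.Adj.symm (by assumption))⟩)
        | (right; left; exact ⟨rfl, by assumption, by assumption, Ne.symm (by assumption),
            Or.inl (SimpleGraph.Adj.symm (by assumption))⟩)
    · obtain ⟨x, y, z, t, hxy, hyz, hzt, htx, hxz, hyt, hd⟩ :=
        darts_of_isCycle_of_length_eq_four hw h4
      simp only [Walk.edges, hd, List.map_cons, List.map_nil, Dart.edge_mk, List.mem_cons,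
        List.not_mem_nil, or_false, exists_eq_or_imp, exists_eq_left] at ha hb ha' hb'
      have hs1 : IsSquare4 G x y z t := ⟨hxy, hyz, hzt, htx, hxz, hyt⟩
      have hs2 := hs1.rotate
      have hs3 := hs2.rotate
      have hs4 := hs3.rotate
      have a1 : NotMinimal elt x y z t a.edge := ha'
      have b1 : NotMinimal elt x y z t b.edge := hb'
      have a2 := a1.rotate
      have a3 := a2.rotate
      have a4 := a3.rotate
      have b2 := b1.rotate
      have b3 := b2.rotate
      have b4 := b3.rotate
      clear ha' hb' hd
      unfold BadPath BadSquare
      rcases ha with rfl | rfl | rfl | rfl <;> rcases hb with rfl | rfl | rfl | rfl <;>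
        first
        | exact absurd rfl hne
        | (left; exact ⟨rfl, by assumption, by assumption,
            by first | assumption | exact Ne.symm (by assumption),
            Or.inr ⟨_, by assumption, by assumption, by assumption⟩⟩)
        | (right; left; exact ⟨rfl, by assumption, by assumption,
            by first | assumption | exact Ne.symm (by assumption),
            Or.inr ⟨_, by assumption, by assumption, by assumption⟩⟩)
        | (right; right; exact ⟨by assumption, by assumption, by assumption⟩)
  · have hpath : ∀ a b : G.Dart, a.snd = b.fst ∧ BadPath elt G a.fst a.snd b.snd →
        BadPair G elt a b := by
      rintro ⟨⟨p, q⟩, hpq⟩ ⟨⟨q', r⟩, hqr⟩ ⟨rfl : q = q', -, -, hpr, h⟩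
      have hne : s(p, q) ≠ s(q, r) := by
        rw [Ne, Sym2.eq_iff]
        have := hpq.ne
        tauto
      rcases h with h | ⟨x, hx, h1, h2⟩
      · obtain ⟨w, hw, hl, hd⟩ := exists_isCycle_three hpq hqr h.symm
        exact ⟨hne, Or.inl ⟨p, w, hw, hl, by simp [hd], by simp [hd]⟩⟩
      · exact hx.badPair hne (by simp) (by simp) h1 h2
    rintro (h | h | ⟨h, h1, h2⟩)
    · exact hpath a b h
    · obtain ⟨h1, h2⟩ := hpath b a h
      refine ⟨h1.symm, ?_⟩
      rcases h2 with ⟨u, w, hw, hl, hd, hd'⟩ | ⟨u, w, hw, hl, hd, hd', he, he'⟩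
      · exact Or.inl ⟨u, w, hw, hl, hd', hd⟩
      · exact Or.inr ⟨u, w, hw, hl, hd', hd, he', he⟩
    · refine h.badPair ?_ (by simp) (by simp) h1 h2
      obtain ⟨h1, h2, h3, h4, h5, h6⟩ := h
      intro he
      have : s(a.fst, a.snd) = s(b.fst, b.snd) := he
      rw [Sym2.eq_iff] at this
      rcases this with h | h
      · exact h5 h.1
      · exact h2.ne h.2

end BadPairs

section BadPairCount

open scoped Classical

theorem n1_mul_two {V : Type*} [Fintype V] {elt : Sym2 V → Sym2 V → Prop} (G : SimpleGraph V) :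
    2 * n1 G elt =
      #(univ.filter fun z : G.Dart × G.Dart => BadPair G elt z.1 z.2) := by
  have hsymm : ∀ a b : G.Dart, BadPair G elt a b → BadPair G elt b a := by
    intro a b h
    rw [badPair_iff] at h ⊢
    have h' : BadSquare elt G a.fst a.snd b.fst b.snd → BadSquare elt G b.fst b.snd a.fst a.snd :=
      fun h => ⟨h.1.rotate.rotate, h.2.2.rotate.rotate, h.2.1.rotate.rotate⟩
    tauto
  let R : SimpleGraph G.Dart :=
    { Adj := BadPair G elt
      symm := ⟨fun a b => hsymm a b⟩
      loopless := ⟨fun a h => h.1 rfl⟩ }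
  have hn : n1 G elt = #R.edgeFinset := by
    rw [n1, ← Set.ncard_coe_finset, coe_edgeFinset]
    congr 1
    ext z
    induction z with
    | _ x y =>
      constructor
      · rintro ⟨a, b, h, he⟩
        rw [he]
        exact h
      · exact fun h => ⟨x, y, h, rfl⟩
  rw [hn, two_mul_card_edgeFinset]

theorem card_badPair {V : Type*} [Fintype V] {elt : Sym2 V → Sym2 V → Prop} (G : SimpleGraph V) :
    #(univ.filter fun z : G.Dart × G.Dart => BadPair G elt z.1 z.2) =
      2 * #(univ.filter fun t : V × V × V => BadPath elt G t.1 t.2.1 t.2.2) +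
      #(univ.filter fun t : V × V × V × V => BadSquare elt G t.1 t.2.1 t.2.2.1 t.2.2.2) := by
  let A := univ.filter fun z : G.Dart × G.Dart =>
    z.1.snd = z.2.fst ∧ BadPath elt G z.1.fst z.1.snd z.2.snd
  let B := univ.filter fun z : G.Dart × G.Dart =>
    z.2.snd = z.1.fst ∧ BadPath elt G z.2.fst z.2.snd z.1.snd
  let C := univ.filter fun z : G.Dart × G.Dart =>
    BadSquare elt G z.1.fst z.1.snd z.2.fst z.2.snd
  have hA : #A = #(univ.filter fun t : V × V × V => BadPath elt G t.1 t.2.1 t.2.2) := by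
    refine card_bij (fun z _ => (z.1.fst, z.1.snd, z.2.snd)) ?_ ?_ ?_
    · simp +contextual [A]
    · rintro ⟨⟨⟨p, q⟩, h⟩, ⟨⟨r, s⟩, h'⟩⟩ hz ⟨⟨⟨p', q'⟩, k⟩, ⟨⟨r', s'⟩, k'⟩⟩ hz'
      simp only [A, Finset.mem_filter, mem_univ, true_and] at hz hz'
      have := hz.1
      have := hz'.1
      simp_all
    · rintro ⟨p, q, r⟩ h
      simp only [Finset.mem_filter, mem_univ, true_and] at h
      exact ⟨(⟨(p, q), h.1⟩, ⟨(q, r), h.2.1⟩), by simpa [A] using h, rfl⟩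
  have hB : #B = #A := by
    refine card_bij (fun z _ => (z.2, z.1)) ?_ ?_ ?_
    · simp [A, B]
    · simp +contextual [Prod.ext_iff]
    · exact fun z hz => ⟨(z.2, z.1), by simpa [A, B] using hz, rfl⟩
  have hC : #C =
      #(univ.filter fun t : V × V × V × V => BadSquare elt G t.1 t.2.1 t.2.2.1 t.2.2.2) := by
    refine card_bij (fun z _ => (z.1.fst, z.1.snd, z.2.fst, z.2.snd)) ?_ ?_ ?_
    · simp [C]
    · rintro ⟨⟨⟨p, q⟩, h⟩, ⟨⟨r, s⟩, h'⟩⟩ hz ⟨⟨⟨p', q'⟩, k⟩, ⟨⟨r', s'⟩, k'⟩⟩ hz'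
      simp +contextual
    · rintro ⟨p, q, r, s⟩ h
      simp only [Finset.mem_filter, mem_univ, true_and] at h
      exact ⟨(⟨(p, q), h.1.1⟩, ⟨(r, s), h.1.2.2.1⟩), by simpa [C] using h, rfl⟩
  have hU : (univ.filter fun z : G.Dart × G.Dart => BadPair G elt z.1 z.2) = A ∪ (B ∪ C) := by
    ext z
    simp [A, B, C, badPair_iff]
  have hBC : Disjoint B C := by
    rw [Finset.disjoint_left]
    intro z hb hc
    simp only [B, C, Finset.mem_filter, mem_univ, true_and] at hb hc
    exact hc.1.2.2.2.1.ne hb.1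
  have hABC : Disjoint A (B ∪ C) := by
    rw [Finset.disjoint_left]
    intro z ha hbc
    simp only [A, B, C, Finset.mem_filter, mem_univ, true_and, Finset.mem_union] at ha hbc
    rcases hbc with hb | hc
    · exact ha.2.2.2.1 hb.1.symm
    · exact hc.1.2.1.ne ha.1
  rw [hU, card_union_of_disjoint hABC, card_union_of_disjoint hBC, hB, hA, hC]
  ring

theorem exists_minimal_pair {ι α : Type*} (r : α → α → Prop) [IsStrictTotalOrder α r]
    {s : Finset ι} (hs : s.Nonempty) (f g : ι → α) :
    ∃ v ∈ s, (∀ z ∈ s, ¬ r (f z) (f v) ∧ ¬ r (g z) (f v)) ∨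
      ∀ z ∈ s, ¬ r (f z) (g v) ∧ ¬ r (g z) (g v) := by
  let := linearOrderOfSTO r
  obtain ⟨v, hv, hmin⟩ := exists_min_image s (fun z => min (f z) (g z)) hs
  refine ⟨v, hv, ?_⟩
  have h1 : ∀ z ∈ s, min (f v) (g v) ≤ f z ∧ min (f v) (g v) ≤ g z :=
    fun z hz => le_min_iff.1 (hmin z hz)
  rcases min_choice (f v) (g v) with h | h <;> rw [h] at h1
  · exact Or.inl fun z hz => ⟨not_lt.2 (h1 z hz).1, not_lt.2 (h1 z hz).2⟩
  · exact Or.inr fun z hz => ⟨not_lt.2 (h1 z hz).1, not_lt.2 (h1 z hz).2⟩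

theorem lt_or_and_iff_not {α : Type*} (r : α → α → Prop) [IsStrictTotalOrder α r] {a b c d : α}
    (hab : a ≠ b) (had : a ≠ d) (hbc : b ≠ c) (hcd : c ≠ d) :
    ((r a a ∨ r b a ∨ r c a ∨ r d a) ∧ (r a c ∨ r b c ∨ r c c ∨ r d c)) ↔
      ¬ ((r a b ∨ r b b ∨ r c b ∨ r d b) ∧ (r a d ∨ r b d ∨ r c d ∨ r d d)) := by
  let := linearOrderOfSTO r
  change ((a < a ∨ b < a ∨ c < a ∨ d < a) ∧ (a < c ∨ b < c ∨ c < c ∨ d < c)) ↔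
      ¬ ((a < b ∨ b < b ∨ c < b ∨ d < b) ∧ (a < d ∨ b < d ∨ c < d ∨ d < d))
  clear_value this
  grind

theorem card_badPath_fiber {V : Type*} [Fintype V] {elt : Sym2 V → Sym2 V → Prop}
    [IsStrictTotalOrder (Sym2 V) elt] (G : SimpleGraph V)
    {u w : V} (huw : u ≠ w) :
    #(univ.filter fun v => BadPath elt G u v w) =
      if G.Adj u w then #(cn G u w) else #(cn G u w) - 1 := by
  split_ifs with h
  · congr 1
    ext v
    simp [BadPath, h, huw, G.adj_comm w v]
  rcases (cn G u w).eq_empty_or_nonempty with he | hne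
  · rw [he, card_empty, Nat.zero_sub, card_eq_zero, filter_eq_empty_iff]
    rintro v - ⟨h1, h2, -⟩
    exact Finset.notMem_empty v (he ▸ mem_cn.2 ⟨h1, h2.symm⟩)
  obtain ⟨v, hv, hmin⟩ := exists_minimal_pair elt hne (fun z => s(u, z)) (fun z => s(z, w))
  rw [← card_erase_of_mem hv]
  congr 1
  ext z
  simp only [Finset.mem_filter, mem_univ, true_and, BadPath, Finset.mem_erase, mem_cn, h, false_or]
  have hd : ∀ x y, x ≠ y → G.Adj w y → s(u, x) ≠ s(y, w) := by
    intro x y hxy hwy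
    rw [Ne, Sym2.eq_iff]
    rintro (⟨rfl, -⟩ | ⟨h1, -⟩)
    · exact h hwy.symm
    · exact huw h1
  obtain ⟨hv1, hv2⟩ := mem_cn.1 hv
  constructor
  · rintro ⟨h1, h2, -, x, hx, h3, h4⟩
    refine ⟨?_, h1, h2.symm⟩
    rintro rfl
    have hxc : x ∈ cn G u w := mem_cn.2 ⟨hx.2.2.2.1.symm, hx.2.2.1⟩
    have e1 : s(w, x) = s(x, w) := Sym2.eq_swap
    have e2 : s(x, u) = s(u, x) := Sym2.eq_swap
    simp only [NotMinimal, e1, e2] at h3 h4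
    rcases hmin with h | h
    · have := h z hv
      have := h x hxc
      tauto
    · have := h z hv
      have := h x hxc
      tauto
  · rintro ⟨hzv, hz1, hz2⟩
    have hzc : z ∈ cn G u w := mem_cn.2 ⟨hz1, hz2⟩
    refine ⟨hz1, hz2.symm, huw, v, ⟨hz1, hz2.symm, hv2, hv1.symm, huw, hzv⟩, ?_⟩
    have e1 : s(w, v) = s(v, w) := Sym2.eq_swap
    have e2 : s(v, u) = s(u, v) := Sym2.eq_swap
    simp only [NotMinimal, e1, e2]
    have hlt : ∀ {a c}, ¬ elt a c → c ≠ a → elt c a := fun {a c} h1 h2 =>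
      ((trichotomous_of elt c a).resolve_right (not_or.2 ⟨h2, h1⟩))
    rcases hmin with h | h
    · obtain ⟨h1, h2⟩ := h z hzc
      have := hlt h1 (by simp only [Ne, Sym2.eq_iff]; grind)
      have := hlt h2 (hd v z hzv.symm hz2)
      tauto
    · obtain ⟨h1, h2⟩ := h z hzc
      have := hlt h1 (hd z v hzv hv2).symm
      have := hlt h2 (by simp only [Ne, Sym2.eq_iff]; grind)
      tauto

theorem card_badPath {V : Type*} [Fintype V] {elt : Sym2 V → Sym2 V → Prop}
    [IsStrictTotalOrder (Sym2 V) elt] (G : SimpleGraph V) :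
    #(univ.filter fun t : V × V × V => BadPath elt G t.1 t.2.1 t.2.2) =
      ∑ u, ∑ w, if u = w then 0 else if G.Adj u w then #(cn G u w) else #(cn G u w) - 1 := by
  rw [card_filter]
  simp only [Fintype.sum_prod_type]
  refine sum_congr rfl fun u _ => ?_
  rw [sum_comm]
  refine sum_congr rfl fun w _ => ?_
  rw [← card_filter]
  split_ifs with h h'
  · subst h
    rw [card_eq_zero, filter_eq_empty_iff]
    rintro v - ⟨-, -, h, -⟩
    exact h rfl
  · rw [card_badPath_fiber G h, if_pos h']
  · rw [card_badPath_fiber G h, if_neg h']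

theorem card_isSquare4 {V : Type*} [Fintype V] (G : SimpleGraph V) :
    #(univ.filter fun t : V × V × V × V => IsSquare4 G t.1 t.2.1 t.2.2.1 t.2.2.2) =
      ∑ u, ∑ w, if u = w then 0 else #(cn G u w) * (#(cn G u w) - 1) := by
  rw [card_filter]
  simp only [Fintype.sum_prod_type]
  refine sum_congr rfl fun u _ => ?_
  rw [sum_comm]
  refine sum_congr rfl fun w _ => ?_
  rw [← Fintype.sum_prod_type' (f := fun v x => if IsSquare4 G u v w x then 1 else 0),
    ← card_filter]
  split_ifs with h
  · subst h
    rw [card_eq_zero, filter_eq_empty_iff]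
    rintro v - ⟨-, -, -, -, h, -⟩
    exact h rfl
  · rw [Nat.mul_sub_one, ← offDiag_card]
    congr 1
    ext ⟨v, x⟩
    simp only [Finset.mem_filter, mem_univ, true_and, mem_offDiag, mem_cn]
    rw [IsSquare4, G.adj_comm v w, G.adj_comm x u]
    tauto

theorem IsSquare4.notMinimal_iff {V : Type*} {elt : Sym2 V → Sym2 V → Prop}
    [IsStrictTotalOrder (Sym2 V) elt] {G : SimpleGraph V}
    {p q r s : V} (h : IsSquare4 G p q r s) :
    (NotMinimal elt p q r s s(p, q) ∧ NotMinimal elt p q r s s(r, s)) ↔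
      ¬ (NotMinimal elt p q r s s(q, r) ∧ NotMinimal elt p q r s s(s, p)) := by
  obtain ⟨h1, h2, h3, h4, h5, h6⟩ := h
  have n1 := h1.ne
  have n2 := h2.ne
  have n3 := h3.ne
  have n4 := h4.ne
  have e1 : s(p, q) ≠ s(q, r) := by rw [Ne, Sym2.eq_iff]; tauto
  have e2 : s(p, q) ≠ s(r, s) := by rw [Ne, Sym2.eq_iff]; tauto
  have e3 : s(p, q) ≠ s(s, p) := by rw [Ne, Sym2.eq_iff]; tauto
  have e4 : s(q, r) ≠ s(r, s) := by rw [Ne, Sym2.eq_iff]; tauto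
  have e5 : s(q, r) ≠ s(s, p) := by rw [Ne, Sym2.eq_iff]; tauto
  have e6 : s(r, s) ≠ s(s, p) := by rw [Ne, Sym2.eq_iff]; tauto
  exact lt_or_and_iff_not elt e1 e3 e4 e6

theorem two_mul_card_badSquare {V : Type*} [Fintype V] {elt : Sym2 V → Sym2 V → Prop}
    [IsStrictTotalOrder (Sym2 V) elt]
    (G : SimpleGraph V) :
    2 * #(univ.filter fun t : V × V × V × V => BadSquare elt G t.1 t.2.1 t.2.2.1 t.2.2.2) =
      #(univ.filter fun t : V × V × V × V => IsSquare4 G t.1 t.2.1 t.2.2.1 t.2.2.2) := by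
  rw [← card_filter_add_card_filter_not
    (s := univ.filter fun t : V × V × V × V => IsSquare4 G t.1 t.2.1 t.2.2.1 t.2.2.2)
    (fun t => BadSquare elt G t.1 t.2.1 t.2.2.1 t.2.2.2), two_mul]
  congr 1
  · congr 1
    ext t
    simp only [Finset.mem_filter, mem_univ, true_and]
    exact ⟨fun h => ⟨h.1, h⟩, fun h => h.2⟩
  · refine card_bij (fun t _ => (t.2.1, t.2.2.1, t.2.2.2, t.1)) ?_ ?_ ?_
    · rintro ⟨p, q, r, s⟩ h
      simp only [Finset.mem_filter, mem_univ, true_and] at h ⊢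
      refine ⟨h.1.rotate, fun h' => ?_⟩
      exact h.1.notMinimal_iff.1 h.2
        ⟨h'.2.1.rotate.rotate.rotate, h'.2.2.rotate.rotate.rotate⟩
    · simp +contextual [Prod.ext_iff]
    · rintro ⟨q, r, s, p⟩ h
      simp only [Finset.mem_filter, mem_univ, true_and] at h
      have hs : IsSquare4 G p q r s := h.1.rotate.rotate.rotate
      refine ⟨(p, q, r, s), ?_, rfl⟩
      simp only [Finset.mem_filter, mem_univ, true_and]
      refine ⟨hs, hs.notMinimal_iff.2 fun h' => h.2 ⟨h.1, h'.1.rotate, h'.2.rotate⟩⟩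

theorem four_mul_n1 {V : Type*} [Fintype V] (G : SimpleGraph V) {elt : Sym2 V → Sym2 V → Prop}
    (hord : IsStrictTotalOrder (Sym2 V) elt) : 4 * n1 G elt = totalWeight G := by
  have h1 := n1_mul_two G (elt := elt)
  rw [card_badPair, card_badPath] at h1
  have h2 := two_mul_card_badSquare G (elt := elt)
  rw [card_isSquare4] at h2
  have h3 : totalWeight G =
      4 * (∑ u, ∑ w, if u = w then 0 else if G.Adj u w then #(cn G u w) else #(cn G u w) - 1) +
      ∑ u, ∑ w, if u = w then 0 else #(cn G u w) * (#(cn G u w) - 1) := by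
    simp only [totalWeight, mul_sum, ← sum_add_distrib]
    refine sum_congr rfl fun u _ => sum_congr rfl fun w _ => ?_
    rw [pairWeight]
    split_ifs <;> ring
  omega

end BadPairCount

open Filter in
theorem stmt9 {V : Type*} [Fintype V] (G : SimpleGraph V)
    (elt : Sym2 V → Sym2 V → Prop) (hord : IsStrictTotalOrder (Sym2 V) elt) :
    gammaTwo G elt = 0 ↔
      (G.IsAcyclic ∨
        ∃ H : G.Subgraph, IsBlock G H ∧ ¬ IsSingleEdge G H ∧
          (∀ H' : G.Subgraph, IsBlock G H' → H' ≠ H → IsSingleEdge G H') ∧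
          (Nonempty (H.coe ≃g (⊤ : SimpleGraph (Fin 4))) ∨
            (∃ ℓ : ℕ, 3 ≤ ℓ ∧ Nonempty (H.coe ≃g GnGraph ℓ)) ∨
            (∃ ℓ : ℕ, 2 ≤ ℓ ∧ Nonempty (H.coe ≃g K2Graph (ℓ + 2))))) := by
  have h4 := four_mul_n1 G hord
  have hγ : gammaTwo G elt = 0 ↔ (totalWeight G : ℤ) = 8 * (cyc G * (cyc G + 2)) := by
    rw [gammaTwo, ← h4]
    push_cast
    constructor <;> intro h <;> linarith
  obtain ⟨hle, hcore⟩ := totalWeight_le_and G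
  rw [hγ]
  constructor
  · intro h
    rcases hcore h with h0 | hfull
    · exact Or.inl (cyc_eq_zero_iff.1 h0)
    · obtain ⟨n, D, hD, hcyc, ⟨f⟩⟩ := hfull.exists_copy
      exact Or.inr (exists_standard_block_of_copy hD hcyc f)
  · rintro (hac | ⟨H, -, -, hH, hstd⟩)
    · rw [cyc_eq_zero_iff.2 hac] at hle ⊢
      omega
    · classical
      refine le_antisymm hle ?_
      have h1 := IsStandard.le_totalWeight (D := H.coe) hstd
      rw [cyc_coe_eq_of_block hH] at h1
      exact h1.trans (Nat.cast_le.2 (totalWeight_le_of_copy H.coeCopy))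

end SEP
end

section
/- Fix n ≥ 4. Label K_{2,n−2} on vertex set {1,…,n} with edge set {1,2}×{3,…,n}, let G_n = K_{2,n−2} together with the edge 12, and let G_{n−1} be the analogous graph on {1,…,n−1}. Fix total orders on the edge sets of these graphs in which the edges 2n < 2(n−1) < ⋯ < 23 are the smallest elements (for G_{n−1}: 2(n−1) < ⋯ < 23), and let Δ_{K_{2,n−2}}, Δ_{G_n}, Δ_{G_{n−1}} denote the associated face complexes. Then: (i) Δ_{K_{2,n−2}} is isomorphic as a simplicial complex to the join of the complex consisting of the two disjoint vertices e_{2,n} and e_{n,2} with the complex Δ_{G_{n−1}}; (ii) the iterated edge contraction (Δ_{G_n}/{e_{1,2}, e_{1,n}})/{e_{2,1}, e_{n,1}} is isomorphic as a simplicial complex to Δ_{K_{2,n−2}}. -/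
open SimpleGraph Finset Filter

namespace SEP

/-- Conflicts between the arcs `a → b` and `c → d` in the face complex of `K_{2,n-2}`. -/
def K2Conflict (n a b c d : ℕ) : Prop :=
  (a = 0 ∧ 2 ≤ b ∧ 2 ≤ c ∧ d = 0) ∨
  (a = 0 ∧ c = 1 ∧ 2 ≤ d ∧ d < b) ∨
  (a = 1 ∧ 2 ≤ b ∧ b + 1 < n ∧ c = b ∧ d = 0) ∨
  (a = 0 ∧ 2 ≤ b ∧ b + 1 < n ∧ c = b ∧ d = 1) ∨
  (2 ≤ a ∧ b = 1 ∧ a < c ∧ d = 0) ∨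
  (2 ≤ a ∧ b = 1 ∧ c = 1 ∧ d = a)

/-- Conflicts between the arcs `a → b` and `c → d` in the face complex of `G_n`. -/
def GnConflict (a b c d : ℕ) : Prop :=
  (a = 0 ∧ 1 ≤ b ∧ 1 ≤ c ∧ d = 0) ∨
  (a = 0 ∧ c = 1 ∧ 2 ≤ d ∧ (d < b ∨ b = 1)) ∨
  (a = 1 ∧ 2 ≤ b ∧ c = b ∧ d = 0) ∨
  (a = 0 ∧ 2 ≤ b ∧ c = b ∧ d = 1) ∨
  (2 ≤ a ∧ b = 1 ∧ (a < c ∨ c = 1) ∧ d = 0) ∨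
  (2 ≤ a ∧ b = 1 ∧ c = 1 ∧ d = a)

/-- `d` has source of index `a` and target of index `b`. -/
def IsArc {n : ℕ} {G : SimpleGraph (Fin n)} (d : G.Dart) (a b : ℕ) : Prop :=
  d.fst.val = a ∧ d.snd.val = b

lemma IsArc.ext {n : ℕ} {G : SimpleGraph (Fin n)} {d e : G.Dart} {a b : ℕ}
    (hd : IsArc d a b) (he : IsArc e a b) : d = e := by
  apply Dart.ext
  exact Prod.ext (Fin.ext (hd.1.trans he.1.symm)) (Fin.ext (hd.2.trans he.2.symm))

lemma K2Graph_adj {n : ℕ} {a b : Fin n} :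
    (K2Graph n).Adj a b ↔ (a.val < 2 ∧ 2 ≤ b.val) ∨ (b.val < 2 ∧ 2 ≤ a.val) := by
  simp only [K2Graph, SimpleGraph.fromRel_adj, ne_eq, Fin.ext_iff]
  omega

lemma GnGraph_adj {n : ℕ} {a b : Fin n} :
    (GnGraph n).Adj a b ↔ a.val ≠ b.val ∧ (a.val < 2 ∨ b.val < 2) := by
  simp only [GnGraph, SimpleGraph.fromRel_adj, ne_eq, Fin.ext_iff]

section Cycles

variable {n : ℕ} {G : SimpleGraph (Fin n)}

lemma length_le_four_of_isCycle (hG : ∀ a b, G.Adj a b → a.val < 2 ∨ b.val < 2)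
    {u : Fin n} (w : G.Walk u u) (hw : w.IsCycle) : w.length ≤ 4 := by
  have hnd := hw.support_nodup
  match w with
  | .nil => simp
  | .cons _ .nil => simp
  | .cons _ (.cons _ .nil) => simp
  | .cons _ (.cons _ (.cons _ .nil)) => simp
  | .cons _ (.cons _ (.cons _ (.cons _ .nil))) => simp
  | .cons h1 (.cons h2 (.cons h3 (.cons h4 (.cons h5 .nil)))) =>
    simp [Fin.ext_iff] at hnd
    have := hG _ _ h1
    have := hG _ _ h2
    have := hG _ _ h3
    have := hG _ _ h4
    have := hG _ _ h5
    omega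
  | .cons h1 (.cons h2 (.cons h3 (.cons h4 (.cons h5 (.cons h6 p))))) =>
    simp [Fin.ext_iff] at hnd
    have := hG _ _ h2
    have := hG _ _ h4
    have := hG _ _ h6
    have hne := p.start_mem_support
    grind

lemma isArc_of_isCycle_three (hG : ∀ a b, G.Adj a b → a.val < 2 ∨ b.val < 2)
    {u : Fin n} (w : G.Walk u u) (hw : w.IsCycle) (hl : w.length = 3) :
    (∃ a b : Fin n, a.val = 0 ∧ b.val = 1 ∧ G.Adj a b) ∧ ∃ i, 2 ≤ i ∧
      ((∀ d ∈ w.darts, IsArc d 0 1 ∨ IsArc d 1 i ∨ IsArc d i 0) ∨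
        (∀ d ∈ w.darts, IsArc d 0 i ∨ IsArc d i 1 ∨ IsArc d 1 0)) := by
  have hnd := hw.support_nodup
  match w with
  | .cons (v := x) h1 (.cons (v := y) h2 (.cons h3 .nil)) =>
    simp [Fin.ext_iff] at hnd
    have k1 := hG _ _ h1
    have k2 := hG _ _ h2
    have k3 := hG _ _ h3
    simp only [Walk.darts_cons, Walk.darts_nil, List.forall_mem_cons, IsArc]
    have key : ∀ a b c : Fin n, G.Adj a b → a.val < 2 → b.val < 2 → a.val ≠ b.val →
        (∃ a b : Fin n, a.val = 0 ∧ b.val = 1 ∧ G.Adj a b) := by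
      intro a b c h ha hb hab
      rcases Nat.lt_or_ge a.val 1 with h0 | h0
      · exact ⟨a, b, by omega, by omega, h⟩
      · exact ⟨b, a, by omega, by omega, h.symm⟩
    constructor
    · by_cases hu : u.val < 2
      · by_cases hx : x.val < 2
        · exact key u x y h1 hu hx (by omega)
        · exact key u y x h3.symm hu (by omega) (by omega)
      · exact key x y u h2 (by omega) (by omega) (by omega)
    · refine ⟨max u.val (max x.val y.val), by omega, ?_⟩
      simp only [List.not_mem_nil, false_imp_iff, implies_true, and_true]
      omega

lemma isArc_of_isCycle_four (hG : ∀ a b, G.Adj a b → a.val < 2 ∨ b.val < 2)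
    {u : Fin n} (w : G.Walk u u) (hw : w.IsCycle) (hl : w.length = 4) :
    ∃ i j : Fin n, 2 ≤ i.val ∧ 2 ≤ j.val ∧ i ≠ j ∧
      ∀ d ∈ w.darts, IsArc d 0 i ∨ IsArc d i 1 ∨ IsArc d 1 j ∨ IsArc d j 0 := by
  have hnd := hw.support_nodup
  match w with
  | .cons (v := x) h1 (.cons (v := y) h2 (.cons (v := t) h3 (.cons h4 .nil))) =>
    simp [Fin.ext_iff] at hnd
    have k1 := hG _ _ h1
    have k2 := hG _ _ h2
    have k3 := hG _ _ h3
    have k4 := hG _ _ h4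
    simp only [Walk.darts_cons, Walk.darts_nil, List.forall_mem_cons, IsArc, ne_eq, Fin.ext_iff,
      List.not_mem_nil, false_imp_iff, implies_true, and_true]
    by_cases hu : u.val < 2
    · by_cases hu0 : u.val = 0
      · exact ⟨x, t, by omega⟩
      · exact ⟨t, x, by omega⟩
    · by_cases hx0 : x.val = 0
      · exact ⟨y, u, by omega⟩
      · exact ⟨u, y, by omega⟩

end Cycles

lemma isFace_iff_of_conflict {n : ℕ} {G : SimpleGraph (Fin n)}
    {elt : Sym2 (Fin n) → Sym2 (Fin n) → Prop}
    (hG : ∀ a b, G.Adj a b → a.val < 2 ∨ b.val < 2) (S : Set G.Dart) :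
    IsFace G elt S ↔ (∀ d ∈ S, d.symm ∉ S) ∧ ∀ d ∈ S, ∀ d' ∈ S, d ≠ d' →
      ∀ (u : Fin n) (w : G.Walk u u), w.IsCycle → d ∈ w.darts → d' ∈ w.darts →
        w.length ≠ 3 ∧ (w.length = 4 → (∃ e ∈ w.edges, elt e d.edge) →
          ¬ ∃ e ∈ w.edges, elt e d'.edge) := by
  have hfin : ∀ T : Set G.Dart, T.Finite := fun T => by
    classical
    exact T.toFinite
  constructor
  · rintro ⟨h1, h2⟩
    refine ⟨fun d hd hs => h1 ⟨d, hd, hs⟩, fun d hd d' hd' hne u w hw hm hm' => ⟨fun hl => ?_,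
      fun hl hmin hmin' => ?_⟩⟩
    · have h := (h2 2 le_rfl u w hw).1 hl
      exact h.not_ge ((Set.one_lt_ncard (hfin _)).2 ⟨d, ⟨hd, hm⟩, d', ⟨hd', hm'⟩, hne⟩)
    · have h := (h2 2 le_rfl u w hw).2 hl
      exact h.not_ge ((Set.one_lt_ncard (hfin _)).2
        ⟨d, ⟨hd, hm, hmin⟩, d', ⟨hd', hm', hmin'⟩, hne⟩)
  · rintro ⟨h1, h2⟩
    refine ⟨fun ⟨d, hd, hs⟩ => h1 d hd hs, fun ℓ hℓ u w hw => ?_⟩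
    have h4 := length_le_four_of_isCycle hG w hw
    refine ⟨fun hl => ?_, fun hl => ?_⟩
    · obtain rfl : ℓ = 2 := by omega
      by_contra! hc
      obtain ⟨d, hd, d', hd', hne⟩ := (Set.one_lt_ncard (hfin _)).1 hc
      exact (h2 d hd.1 d' hd'.1 hne u w hw hd.2 hd'.2).1 hl
    · obtain rfl : ℓ = 2 := by omega
      by_contra! hc
      obtain ⟨d, hd, d', hd', hne⟩ := (Set.one_lt_ncard (hfin _)).1 hc
      exact (h2 d hd.1 d' hd'.1 hne u w hw hd.2.1 hd'.2.1).2 hl hd.2.2 hd'.2.2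

/-- The edges `{1, j}` are smaller than the edges `{0, i}`, and they decrease with `j`. -/
structure SmallStar {n : ℕ} (elt : Sym2 (Fin n) → Sym2 (Fin n) → Prop) : Prop where
  asymm : ∀ e f, elt e f → ¬ elt f e
  chain : ∀ o i j : Fin n, o.val = 1 → 2 ≤ i.val → i.val < j.val → elt s(o, j) s(o, i)
  small : ∀ z o i j : Fin n, z.val = 0 → o.val = 1 → 2 ≤ i.val → 2 ≤ j.val →
    elt s(o, j) s(z, i)

lemma GnConflict.of_swap {a b : ℕ} (h : a ≠ b ∧ (a < 2 ∨ b < 2)) :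
    GnConflict a b b a ∨ GnConflict b a a b := by
  unfold GnConflict
  grind

lemma K2Conflict.of_swap {n a b : ℕ} (h : (a < 2 ∧ 2 ≤ b) ∨ (b < 2 ∧ 2 ≤ a)) :
    K2Conflict n a b b a ∨ K2Conflict n b a a b := by
  unfold K2Conflict
  have : a = 0 ∨ a = 1 ∨ b = 0 ∨ b = 1 := by omega
  rcases this with rfl | rfl | rfl | rfl <;> grind

lemma GnConflict.of_three {i a b c d : ℕ} (hi : 2 ≤ i)
    (h : (((a = 0 ∧ b = 1) ∨ (a = 1 ∧ b = i) ∨ (a = i ∧ b = 0)) ∧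
        ((c = 0 ∧ d = 1) ∨ (c = 1 ∧ d = i) ∨ (c = i ∧ d = 0))) ∨
      (((a = 0 ∧ b = i) ∨ (a = i ∧ b = 1) ∨ (a = 1 ∧ b = 0)) ∧
        ((c = 0 ∧ d = i) ∨ (c = i ∧ d = 1) ∨ (c = 1 ∧ d = 0))))
    (hne : ¬ (a = c ∧ b = d)) : GnConflict a b c d ∨ GnConflict c d a b := by
  unfold GnConflict
  rcases h with ⟨h | h | h, h' | h' | h'⟩ | ⟨h | h | h, h' | h' | h'⟩ <;> grind

lemma GnConflict.of_four {i j a b c d : ℕ} (hi : 2 ≤ i) (hj : 2 ≤ j)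
    (h : (a = 0 ∧ b = i) ∨ (a = i ∧ b = 1) ∧ i < j ∨ (a = 1 ∧ b = j) ∧ j < i ∨ (a = j ∧ b = 0))
    (h' : (c = 0 ∧ d = i) ∨ (c = i ∧ d = 1) ∧ i < j ∨ (c = 1 ∧ d = j) ∧ j < i ∨ (c = j ∧ d = 0))
    (hne : ¬ (a = c ∧ b = d)) : GnConflict a b c d ∨ GnConflict c d a b := by
  unfold GnConflict
  rcases h with h | h | h | h <;> rcases h' with h' | h' | h' | h' <;> grind

lemma K2Conflict.of_four {n i j a b c d : ℕ} (hin : i < n) (hjn : j < n) (hi : 2 ≤ i) (hj : 2 ≤ j)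
    (h : (a = 0 ∧ b = i) ∨ (a = i ∧ b = 1) ∧ i < j ∨ (a = 1 ∧ b = j) ∧ j < i ∨ (a = j ∧ b = 0))
    (h' : (c = 0 ∧ d = i) ∨ (c = i ∧ d = 1) ∧ i < j ∨ (c = 1 ∧ d = j) ∧ j < i ∨ (c = j ∧ d = 0))
    (hne : ¬ (a = c ∧ b = d)) : K2Conflict n a b c d ∨ K2Conflict n c d a b := by
  unfold K2Conflict
  rcases h with h | h | h | h <;> rcases h' with h' | h' | h' | h' <;> grind

section Flag

variable {n : ℕ} {G : SimpleGraph (Fin n)} {elt : Sym2 (Fin n) → Sym2 (Fin n) → Prop}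

lemma IsFace.not_both_mem_three (hG : ∀ a b, G.Adj a b → a.val < 2 ∨ b.val < 2)
    {S : Set G.Dart} (hS : IsFace G elt S) {d d' : G.Dart}
    (hd : d ∈ S) (hd' : d' ∈ S) (hne : d ≠ d') {a b c : Fin n}
    (hab : G.Adj a b) (hbc : G.Adj b c) (hca : G.Adj c a)
    (h : d ∈ (Walk.cons hab (.cons hbc (.cons hca .nil))).darts)
    (h' : d' ∈ (Walk.cons hab (.cons hbc (.cons hca .nil))).darts) : False := by
  refine (((isFace_iff_of_conflict hG S).1 hS).2 d hd d' hd' hne a _ ?_ h h').1 rfl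
  have := hab.ne
  have := hbc.ne
  have := hca.ne
  rw [Walk.isCycle_def, Walk.isTrail_def]
  simp
  grind

lemma IsFace.not_both_mem_four (hG : ∀ a b, G.Adj a b → a.val < 2 ∨ b.val < 2)
    (hK : K2Graph n ≤ G) (helt : SmallStar elt)
    {S : Set G.Dart} (hS : IsFace G elt S) {d d' : G.Dart}
    (hd : d ∈ S) (hd' : d' ∈ S) (hne : d ≠ d') {i j : Fin n}
    (hi : 2 ≤ i.val) (hj : 2 ≤ j.val) (hij : i ≠ j)
    (h : IsArc d 0 i ∨ IsArc d i 1 ∧ i < j ∨ IsArc d 1 j ∧ j < i ∨ IsArc d j 0)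
    (h' : IsArc d' 0 i ∨ IsArc d' i 1 ∧ i < j ∨ IsArc d' 1 j ∧ j < i ∨ IsArc d' j 0) :
    False := by
  obtain ⟨z, hz⟩ : ∃ z : Fin n, z.val = 0 := ⟨⟨0, by omega⟩, rfl⟩
  obtain ⟨o, ho⟩ : ∃ o : Fin n, o.val = 1 := ⟨⟨1, by omega⟩, rfl⟩
  have a1 : G.Adj z i := hK (K2Graph_adj.2 (by omega))
  have a2 : G.Adj i o := hK (K2Graph_adj.2 (by omega))
  have a3 : G.Adj o j := hK (K2Graph_adj.2 (by omega))
  have a4 : G.Adj j z := hK (K2Graph_adj.2 (by omega))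
  have hzo : z ≠ o := fun h => by rw [h] at hz; omega
  have key : ∀ d : G.Dart,
      (IsArc d 0 i ∨ IsArc d i 1 ∧ i < j ∨ IsArc d 1 j ∧ j < i ∨ IsArc d j 0) →
      d ∈ (Walk.cons a1 (.cons a2 (.cons a3 (.cons a4 .nil)))).darts ∧
        ∃ e ∈ (Walk.cons a1 (.cons a2 (.cons a3 (.cons a4 .nil)))).edges, elt e d.edge := by
    intro d hd
    simp only [Walk.darts_cons, Walk.darts_nil, List.mem_cons, List.not_mem_nil, or_false,
      Walk.edges_cons, Walk.edges_nil]
    rcases hd with hd | ⟨hd, hlt⟩ | ⟨hd, hlt⟩ | hd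
    · obtain rfl : d = ⟨(z, i), a1⟩ := hd.ext ⟨hz, rfl⟩
      exact ⟨by simp, s(o, j), by simp, helt.small _ _ _ _ hz ho hi hj⟩
    · obtain rfl : d = ⟨(i, o), a2⟩ := hd.ext ⟨rfl, ho⟩
      refine ⟨by simp, s(o, j), by simp, ?_⟩
      rw [Dart.edge_mk, Sym2.eq_swap (a := i)]
      exact helt.chain _ _ _ ho hi hlt
    · obtain rfl : d = ⟨(o, j), a3⟩ := hd.ext ⟨ho, rfl⟩
      refine ⟨by simp, s(o, i), by simp [Sym2.eq_swap], ?_⟩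
      exact helt.chain _ _ _ ho hj hlt
    · obtain rfl : d = ⟨(j, z), a4⟩ := hd.ext ⟨rfl, hz⟩
      refine ⟨by simp, s(o, j), by simp, ?_⟩
      rw [Dart.edge_mk, Sym2.eq_swap (a := j)]
      exact helt.small _ _ _ _ hz ho hj hj
  refine (((isFace_iff_of_conflict hG S).1 hS).2 d hd d' hd' hne z _ ?_ (key d h).1
    (key d' h').1).2 rfl (key d h).2 (key d' h').2
  have := a1.ne
  have := a2.ne
  have := a3.ne
  have := a4.ne
  rw [Walk.isCycle_def, Walk.isTrail_def]
  simp
  grind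

lemma SmallStar.isArc_of_not_min (helt : SmallStar elt)
    {u : Fin n} (w : G.Walk u u) {i j : Fin n} (hi : 2 ≤ i.val) (hj : 2 ≤ j.val)
    (hw : ∀ d ∈ w.darts, IsArc d 0 i ∨ IsArc d i 1 ∨ IsArc d 1 j ∨ IsArc d j 0)
    {d : G.Dart} (hd : d ∈ w.darts) (hmin : ∃ e ∈ w.edges, elt e d.edge) (hij : i ≠ j) :
    IsArc d 0 i ∨ IsArc d i 1 ∧ i < j ∨ IsArc d 1 j ∧ j < i ∨ IsArc d j 0 := by
  obtain ⟨z, hz⟩ : ∃ z : Fin n, z.val = 0 := ⟨⟨0, by omega⟩, rfl⟩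
  obtain ⟨o, ho⟩ : ∃ o : Fin n, o.val = 1 := ⟨⟨1, by omega⟩, rfl⟩
  have edge_eq : ∀ {d : G.Dart} {a b : ℕ} {x y : Fin n}, IsArc d a b → x.val = a → y.val = b →
      d.edge = s(x, y) := by
    rintro d a b x y h hx hy
    have h1 : d.fst = x := Fin.ext (h.1.trans hx.symm)
    have h2 : d.snd = y := Fin.ext (h.2.trans hy.symm)
    rw [← h1, ← h2]
    rfl
  have hirr : ∀ e, ¬ elt e e := fun e he => helt.asymm e e he he
  obtain ⟨e, he, hlt⟩ := hmin
  obtain ⟨d', hd', rfl⟩ := List.mem_map.1 he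
  have hmax : ∀ k l : Fin n, 2 ≤ k.val → k < l → d'.edge = s(z, k) ∨ d'.edge = s(z, l) ∨
      d'.edge = s(o, k) ∨ d'.edge = s(o, l) → ¬ elt d'.edge s(o, l) := by
    intro k l hk hkl h
    rcases h with h | h | h | h <;> rw [h]
    · exact helt.asymm _ _ (helt.small _ _ _ _ hz ho hk (by omega))
    · exact helt.asymm _ _ (helt.small _ _ _ _ hz ho (by omega) (by omega))
    · exact helt.asymm _ _ (helt.chain _ _ _ ho hk hkl)
    · exact hirr _
  have h4 : (d'.edge = s(z, i) ∨ d'.edge = s(z, j)) ∨ d'.edge = s(o, i) ∨ d'.edge = s(o, j) := by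
    rcases hw d' hd' with h | h | h | h
    · exact .inl (.inl (edge_eq h hz rfl))
    · exact .inr (.inl ((edge_eq h rfl ho).trans Sym2.eq_swap))
    · exact .inr (.inr (edge_eq h ho rfl))
    · exact .inl (.inr ((edge_eq h rfl hz).trans Sym2.eq_swap))
  rcases hw d hd with h | h | h | h
  · exact .inl h
  · refine .inr (.inl ⟨h, lt_of_le_of_ne (not_lt.1 fun hji => ?_) hij⟩)
    exact hmax j i hj hji (by tauto) (by rwa [(edge_eq h rfl ho).trans Sym2.eq_swap] at hlt)
  · refine .inr (.inr (.inl ⟨h, lt_of_le_of_ne (not_lt.1 fun hji => ?_) hij.symm⟩))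
    exact hmax i j hi hji (by tauto) (by rwa [edge_eq h ho rfl] at hlt)
  · exact .inr (.inr (.inr h))

lemma isFace_GnGraph_iff (helt : SmallStar elt) (S : Set (GnGraph n).Dart) :
    IsFace (GnGraph n) elt S ↔
      ∀ d ∈ S, ∀ d' ∈ S, ¬ GnConflict d.fst d.snd d'.fst d'.snd := by
  have hG : ∀ a b, (GnGraph n).Adj a b → a.val < 2 ∨ b.val < 2 :=
    fun a b h => (GnGraph_adj.1 h).2
  have hK : K2Graph n ≤ GnGraph n := by
    intro a b h
    rw [GnGraph_adj]
    rw [K2Graph_adj] at h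
    omega
  constructor
  · intro hS d hd d' hd' hc
    have hda := GnGraph_adj.1 d.adj
    have hda' := GnGraph_adj.1 d'.adj
    have hne : d ≠ d' := by
      rintro rfl
      simp only [GnConflict] at hc
      omega
    have four : ∀ i j : Fin n, 2 ≤ i.val → 2 ≤ j.val → i.val ≠ j.val →
        (IsArc d 0 i ∨ IsArc d i 1 ∧ i < j ∨ IsArc d 1 j ∧ j < i ∨ IsArc d j 0) →
        (IsArc d' 0 i ∨ IsArc d' i 1 ∧ i < j ∨ IsArc d' 1 j ∧ j < i ∨ IsArc d' j 0) → False :=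
      fun i j hi hj hij h h' => hS.not_both_mem_four hG hK helt hd hd' hne hi hj
        (fun h => hij (by rw [h])) h h'
    have three : ∀ a b c : Fin n, a.val ≠ b.val → b.val ≠ c.val → c.val ≠ a.val →
        a.val < 2 → b.val < 2 →
        (IsArc d a b ∨ IsArc d b c ∨ IsArc d c a) →
        (IsArc d' a b ∨ IsArc d' b c ∨ IsArc d' c a) → False := by
      intro a b c hab hbc hca ha hb h h'
      have hab := GnGraph_adj.2 ⟨hab, .inl ha⟩
      have hbc := GnGraph_adj.2 ⟨hbc, .inl hb⟩
      have hca := GnGraph_adj.2 ⟨hca, .inr ha⟩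
      have key : ∀ d : (GnGraph n).Dart, (IsArc d a b ∨ IsArc d b c ∨ IsArc d c a) →
          d ∈ (Walk.cons hab (.cons hbc (.cons hca .nil))).darts := by
        rintro d (h | h | h)
        · obtain rfl : d = ⟨(a, b), hab⟩ := h.ext ⟨rfl, rfl⟩
          simp
        · obtain rfl : d = ⟨(b, c), hbc⟩ := h.ext ⟨rfl, rfl⟩
          simp
        · obtain rfl : d = ⟨(c, a), hca⟩ := h.ext ⟨rfl, rfl⟩
          simp
      exact hS.not_both_mem_three hG hd hd' hne hab hbc hca (key d h) (key d' h')
    have anti : d.fst.val = d'.snd.val → d.snd.val = d'.fst.val → False := by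
      intro h1 h2
      refine ((isFace_iff_of_conflict hG S).1 hS).1 d hd ?_
      have : d.symm = d' := IsArc.ext (a := d'.fst) (b := d'.snd) ⟨h2, h1⟩ ⟨rfl, rfl⟩
      rwa [this]
    simp only [IsArc, Fin.lt_def] at four three
    rcases hc with hc | hc | hc | hc | hc | hc
    · by_cases h1 : d.snd.val = 1
      · by_cases h2 : d'.fst.val = 1
        · exact anti (by omega) (by omega)
        · exact three d.fst d.snd d'.fst (by omega) (by omega) (by omega) (by omega) (by omega)
            (by omega) (by omega)
      · by_cases h2 : d'.fst.val = 1
        · exact three d'.fst d'.snd d.snd (by omega) (by omega) (by omega) (by omega) (by omega)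
            (by omega) (by omega)
        · by_cases h3 : d.snd.val = d'.fst.val
          · exact anti (by omega) (by omega)
          · exact four d.snd d'.fst (by omega) (by omega) (by omega) (by omega) (by omega)
    · by_cases h1 : d.snd.val = 1
      · exact three d.fst d.snd d'.snd (by omega) (by omega) (by omega) (by omega) (by omega)
            (by omega) (by omega)
      · exact four d.snd d'.snd (by omega) (by omega) (by omega) (by omega) (by omega)
    · exact three d'.snd d.fst d.snd (by omega) (by omega) (by omega) (by omega) (by omega)
            (by omega) (by omega)
    · exact three d'.snd d.fst d.snd (by omega) (by omega) (by omega) (by omega) (by omega)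
            (by omega) (by omega)
    · by_cases h1 : d'.fst.val = 1
      · exact three d'.fst d'.snd d.fst (by omega) (by omega) (by omega) (by omega) (by omega)
            (by omega) (by omega)
      · exact four d.fst d'.fst (by omega) (by omega) (by omega) (by omega) (by omega)
    · exact anti (by omega) (by omega)
  · intro hc
    rw [isFace_iff_of_conflict hG]
    constructor
    · intro d hd hs
      exact (GnConflict.of_swap (GnGraph_adj.1 d.adj)).elim (hc d hd _ hs) (hc _ hs d hd)
    · intro d hd d' hd' hne u w hw hm hm'
      have hne' : ¬ (d.fst.val = d'.fst.val ∧ d.snd.val = d'.snd.val) :=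
        fun h => hne (IsArc.ext (a := d'.fst) (b := d'.snd) h ⟨rfl, rfl⟩)
      constructor
      · intro hl
        obtain ⟨-, i, hi, h⟩ := isArc_of_isCycle_three hG w hw hl
        exact (GnConflict.of_three hi (h.imp (fun h => ⟨h d hm, h d' hm'⟩)
          (fun h => ⟨h d hm, h d' hm'⟩)) hne').elim (hc d hd d' hd') (hc d' hd' d hd)
      · intro hl hmin hmin'
        obtain ⟨i, j, hi, hj, hij, h⟩ := isArc_of_isCycle_four hG w hw hl
        have k1 := helt.isArc_of_not_min w hi hj h hm hmin hij
        have k2 := helt.isArc_of_not_min w hi hj h hm' hmin' hij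
        exact (GnConflict.of_four hi hj k1 k2 hne').elim
          (hc d hd d' hd') (hc d' hd' d hd)

lemma isFace_K2Graph_iff (helt : SmallStar elt) (S : Set (K2Graph n).Dart) (hn : 4 ≤ n) :
    IsFace (K2Graph n) elt S ↔
      ∀ d ∈ S, ∀ d' ∈ S, ¬ K2Conflict n d.fst d.snd d'.fst d'.snd := by
  have hG : ∀ a b, (K2Graph n).Adj a b → a.val < 2 ∨ b.val < 2 := by
    intro a b h
    rw [K2Graph_adj] at h
    omega
  constructor
  · intro hS d hd d' hd' hc
    have hda := K2Graph_adj.1 d.adj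
    have hda' := K2Graph_adj.1 d'.adj
    have hne : d ≠ d' := by
      rintro rfl
      simp only [K2Conflict] at hc
      omega
    have four : ∀ i j : Fin n, 2 ≤ i.val → 2 ≤ j.val → i.val ≠ j.val →
        (IsArc d 0 i ∨ IsArc d i 1 ∧ i < j ∨ IsArc d 1 j ∧ j < i ∨ IsArc d j 0) →
        (IsArc d' 0 i ∨ IsArc d' i 1 ∧ i < j ∨ IsArc d' 1 j ∧ j < i ∨ IsArc d' j 0) → False :=
      fun i j hi hj hij h h' => hS.not_both_mem_four hG le_rfl helt hd hd' hne hi hj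
        (fun h => hij (by rw [h])) h h'
    have anti : d.fst.val = d'.snd.val → d.snd.val = d'.fst.val → False := by
      intro h1 h2
      refine ((isFace_iff_of_conflict hG S).1 hS).1 d hd ?_
      have : d.symm = d' := IsArc.ext (a := d'.fst) (b := d'.snd) ⟨h2, h1⟩ ⟨rfl, rfl⟩
      rwa [this]
    obtain ⟨last, hlast⟩ : ∃ l : Fin n, l.val + 1 = n := ⟨⟨n - 1, by omega⟩, by simp; omega⟩
    simp only [IsArc, Fin.lt_def] at four
    rcases hc with hc | hc | hc | hc | hc | hc
    · by_cases h3 : d.snd.val = d'.fst.val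
      · exact anti (by omega) (by omega)
      · exact four d.snd d'.fst (by omega) (by omega) (by omega) (by omega) (by omega)
    · exact four d.snd d'.snd (by omega) (by omega) (by omega) (by omega) (by omega)
    · exact four last d.snd (by omega) (by omega) (by omega) (by omega) (by omega)
    · exact four d.snd last (by omega) (by omega) (by omega) (by omega) (by omega)
    · exact four d.fst d'.fst (by omega) (by omega) (by omega) (by omega) (by omega)
    · exact anti (by omega) (by omega)
  · intro hc
    rw [isFace_iff_of_conflict hG]
    constructor
    · intro d hd hs
      exact (K2Conflict.of_swap (K2Graph_adj.1 d.adj)).elim (hc d hd _ hs) (hc _ hs d hd)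
    · intro d hd d' hd' hne u w hw hm hm'
      have hne' : ¬ (d.fst.val = d'.fst.val ∧ d.snd.val = d'.snd.val) :=
        fun h => hne (IsArc.ext (a := d'.fst) (b := d'.snd) h ⟨rfl, rfl⟩)
      constructor
      · intro hl
        obtain ⟨⟨a, b, ha, hb, hab⟩, -⟩ := isArc_of_isCycle_three hG w hw hl
        rw [K2Graph_adj] at hab
        omega
      · intro hl hmin hmin'
        obtain ⟨i, j, hi, hj, hij, h⟩ := isArc_of_isCycle_four hG w hw hl
        have k1 := helt.isArc_of_not_min w hi hj h hm hmin hij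
        have k2 := helt.isArc_of_not_min w hi hj h hm' hmin' hij
        exact (K2Conflict.of_four i.isLt j.isLt hi hj k1 k2 hne').elim
          (hc d hd d' hd') (hc d' hd' d hd)

end Flag

/-- Complexes whose faces are the sets of pairwise non-conflicting vertices are isomorphic
as soon as a bijection of their vertices matches the conflicts. -/
lemma CxIso.of_conflict {A B : Type*} {F : Set (Set A)} {H : Set (Set B)} {V : Set A}
    {r : A → A → Prop} {s : B → B → Prop} {φ : A → B}
    (hF : ∀ S, S ∈ F ↔ S ⊆ V ∧ ∀ x ∈ S, ∀ y ∈ S, ¬ r x y)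
    (hH : ∀ T, T ∈ H ↔ ∀ x ∈ T, ∀ y ∈ T, ¬ s x y)
    (hinj : Set.InjOn φ V) (hsurj : ∀ y, ∃ x ∈ V, φ x = y)
    (hrs : ∀ x ∈ V, ∀ y ∈ V, (r x y ↔ s (φ x) (φ y)))
    (hirr : ∀ y, ¬ s y y) : CxIso F H := by
  have hVF : ⋃₀ F = V := by
    ext x
    constructor
    · rintro ⟨S, hS, hx⟩
      exact ((hF S).1 hS).1 hx
    · intro hx
      refine ⟨{x}, (hF _).2 ⟨by simpa using hx, ?_⟩, rfl⟩
      rintro _ rfl _ rfl h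
      exact hirr _ ((hrs _ hx _ hx).1 h)
  have hVH : ⋃₀ H = Set.univ := by
    refine Set.eq_univ_of_forall fun y => ⟨{y}, (hH _).2 ?_, rfl⟩
    rintro _ rfl _ rfl
    exact hirr _
  refine ⟨φ, ?_, fun S hS => ?_, fun T hT => ?_⟩
  · rw [hVF, hVH]
    exact ⟨fun _ _ => trivial, hinj, fun y _ => hsurj y⟩
  · obtain ⟨hV, h⟩ := (hF S).1 hS
    rw [hH]
    rintro _ ⟨x, hx, rfl⟩ _ ⟨y, hy, rfl⟩ hs
    exact h x hx y hy ((hrs x (hV hx) y (hV hy)).2 hs)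
  · refine ⟨{x | x ∈ V ∧ φ x ∈ T}, (hF _).2 ⟨fun x hx => hx.1, fun x hx y hy h => ?_⟩, ?_⟩
    · exact (hH T).1 hT _ hx.2 _ hy.2 ((hrs x hx.1 y hy.1).1 h)
    · ext y
      constructor
      · rintro ⟨x, hx, rfl⟩
        exact hx.2
      · intro hy
        obtain ⟨x, hx, rfl⟩ := hsurj y
        exact ⟨x, ⟨hx, hy⟩, rfl⟩

lemma mem_contractCx_iff {A : Type*} {F : Set (Set A)} {v w : A}
    (hF : ∀ S ∈ F, ∀ T ⊆ S, T ∈ F) (hvw : v ≠ w) (S : Set A) :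
    S ∈ contractCx F v w ↔ v ∉ S ∧ (S ∈ F ∨ w ∈ S ∧ insert v (S \ {w}) ∈ F) := by
  constructor
  · rintro (⟨h, hv⟩ | ⟨H, hH, hv, rfl⟩)
    · exact ⟨hv, .inl h⟩
    · refine ⟨by simp [hvw], .inr ⟨by simp, hF H hH _ ?_⟩⟩
      rintro x (rfl | ⟨⟨hx, -⟩ | hx, hxw⟩)
      · exact hv
      · exact hx
      · exact absurd hx hxw
  · rintro ⟨hv, h | ⟨hw, h⟩⟩
    · exact .inl ⟨h, hv⟩
    · refine .inr ⟨_, h, Set.mem_insert _ _, ?_⟩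
      ext x
      simp only [Set.mem_union, Set.mem_sdiff, Set.mem_insert_iff, Set.mem_singleton_iff]
      grind

lemma subset_mem_contractCx {A : Type*} {F : Set (Set A)} {v w : A}
    (hF : ∀ S ∈ F, ∀ T ⊆ S, T ∈ F) (hvw : v ≠ w) :
    ∀ S ∈ contractCx F v w, ∀ T ⊆ S, T ∈ contractCx F v w := by
  intro S hS T hT
  rw [mem_contractCx_iff hF hvw] at hS ⊢
  obtain ⟨hv, h⟩ := hS
  refine ⟨fun h => hv (hT h), ?_⟩
  rcases h with h | ⟨-, h⟩
  · exact .inl (hF S h T hT)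
  · by_cases hw : w ∈ T
    · exact .inr ⟨hw, hF _ h _ (Set.insert_subset_insert (Set.sdiff_subset_sdiff_left hT))⟩
    · refine .inl (hF _ h T fun x hx => .inr ⟨hT hx, ?_⟩)
      rintro rfl
      exact hw hx

/-- Conflicts in the join of two points with a complex given by the conflict relation `s`. -/
def joinConflict {B : Type*} (s : B → B → Prop) : Fin 2 ⊕ B → Fin 2 ⊕ B → Prop
  | .inl a, .inl b => a = 0 ∧ b = 1
  | .inr x, .inr y => s x y
  | _, _ => False

lemma mem_joinCx_twoPtCx_iff {B : Type*} {H : Set (Set B)} {s : B → B → Prop}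
    (hH : ∀ T, T ∈ H ↔ ∀ x ∈ T, ∀ y ∈ T, ¬ s x y) (T : Set (Fin 2 ⊕ B)) :
    T ∈ joinCx twoPtCx H ↔ ∀ x ∈ T, ∀ y ∈ T, ¬ joinConflict s x y := by
  constructor
  · rintro ⟨F, hF, K, hK, rfl⟩
    rintro _ (⟨a, ha, rfl⟩ | ⟨x, hx, rfl⟩) _ (⟨b, hb, rfl⟩ | ⟨y, hy, rfl⟩)
    · rintro ⟨rfl, rfl⟩
      rcases hF with rfl | rfl | rfl <;> simp_all
    · exact id
    · exact id
    · exact (hH K).1 hK x hx y hy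
  · intro h
    refine ⟨Sum.inl ⁻¹' T, ?_, Sum.inr ⁻¹' T, ?_, ?_⟩
    · have h01 : ¬ (Sum.inl 0 ∈ T ∧ Sum.inl 1 ∈ T) := fun ⟨h0, h1⟩ => h _ h0 _ h1 ⟨rfl, rfl⟩
      simp only [twoPtCx, Set.mem_ofPred_eq, Set.ext_iff, Fin.forall_fin_two, Set.mem_preimage]
      simp
      tauto
    · exact (hH _).2 fun x hx y hy => h _ hx _ hy
    · ext (a | x) <;> simp

/-- The arc `c → d` is the image of `a → b` under the map sending `0 → 1` to `0 → n - 1` and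
`1 → 0` to `n - 1 → 0`, and fixing all other arcs. -/
def Collapse (n a b c d : ℕ) : Prop :=
  (a = 0 ∧ b = 1 ∧ c = 0 ∧ d + 1 = n) ∨ (a = 1 ∧ b = 0 ∧ c + 1 = n ∧ d = 0) ∨
    (¬ (a < 2 ∧ b < 2) ∧ c = a ∧ d = b)

lemma Collapse.gnConflict_iff {n a b c d a' b' c' d' : ℕ} (hn : 4 ≤ n)
    (h : Collapse n a b a' b') (h' : Collapse n c d c' d')
    (ha : a + 1 < n) (hb : b + 1 < n) (hc : c + 1 < n) (hd : d + 1 < n) :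
    K2Conflict n a' b' c' d' ↔ GnConflict a b c d := by
  unfold K2Conflict GnConflict
  constructor <;> rintro (hK | hK | hK | hK | hK | hK) <;>
    rcases h with ⟨rfl, rfl, rfl, h⟩ | ⟨rfl, rfl, h, rfl⟩ | ⟨h, rfl, rfl⟩ <;>
    rcases h' with ⟨rfl, rfl, rfl, h'⟩ | ⟨rfl, rfl, h', rfl⟩ | ⟨h', rfl, rfl⟩ <;> grind

lemma Collapse.gnConflict_of_k2Conflict {n a b c d a' b' c' d' x y z t : ℕ} (hn : 4 ≤ n)
    (h : Collapse n a b a' b') (h' : Collapse n c d c' d')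
    (hv : ¬ (a = 0 ∧ b + 1 = n)) (hv' : ¬ (a + 1 = n ∧ b = 0))
    (hw : ¬ (c = 0 ∧ d + 1 = n)) (hw' : ¬ (c + 1 = n ∧ d = 0))
    (hx : (x = a ∧ y = b) ∨ (x = a' ∧ y = b')) (hz : (z = c ∧ t = d) ∨ (z = c' ∧ t = d'))
    (hK : K2Conflict n a' b' c' d') : GnConflict x y z t := by
  unfold K2Conflict at hK
  unfold GnConflict
  rcases hK with hK | hK | hK | hK | hK | hK <;>
    rcases h with ⟨rfl, rfl, rfl, h⟩ | ⟨rfl, rfl, h, rfl⟩ | ⟨h, rfl, rfl⟩ <;>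
    rcases h' with ⟨rfl, rfl, rfl, h'⟩ | ⟨rfl, rfl, h', rfl⟩ | ⟨h', rfl, rfl⟩ <;>
    rcases hx with ⟨rfl, rfl⟩ | ⟨rfl, rfl⟩ <;> rcases hz with ⟨rfl, rfl⟩ | ⟨rfl, rfl⟩ <;> grind

lemma Collapse.k2Conflict_of_gnConflict {n a b c d a' b' c' d' x y z t : ℕ} (hn : 4 ≤ n)
    (h : Collapse n a b a' b') (h' : Collapse n c d c' d')
    (hb : b < n) (hd : d < n) (ha : a < n) (hc : c < n)
    (hx : (x = a ∧ y = b) ∨ (x = a' ∧ y = b')) (hz : (z = c ∧ t = d) ∨ (z = c' ∧ t = d'))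
    (hG : GnConflict x y z t) : K2Conflict n a' b' c' d' ∨
      (x = 0 ∧ y = 1 ∧ z = 1 ∧ t + 1 = n) ∨ (x + 1 = n ∧ y = 1 ∧ z = 1 ∧ t = 0) ∨
      (x = 0 ∧ y + 1 = n ∧ z + 1 = n ∧ t = 1) ∨ (x = 1 ∧ y + 1 = n ∧ z + 1 = n ∧ t = 0) := by
  unfold K2Conflict
  rcases hG with hG | hG | hG | hG | hG | hG <;>
    rcases h with ⟨rfl, rfl, rfl, h⟩ | ⟨rfl, rfl, h, rfl⟩ | ⟨h, rfl, rfl⟩ <;>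
    rcases h' with ⟨rfl, rfl, rfl, h'⟩ | ⟨rfl, rfl, h', rfl⟩ | ⟨h', rfl, rfl⟩ <;>
    rcases hx with ⟨rfl, rfl⟩ | ⟨rfl, rfl⟩ <;> rcases hz with ⟨rfl, rfl⟩ | ⟨rfl, rfl⟩ <;> grind

lemma Collapse.exists_dart {n a b : ℕ} (hn : 4 ≤ n) (ha : a < n) (hb : b < n) (hab : a ≠ b)
    (h : a < 2 ∨ b < 2) : ∃ d : (K2Graph n).Dart, Collapse n a b d.fst d.snd := by
  have key : ∀ c d, c < n → d < n → ((c < 2 ∧ 2 ≤ d) ∨ (d < 2 ∧ 2 ≤ c)) → Collapse n a b c d →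
      ∃ d : (K2Graph n).Dart, Collapse n a b d.fst d.snd := by
    intro c d hc hd h hcol
    exact ⟨⟨(⟨c, hc⟩, ⟨d, hd⟩), K2Graph_adj.2 h⟩, hcol⟩
  by_cases h2 : a < 2 ∧ b < 2
  · by_cases h0 : a = 0
    · exact key 0 (n - 1) (by omega) (by omega) (by omega) (.inl (by omega))
    · exact key (n - 1) 0 (by omega) (by omega) (by omega) (.inr (.inl (by omega)))
  · exact key a b ha hb (by omega) (.inr (.inr ⟨h2, rfl, rfl⟩))

/-- The map collapsing the arcs of `G_n` to arcs of `K_{2,n-2}`. -/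
lemma exists_collapse_map {n : ℕ} (hn : 4 ≤ n) : ∃ φ : (GnGraph n).Dart → (K2Graph n).Dart,
    ∀ x, Collapse n x.fst x.snd (φ x).fst (φ x).snd :=
  ⟨_, fun x => (Collapse.exists_dart hn x.fst.isLt x.snd.isLt (GnGraph_adj.1 x.adj).1
    (GnGraph_adj.1 x.adj).2).choose_spec⟩

lemma SmallStar.of_hypotheses {n : ℕ} (hn : 1 < n) {elt : Sym2 (Fin n) → Sym2 (Fin n) → Prop}
    (hord : IsStrictTotalOrder (Sym2 (Fin n)) elt)
    (hchain : ∀ b b' : Fin n, 2 ≤ b.val → 2 ≤ b'.val → b'.val < b.val →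
      elt s((⟨1, hn⟩ : Fin n), b) s((⟨1, hn⟩ : Fin n), b'))
    (hsmall : ∀ b : Fin n, 2 ≤ b.val → ∀ e ∈ (GnGraph n).edgeSet,
      (¬ ∃ b' : Fin n, 2 ≤ b'.val ∧ e = s((⟨1, hn⟩ : Fin n), b')) →
        elt s((⟨1, hn⟩ : Fin n), b) e) : SmallStar elt where
  asymm _ _ h h' := irrefl_of elt _ (trans_of elt h h')
  chain o i j ho hi hij := by
    obtain rfl : o = ⟨1, hn⟩ := Fin.ext ho
    exact hchain j i (by omega) hi hij
  small z o i j hz ho hi hj := by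
    obtain rfl : o = ⟨1, hn⟩ := Fin.ext ho
    refine hsmall j hj _ ?_ ?_
    · rw [SimpleGraph.mem_edgeSet, GnGraph_adj]
      omega
    · rintro ⟨b', -, h⟩
      simp only [Sym2.eq_iff, Fin.ext_iff] at h
      omega

lemma exists_isArc {n : ℕ} {G : SimpleGraph (Fin n)} {a b : ℕ} (ha : a < n) (hb : b < n)
    (h : G.Adj ⟨a, ha⟩ ⟨b, hb⟩) : ∃ d : G.Dart, IsArc d a b :=
  ⟨⟨(_, _), h⟩, rfl, rfl⟩

/-- The correspondence between the arcs of `K_{2,n-2}` and the vertices of the join of two points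
with the arcs of `G_{n-1}`. -/
def JoinRel {n : ℕ} (d : (K2Graph n).Dart) : Fin 2 ⊕ (GnGraph (n - 1)).Dart → Prop
  | .inl k => (k = 0 ∧ IsArc d (n - 1) 1) ∨ (k = 1 ∧ IsArc d 1 (n - 1))
  | .inr x => Collapse n x.fst x.snd d.fst d.snd

lemma exists_joinRel {n : ℕ} (hn : 4 ≤ n) (d : (K2Graph n).Dart) : ∃ e, JoinRel d e := by
  have hd := K2Graph_adj.1 d.adj
  have h1 := d.fst.isLt
  have h2 := d.snd.isLt
  have key : ∀ a b, a + 1 < n → b + 1 < n → a ≠ b → (a < 2 ∨ b < 2) →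
      Collapse n a b d.fst d.snd → ∃ e, JoinRel d e := by
    intro a b ha hb hab h2 hc
    obtain ⟨x, rfl, rfl⟩ := exists_isArc (G := GnGraph (n - 1)) (a := a) (b := b)
      (by omega) (by omega) (GnGraph_adj.2 ⟨hab, h2⟩)
    exact ⟨.inr x, hc⟩
  by_cases hl : d.fst.val + 1 < n ∧ d.snd.val + 1 < n
  · exact key _ _ hl.1 hl.2 (by omega) (by omega) (.inr (.inr ⟨by omega, rfl, rfl⟩))
  · by_cases h : d.fst.val = 0
    · exact key 0 1 (by omega) (by omega) (by omega) (by omega) (.inl (by omega))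
    by_cases h : d.snd.val = 0
    · exact key 1 0 (by omega) (by omega) (by omega) (by omega) (.inr (.inl (by omega)))
    by_cases h : d.snd.val = 1
    · exact ⟨.inl 0, .inl ⟨rfl, by omega, h⟩⟩
    · exact ⟨.inl 1, .inr ⟨rfl, by omega, by omega⟩⟩

lemma exists_of_joinRel {n : ℕ} (hn : 4 ≤ n) (e : Fin 2 ⊕ (GnGraph (n - 1)).Dart) :
    ∃ d : (K2Graph n).Dart, JoinRel d e := by
  have key : ∀ a b, a < n → b < n → ((a < 2 ∧ 2 ≤ b) ∨ (b < 2 ∧ 2 ≤ a)) →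
      ∃ d : (K2Graph n).Dart, IsArc d a b :=
    fun a b ha hb h => exists_isArc ha hb (K2Graph_adj.2 h)
  match e with
  | .inl 0 =>
    obtain ⟨d, hd⟩ := key (n - 1) 1 (by omega) (by omega) (by omega)
    exact ⟨d, .inl ⟨rfl, hd⟩⟩
  | .inl 1 =>
    obtain ⟨d, hd⟩ := key 1 (n - 1) (by omega) (by omega) (by omega)
    exact ⟨d, .inr ⟨rfl, hd⟩⟩
  | .inr x =>
    have hx := GnGraph_adj.1 x.adj
    exact Collapse.exists_dart hn (by omega) (by omega) hx.1 hx.2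

lemma JoinRel.left_unique {n : ℕ} {d d' : (K2Graph n).Dart}
    {e : Fin 2 ⊕ (GnGraph (n - 1)).Dart} (h : JoinRel d e) (h' : JoinRel d' e) : d = d' := by
  match e with
  | .inl k =>
    rcases h with ⟨rfl, h⟩ | ⟨rfl, h⟩ <;> rcases h' with ⟨h0, h'⟩ | ⟨h0, h'⟩
    · exact h.ext h'
    · cases h0
    · cases h0
    · exact h.ext h'
  | .inr x =>
    unfold JoinRel Collapse at h h'
    refine IsArc.ext (a := d.fst) (b := d.snd) ⟨rfl, rfl⟩ ⟨?_, ?_⟩ <;> omega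

lemma JoinRel.right_unique {n : ℕ} {d : (K2Graph n).Dart}
    {e e' : Fin 2 ⊕ (GnGraph (n - 1)).Dart} (hn : 4 ≤ n) (h : JoinRel d e) (h' : JoinRel d e') :
    e = e' := by
  match e, e' with
  | .inl k, .inl k' =>
    rcases h with ⟨rfl, h⟩ | ⟨rfl, h⟩ <;> rcases h' with ⟨rfl, h'⟩ | ⟨rfl, h'⟩ <;>
      simp only [IsArc] at h h' <;> first | rfl | omega
  | .inr x, .inr y =>
    have := K2Graph_adj.1 d.adj
    unfold JoinRel Collapse at h h'
    congr 1
    refine IsArc.ext (a := x.fst) (b := x.snd) ⟨rfl, rfl⟩ ⟨?_, ?_⟩ <;> omega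
  | .inl k, .inr y =>
    unfold JoinRel Collapse at h'
    rcases h with ⟨rfl, h⟩ | ⟨rfl, h⟩ <;> simp only [IsArc] at h <;> omega
  | .inr x, .inl k =>
    unfold JoinRel Collapse at h
    rcases h' with ⟨rfl, h'⟩ | ⟨rfl, h'⟩ <;> simp only [IsArc] at h' <;> omega

lemma JoinRel.k2Conflict_iff {n : ℕ} {d d' : (K2Graph n).Dart}
    {e e' : Fin 2 ⊕ (GnGraph (n - 1)).Dart} (hn : 4 ≤ n) (h : JoinRel d e) (h' : JoinRel d' e') :
    K2Conflict n d.fst d.snd d'.fst d'.snd ↔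
      joinConflict (fun x y : (GnGraph (n - 1)).Dart => GnConflict x.fst x.snd y.fst y.snd)
        e e' := by
  match e, e' with
  | .inl k, .inl k' =>
    unfold K2Conflict
    rcases h with ⟨rfl, h⟩ | ⟨rfl, h⟩ <;> rcases h' with ⟨rfl, h'⟩ | ⟨rfl, h'⟩ <;>
      simp only [IsArc] at h h' <;> simp [joinConflict] <;> omega
  | .inr x, .inr y =>
    exact Collapse.gnConflict_iff hn h h' (by omega) (by omega) (by omega) (by omega)
  | .inl k, .inr y =>
    have := y.fst.isLt
    have := y.snd.isLt
    unfold JoinRel Collapse at h'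
    unfold K2Conflict
    simp only [joinConflict, iff_false]
    rcases h with ⟨rfl, h⟩ | ⟨rfl, h⟩ <;> simp only [IsArc] at h <;> omega
  | .inr x, .inl k =>
    have := x.fst.isLt
    have := x.snd.isLt
    unfold JoinRel Collapse at h
    unfold K2Conflict
    simp only [joinConflict, iff_false]
    rcases h' with ⟨rfl, h'⟩ | ⟨rfl, h'⟩ <;> simp only [IsArc] at h' <;> omega

lemma cxIso_K2Graph_joinCx {n : ℕ} (hn : 4 ≤ n) {elt : Sym2 (Fin n) → Sym2 (Fin n) → Prop}
    {elt' : Sym2 (Fin (n - 1)) → Sym2 (Fin (n - 1)) → Prop} (helt : SmallStar elt)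
    (helt' : SmallStar elt') :
    CxIso (faceCx (K2Graph n) elt) (joinCx twoPtCx (faceCx (GnGraph (n - 1)) elt')) := by
  choose φ hφ using fun d : (K2Graph n).Dart => exists_joinRel hn d
  have hH := mem_joinCx_twoPtCx_iff (H := faceCx (GnGraph (n - 1)) elt')
    (isFace_GnGraph_iff helt')
  have hsurj : ∀ e, ∃ d, φ d = e := fun e =>
    let ⟨d, hd⟩ := exists_of_joinRel hn e
    ⟨d, (hφ d).right_unique hn hd⟩
  refine CxIso.of_conflict (V := Set.univ) (φ := φ)
    (r := fun d d' => K2Conflict n d.fst d.snd d'.fst d'.snd)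
    (fun S => (isFace_K2Graph_iff helt S hn).trans (by simp)) hH ?_ ?_ ?_ ?_
  · intro d _ d' _ h
    exact (hφ d).left_unique (h ▸ hφ d')
  · intro e
    obtain ⟨d, hd⟩ := hsurj e
    exact ⟨d, trivial, hd⟩
  · intro d _ d' _
    exact (hφ d).k2Conflict_iff hn (hφ d')
  · intro e he
    obtain ⟨d, rfl⟩ := hsurj e
    have h := ((hφ d).k2Conflict_iff hn (hφ d)).2 he
    unfold K2Conflict at h
    omega

section Contraction

variable {n : ℕ} {elt : Sym2 (Fin n) → Sym2 (Fin n) → Prop} {v w v' w' : (GnGraph n).Dart}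
  {φ : (GnGraph n).Dart → (K2Graph n).Dart}

lemma not_k2Conflict_of_mem_contractCx (hn : 4 ≤ n)
    (helt : SmallStar elt) (hφ : ∀ x, Collapse n x.fst x.snd (φ x).fst (φ x).snd)
    (hv : IsArc v 0 (n - 1)) (hw : IsArc w 0 1) (hv' : IsArc v' (n - 1) 0) (hw' : IsArc w' 1 0)
    {S : Set (GnGraph n).Dart} (hvS : v ∉ S) (hv'S : v' ∉ S) {H : Set (GnGraph n).Dart}
    (hH : H ∈ faceCx (GnGraph n) elt)
    (hSH : ∀ x ∈ S, x ∈ H ∨ x = w ∧ v ∈ H ∨ x = w' ∧ v' ∈ H) :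
    ∀ x ∈ S, ∀ y ∈ S, ¬ K2Conflict n (φ x).fst (φ x).snd (φ y).fst (φ y).snd := by
  have hrep : ∀ x ∈ S, ∃ y ∈ H, (y.fst.val = x.fst ∧ y.snd.val = x.snd) ∨
      (y.fst.val = (φ x).fst ∧ y.snd.val = (φ x).snd) := by
    intro x hx
    rcases hSH x hx with h | ⟨rfl, h⟩ | ⟨rfl, h⟩
    · exact ⟨x, h, .inl ⟨rfl, rfl⟩⟩
    · refine ⟨v, h, .inr ?_⟩
      have := hφ x
      unfold Collapse IsArc at *
      omega
    · refine ⟨v', h, .inr ?_⟩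
      have := hφ x
      unfold Collapse IsArc at *
      omega
  have hV : ∀ x ∈ S, ¬ (x.fst.val = 0 ∧ x.snd.val + 1 = n) ∧
      ¬ (x.fst.val + 1 = n ∧ x.snd.val = 0) := by
    refine fun x hx => ⟨fun h => hvS ?_, fun h => hv'S ?_⟩
    · rwa [hv.ext (e := x) ⟨by omega, by omega⟩]
    · rwa [hv'.ext (e := x) ⟨by omega, by omega⟩]
  intro x hx y hy hK
  obtain ⟨x₁, hx₁, hxx⟩ := hrep x hx
  obtain ⟨y₁, hy₁, hyy⟩ := hrep y hy
  exact (isFace_GnGraph_iff helt H).1 hH x₁ hx₁ y₁ hy₁ (Collapse.gnConflict_of_k2Conflict hn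
    (hφ x) (hφ y) (hV x hx).1 (hV x hx).2 (hV y hy).1 (hV y hy).2 hxx hyy hK)

/-- A set of arcs whose images do not conflict has a face of `Δ_{G_n}` above it, as soon as the
exceptional pairs of arcs are avoided. -/
lemma mem_faceCx_of_not_k2Conflict (hn : 4 ≤ n)
    (helt : SmallStar elt) (hφ : ∀ x, Collapse n x.fst x.snd (φ x).fst (φ x).snd)
    (hv : IsArc v 0 (n - 1)) (hw : IsArc w 0 1) (hv' : IsArc v' (n - 1) 0) (hw' : IsArc w' 1 0)
    {S H : Set (GnGraph n).Dart}
    (hS : ∀ x ∈ S, ∀ y ∈ S, ¬ K2Conflict n (φ x).fst (φ x).snd (φ y).fst (φ y).snd)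
    (hHS : ∀ x ∈ H, x ∈ S ∨ x = v ∧ w ∈ S ∨ x = v' ∧ w' ∈ S)
    (h₁ : ∀ x ∈ S, IsArc x 1 (n - 1) → w ∉ H ∧ v' ∉ H)
    (h₂ : ∀ x ∈ S, IsArc x (n - 1) 1 → v ∉ H ∧ w' ∉ H) :
    H ∈ faceCx (GnGraph n) elt := by
  have hrep : ∀ x ∈ H, ∃ y ∈ S, (x.fst.val = y.fst ∧ x.snd.val = y.snd) ∨
      (x.fst.val = (φ y).fst ∧ x.snd.val = (φ y).snd) := by
    intro x hx
    rcases hHS x hx with h | ⟨rfl, h⟩ | ⟨rfl, h⟩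
    · exact ⟨x, h, .inl ⟨rfl, rfl⟩⟩
    · refine ⟨w, h, .inr ?_⟩
      have := hφ w
      unfold Collapse IsArc at *
      omega
    · refine ⟨w', h, .inr ?_⟩
      have := hφ w'
      unfold Collapse IsArc at *
      omega
  have hmem : ∀ x ∈ H, (IsArc x 1 (n - 1) ∨ IsArc x (n - 1) 1) → x ∈ S := by
    intro x hx h
    rcases hHS x hx with hx | ⟨rfl, -⟩ | ⟨rfl, -⟩
    · exact hx
    all_goals
      unfold IsArc at *
      omega
  refine (isFace_GnGraph_iff helt H).2 fun x hx y hy hG => ?_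
  obtain ⟨x₁, hx₁, hxx⟩ := hrep x hx
  obtain ⟨y₁, hy₁, hyy⟩ := hrep y hy
  rcases Collapse.k2Conflict_of_gnConflict hn (hφ x₁) (hφ y₁) x₁.snd.isLt y₁.snd.isLt
    x₁.fst.isLt y₁.fst.isLt hxx hyy hG with h | h | h | h | h
  · exact hS x₁ hx₁ y₁ hy₁ h
  · have hy1 : IsArc y 1 (n - 1) := ⟨by omega, by omega⟩
    refine (h₁ y (hmem y hy (.inl hy1)) hy1).1 ?_
    rwa [hw.ext (e := x) ⟨by omega, by omega⟩]
  · have hx1 : IsArc x (n - 1) 1 := ⟨by omega, by omega⟩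
    refine (h₂ x (hmem x hx (.inr hx1)) hx1).2 ?_
    rwa [hw'.ext (e := y) ⟨by omega, by omega⟩]
  · have hy1 : IsArc y (n - 1) 1 := ⟨by omega, by omega⟩
    refine (h₂ y (hmem y hy (.inr hy1)) hy1).1 ?_
    rwa [hv.ext (e := x) ⟨by omega, by omega⟩]
  · have hx1 : IsArc x 1 (n - 1) := ⟨by omega, by omega⟩
    refine (h₁ x (hmem x hx (.inl hx1)) hx1).2 ?_
    rwa [hv'.ext (e := y) ⟨by omega, by omega⟩]

lemma mem_contractCx_contractCx_iff (hn : 4 ≤ n)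
    (helt : SmallStar elt) (hφ : ∀ x, Collapse n x.fst x.snd (φ x).fst (φ x).snd)
    (hv : IsArc v 0 (n - 1)) (hw : IsArc w 0 1) (hv' : IsArc v' (n - 1) 0) (hw' : IsArc w' 1 0)
    (S : Set (GnGraph n).Dart) :
    S ∈ contractCx (contractCx (faceCx (GnGraph n) elt) v w) v' w' ↔ S ⊆ {x | x ≠ v ∧ x ≠ v'} ∧
      ∀ x ∈ S, ∀ y ∈ S, ¬ K2Conflict n (φ x).fst (φ x).snd (φ y).fst (φ y).snd := by
  have hF : ∀ S ∈ faceCx (GnGraph n) elt, ∀ T ⊆ S, T ∈ faceCx (GnGraph n) elt := by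
    intro S hS T hT
    refine (isFace_GnGraph_iff helt T).2 fun x hx y hy => ?_
    exact (isFace_GnGraph_iff helt S).1 hS x (hT hx) y (hT hy)
  have hvw : v ≠ w := by
    rintro rfl
    unfold IsArc at *
    omega
  have hvw' : v' ≠ w' := by
    rintro rfl
    unfold IsArc at *
    omega
  have hv'w : v' ≠ w := by
    rintro rfl
    unfold IsArc at *
    omega
  have hvv' : v ≠ v' := by
    rintro rfl
    unfold IsArc at *
    omega
  have hww' : w ≠ w' := by
    rintro rfl
    unfold IsArc at *
    omega
  rw [mem_contractCx_iff (subset_mem_contractCx hF hvw) hvw']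
  simp only [mem_contractCx_iff hF hvw]
  constructor
  · rintro ⟨hv'S, h⟩
    have hvS : v ∉ S := by
      rcases h with h | h
      · exact h.1
      · intro hvS
        exact h.2.1 (.inr ⟨hvS, by rintro rfl; unfold IsArc at *; omega⟩)
    refine ⟨fun x hx => ⟨ne_of_mem_of_not_mem hx hvS, ne_of_mem_of_not_mem hx hv'S⟩, ?_⟩
    have main := fun H => not_k2Conflict_of_mem_contractCx (H := H) hn helt hφ hv hw hv' hw' hvS hv'S
    rcases h with ⟨-, h | ⟨-, h⟩⟩ | ⟨-, -, h | ⟨-, h⟩⟩ <;>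
    · refine main _ h fun x hx => ?_
      by_cases x = w <;> by_cases x = w' <;> simp_all
  · rintro ⟨hSV, hS⟩
    have hvS : v ∉ S := fun h => (hSV h).1 rfl
    have hv'S : v' ∉ S := fun h => (hSV h).2 rfl
    refine ⟨hv'S, ?_⟩
    have main := fun H => mem_faceCx_of_not_k2Conflict (H := H) hn helt hφ hv hw hv' hw' hS
    have hconf : ∀ x ∈ S, ∀ y ∈ S, IsArc x 1 (n - 1) → IsArc y (n - 1) 1 → False := by
      intro x hx y hy h h'
      have h1 := hφ x
      have h2 := hφ y
      unfold Collapse at h1 h2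
      unfold IsArc at h h'
      exact hS y hy x hx (.inr (.inr (.inr (.inr (.inr (by omega))))))
    have hconf' : w ∈ S → w' ∈ S → False := by
      intro h h'
      have h1 := hφ w
      have h2 := hφ w'
      unfold Collapse at h1 h2
      unfold IsArc at hw hw'
      exact hS w h w' h' (.inl (by omega))
    by_cases hP : w ∈ S ∧ ∃ x ∈ S, IsArc x 1 (n - 1)
    · obtain ⟨hwS, x₁, hx₁, hx₁'⟩ := hP
      refine .inl ⟨hvS, .inr ⟨hwS, main _ ?_ ?_ ?_⟩⟩
      · rintro x (rfl | hx)
        · exact .inr (.inl ⟨rfl, hwS⟩)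
        · exact .inl hx.1
      · intro _ _ _
        simp [hvw.symm, hvv'.symm, hv'S]
      · intro x hx h
        exact (hconf x₁ hx₁ x hx hx₁' h).elim
    · by_cases hP' : w' ∈ S ∧ ∃ x ∈ S, IsArc x (n - 1) 1
      · obtain ⟨hwS, x₁, hx₁, hx₁'⟩ := hP'
        refine .inr ⟨hwS, by simp [hvv', hvS], .inl (main _ ?_ ?_ ?_)⟩
        · rintro x (rfl | hx)
          · exact .inr (.inr ⟨rfl, hwS⟩)
          · exact .inl hx.1
        · intro x hx h
          exact (hconf x hx x₁ hx₁ h hx₁').elim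
        · intro _ _ _
          simp [hvw'.symm, hvv', hvS]
      · refine .inl ⟨hvS, .inl (main S (fun _ h => .inl h) ?_ ?_)⟩
        · exact fun x hx h => ⟨fun hw => hP ⟨hw, x, hx, h⟩, hv'S⟩
        · exact fun x hx h => ⟨hvS, fun hw => hP' ⟨hw, x, hx, h⟩⟩

lemma cxIso_contractCx_K2Graph (hn : 4 ≤ n) (helt : SmallStar elt)
    (hv : IsArc v 0 (n - 1)) (hw : IsArc w 0 1) (hv' : IsArc v' (n - 1) 0) (hw' : IsArc w' 1 0) :
    CxIso (contractCx (contractCx (faceCx (GnGraph n) elt) v w) v' w')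
      (faceCx (K2Graph n) elt) := by
  obtain ⟨φ, hφ⟩ := exists_collapse_map hn
  refine CxIso.of_conflict (φ := φ) (mem_contractCx_contractCx_iff hn helt hφ hv hw hv' hw')
    (fun T => isFace_K2Graph_iff helt T hn) ?_ ?_ (fun _ _ _ _ => Iff.rfl) ?_
  · intro x hx y hy h
    have h1 := hφ x
    have h2 := hφ y
    rw [← h] at h2
    have hV : ∀ x, x ≠ v ∧ x ≠ v' → ¬ (x.fst.val = 0 ∧ x.snd.val + 1 = n) ∧
        ¬ (x.fst.val + 1 = n ∧ x.snd.val = 0) := by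
      refine fun x hx => ⟨fun h => hx.1 ?_, fun h => hx.2 ?_⟩
      · exact IsArc.ext ⟨by omega, by omega⟩ hv
      · exact IsArc.ext ⟨by omega, by omega⟩ hv'
    have hx := hV x hx
    have hy := hV y hy
    refine IsArc.ext (a := x.fst) (b := x.snd) ⟨rfl, rfl⟩ ⟨?_, ?_⟩ <;> unfold Collapse at * <;>
      omega
  · intro y
    have hy := K2Graph_adj.1 y.adj
    have key : ∀ x, x ≠ v ∧ x ≠ v' → Collapse n x.fst x.snd y.fst y.snd →
        ∃ x ∈ {x | x ≠ v ∧ x ≠ v'}, φ x = y := by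
      intro x hx h
      have h' := hφ x
      refine ⟨x, hx, IsArc.ext (a := y.fst) (b := y.snd) ⟨?_, ?_⟩ ⟨rfl, rfl⟩⟩ <;>
        unfold Collapse at * <;> omega
    have hne : ∀ {a b : ℕ} (x : (GnGraph n).Dart), IsArc x a b → ¬ (a = 0 ∧ b = n - 1) →
        ¬ (a = n - 1 ∧ b = 0) → x ≠ v ∧ x ≠ v' := by
      intro a b x hx h h'
      constructor <;> rintro rfl <;> unfold IsArc at * <;> omega
    by_cases h0 : y.fst.val = 0 ∧ y.snd.val = n - 1
    · refine key w (hne w hw (by omega) (by omega)) (.inl ?_)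
      unfold IsArc at hw
      omega
    by_cases h1 : y.fst.val = n - 1 ∧ y.snd.val = 0
    · refine key w' (hne w' hw' (by omega) (by omega)) (.inr (.inl ?_))
      unfold IsArc at hw'
      omega
    obtain ⟨x, hx⟩ := exists_isArc (G := GnGraph n) y.fst.isLt y.snd.isLt
      (GnGraph_adj.2 (by simp only; omega))
    refine key x (hne x hx h0 h1) (.inr (.inr ?_))
    unfold IsArc at hx
    omega
  · intro y h
    unfold K2Conflict at h
    omega

end Contraction

open Filter in
theorem stmt10 (n : ℕ) (hn : 4 ≤ n)
    (elt : Sym2 (Fin n) → Sym2 (Fin n) → Prop)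
    (hord : IsStrictTotalOrder (Sym2 (Fin n)) elt)
    (hchain : ∀ b b' : Fin n, 2 ≤ b.val → 2 ≤ b'.val → b'.val < b.val →
      elt s((⟨1, by omega⟩ : Fin n), b) s((⟨1, by omega⟩ : Fin n), b'))
    (hsmall : ∀ b : Fin n, 2 ≤ b.val → ∀ e ∈ (GnGraph n).edgeSet,
      (¬ ∃ b' : Fin n, 2 ≤ b'.val ∧ e = s((⟨1, by omega⟩ : Fin n), b')) →
        elt s((⟨1, by omega⟩ : Fin n), b) e)
    (elt' : Sym2 (Fin (n - 1)) → Sym2 (Fin (n - 1)) → Prop)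
    (hord' : IsStrictTotalOrder (Sym2 (Fin (n - 1))) elt')
    (hchain' : ∀ b b' : Fin (n - 1), 2 ≤ b.val → 2 ≤ b'.val → b'.val < b.val →
      elt' s((⟨1, by omega⟩ : Fin (n - 1)), b) s((⟨1, by omega⟩ : Fin (n - 1)), b'))
    (hsmall' : ∀ b : Fin (n - 1), 2 ≤ b.val → ∀ e ∈ (GnGraph (n - 1)).edgeSet,
      (¬ ∃ b' : Fin (n - 1), 2 ≤ b'.val ∧ e = s((⟨1, by omega⟩ : Fin (n - 1)), b')) →
        elt' s((⟨1, by omega⟩ : Fin (n - 1)), b) e)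
    (d01 d10 d0last dlast0 : (GnGraph n).Dart)
    (hd01 : d01.toProd = (⟨0, by omega⟩, ⟨1, by omega⟩))
    (hd10 : d10.toProd = (⟨1, by omega⟩, ⟨0, by omega⟩))
    (hd0last : d0last.toProd = (⟨0, by omega⟩, ⟨n - 1, by omega⟩))
    (hdlast0 : dlast0.toProd = (⟨n - 1, by omega⟩, ⟨0, by omega⟩)) :
    CxIso (faceCx (K2Graph n) elt) (joinCx twoPtCx (faceCx (GnGraph (n - 1)) elt')) ∧
      CxIso (contractCx (contractCx (faceCx (GnGraph n) elt) d0last d01) dlast0 d10)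
        (faceCx (K2Graph n) elt) := by
  have helt := SmallStar.of_hypotheses (by omega) hord hchain hsmall
  refine ⟨cxIso_K2Graph_joinCx hn helt (.of_hypotheses (by omega) hord' hchain' hsmall'),
    cxIso_contractCx_K2Graph hn helt ?_ ?_ ?_ ?_⟩ <;>
    simp [IsArc, *]

end SEP
end
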